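/- In the non-degenerate case ρσ > 0, for every 0 < t < ∞ the following filtration relations hold, with the single inclusion strict: 𝔉^{(V₁,V₂)}(t) = 𝔉^{(R₁,R₂)}(t) = 𝔉^{(|Y|,V)}(t) = 𝔉^{(|Y|,Q)}(t) ⊊ 𝔉^{(X₁,X₂)}(t) = 𝔉^{(W₁,W₂)}(t) = 𝔉^{(Y,V)}(t) = 𝔉^{(W,U♭)}(t) = 𝔉^{(Y,U♭)}(t) = 𝔉^{(W,Q)}(t) = 𝔉^{(Y,Q)}(t). -/

import Mathlib

open MeasureTheory ProbabilityTheory Filter Set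

noncomputable section

namespace SDEPaper

/-- The signum convention of the paper: `psgn y = 1` for `y > 0`, `= -1` for `y ≤ 0`. -/
def psgn (y : ℝ) : ℝ := if 0 < y then 1 else -1

variable {Ω : Type*} [m : MeasurableSpace Ω]

/-- The σ-algebra generated by the process `Ξ` on the time interval `[0, t]`. -/
def natSA {E : Type*} [MeasurableSpace E] (Ξ : ℝ → Ω → E) (t : ℝ) : MeasurableSpace Ω :=
  ⨆ s ∈ Icc (0 : ℝ) t, MeasurableSpace.comap (Ξ s) inferInstance

/-- The `μ`-augmentation of a σ-algebra. -/
def augSA (μ : Measure Ω) (m' : MeasurableSpace Ω) : MeasurableSpace Ω :=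
  m' ⊔ MeasurableSpace.generateFrom {A : Set Ω | μ A = 0}

/-- `𝔉^Ξ(t)`: the `μ`-augmented σ-algebra generated by the process `Ξ` up to time `t`. -/
def natFilt {E : Type*} [MeasurableSpace E] (μ : Measure Ω) (Ξ : ℝ → Ω → E) (t : ℝ) :
    MeasurableSpace Ω := augSA μ (natSA Ξ t)

/-- Dyadic left-point Riemann sum of `H` against `X` on `[0,t]`. -/
def rsum (H X : ℝ → Ω → ℝ) (t : ℝ) (n : ℕ) (ω : Ω) : ℝ :=
  ∑ i ∈ Finset.range (2 ^ n),
    H (t * i / 2 ^ n) ω * (X (t * (i + 1) / 2 ^ n) ω - X (t * i / 2 ^ n) ω)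

/-- `I = ∫₀^· H dX`: dyadic Riemann sums converge in probability, and `I 0 = 0` a.s. -/
def IsSI (μ : Measure Ω) (H X I : ℝ → Ω → ℝ) : Prop :=
  (∀ᵐ ω ∂μ, I 0 ω = 0) ∧
  ∀ t : ℝ, 0 ≤ t → TendstoInMeasure μ (fun n => rsum H X t n) atTop (I t)

/-- `I = ∫₀^· H₁ dX₁ + ∫₀^· H₂ dX₂` in the sense of convergence in probability
of dyadic Riemann sums. -/
def IsSI2 (μ : Measure Ω) (H₁ X₁ H₂ X₂ I : ℝ → Ω → ℝ) : Prop :=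
  (∀ᵐ ω ∂μ, I 0 ω = 0) ∧
  ∀ t : ℝ, 0 ≤ t →
    TendstoInMeasure μ (fun n ω => rsum H₁ X₁ t n ω + rsum H₂ X₂ t n ω) atTop (I t)

/-- Dyadic sums of products of increments. -/
def qsum (X Y : ℝ → Ω → ℝ) (t : ℝ) (n : ℕ) (ω : Ω) : ℝ :=
  ∑ i ∈ Finset.range (2 ^ n),
    (X (t * (i + 1) / 2 ^ n) ω - X (t * i / 2 ^ n) ω) *
      (Y (t * (i + 1) / 2 ^ n) ω - Y (t * i / 2 ^ n) ω)

/-- `C = ⟨X,Y⟩`: the quadratic covariation, as a limit in probability of dyadic sums. -/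
def IsQV (μ : Measure Ω) (X Y C : ℝ → Ω → ℝ) : Prop :=
  ∀ t : ℝ, 0 ≤ t → TendstoInMeasure μ (fun n => qsum X Y t n) atTop (C t)

/-- `W` is a standard one-dimensional Brownian motion with respect to the family of
σ-algebras `F` (a filtration contained in the ambient σ-algebra). -/
structure IsBM (μ : Measure Ω) (F : ℝ → MeasurableSpace Ω) (W : ℝ → Ω → ℝ) : Prop where
  le : ∀ t : ℝ, F t ≤ m
  mono : Monotone F
  adapted : ∀ t : ℝ, 0 ≤ t → MeasurableSpace.comap (W t) inferInstance ≤ F t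
  init : ∀ᵐ ω ∂μ, W 0 ω = 0
  cont : ∀ᵐ ω ∂μ, Continuous fun t => W t ω
  law : ∀ s t : ℝ, 0 ≤ s → s ≤ t →
    μ.map (fun ω => W t ω - W s ω) = gaussianReal 0 ((t - s).toNNReal)
  indep : ∀ s t : ℝ, 0 ≤ s → s ≤ t →
    Indep (MeasurableSpace.comap (fun ω => W t ω - W s ω) inferInstance) (F s) μ

/-- `(B₁, B₂)` is a planar Brownian motion: two independent standard Brownian motions
with respect to the common filtration `F`. -/
def IsPlanarBM (μ : Measure Ω) (F : ℝ → MeasurableSpace Ω) (B₁ B₂ : ℝ → Ω → ℝ) : Prop :=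
  IsBM μ F B₁ ∧ IsBM μ F B₂ ∧
    IndepFun (fun ω => (fun t => B₁ t ω)) (fun ω => (fun t => B₂ t ω)) μ

/-- `L` is the (right) local time at the origin of the process `Y`:
`L t = lim_{ε ↓ 0} (4ε)⁻¹ ∫₀ᵗ 1{|Y(s)| < ε} ds`. -/
def IsLocalTime (μ : Measure Ω) (Y L : ℝ → Ω → ℝ) : Prop :=
  ∀ᵐ ω ∂μ, ∀ t : ℝ, 0 ≤ t →
    Tendsto (fun ε : ℝ =>
        (4 * ε)⁻¹ * ∫ s in (0:ℝ)..t, (if |Y s ω| < ε then (1:ℝ) else 0))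
      (nhdsWithin 0 (Ioi 0)) (nhds (L t ω))

/-- A continuous local martingale with respect to the filtration `F`. -/
def IsContLocMart (μ : Measure Ω) (F : Filtration ℝ m) (M : ℝ → Ω → ℝ) : Prop :=
  (∀ᵐ ω ∂μ, Continuous fun t => M t ω) ∧ StronglyAdapted F M ∧
    ∃ τ : ℕ → Ω → ℝ, (∀ n, IsStoppingTime F (fun ω => (τ n ω : WithTop ℝ))) ∧
      (∀ᵐ ω ∂μ, Tendsto (fun n => τ n ω) atTop atTop) ∧
      ∀ n, Martingale (fun t ω => M (min t (τ n ω)) ω) F μ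

/-- Orthogonality: the cross-variation `⟨M,N⟩` vanishes identically. -/
def Orthogonal (μ : Measure Ω) (M N : ℝ → Ω → ℝ) : Prop :=
  IsQV μ M N fun _ _ => 0

/-- Domination: `⟨M⟩(t) = ∫₀ᵗ q(s) d⟨N⟩(s)` for a progressively measurable
process `q` with values in `[0,c]`. -/
def Dominated (μ : Measure Ω) (F : Filtration ℝ m) (M N : ℝ → Ω → ℝ) (c : ℝ) : Prop :=
  ∃ QM QN q : ℝ → Ω → ℝ, IsQV μ M M QM ∧ IsQV μ N N QN ∧
    ProgMeasurable F q ∧ (∀ t ω, q t ω ∈ Icc (0:ℝ) c) ∧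
    ∀ᵐ ω ∂μ, ∃ ν : Measure ℝ,
      (∀ a b : ℝ, 0 ≤ a → a ≤ b → ν (Ioc a b) = ENNReal.ofReal (QN b ω - QN a ω)) ∧
      ∀ t : ℝ, 0 ≤ t → QM t ω = ∫ s in Ioc (0:ℝ) t, q s ω ∂ν

/-- The law of the two-dimensional process `(X₁, X₂)` on path space. -/
def pathLaw (μ : Measure Ω) (X₁ X₂ : ℝ → Ω → ℝ) : Measure (ℝ → ℝ × ℝ) :=
  μ.map fun ω => (fun t => (X₁ t ω, X₂ t ω))
/-- `(X₁, X₂)` solves the system (1.1)-(1.2) driven by `(B₁, B₂)`. -/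
def Solves11 (μ : Measure Ω) (F : ℝ → MeasurableSpace Ω) (g h ρ σ x₁ x₂ : ℝ)
    (B₁ B₂ X₁ X₂ : ℝ → Ω → ℝ) : Prop :=
  (∀ t : ℝ, 0 ≤ t →
    MeasurableSpace.comap (fun ω => (X₁ t ω, X₂ t ω)) inferInstance ≤ F t) ∧
  (∀ᵐ ω ∂μ, Continuous (fun t => X₁ t ω) ∧ Continuous (fun t => X₂ t ω)) ∧
  ∃ I₁ I₂ : ℝ → Ω → ℝ,
    IsSI μ (fun s ω => if X₁ s ω ≤ X₂ s ω then σ else ρ) B₁ I₁ ∧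
    IsSI μ (fun s ω => if X₁ s ω ≤ X₂ s ω then ρ else σ) B₂ I₂ ∧
    ∀ᵐ ω ∂μ, ∀ t : ℝ, 0 ≤ t →
      X₁ t ω = x₁ + (∫ s in (0:ℝ)..t, (if X₁ s ω ≤ X₂ s ω then g else -h)) + I₁ t ω ∧
      X₂ t ω = x₂ + (∫ s in (0:ℝ)..t, (if X₁ s ω ≤ X₂ s ω then -h else g)) + I₂ t ω

/-- `(X₁, X₂)` solves the system (4.7)-(4.8), driven by the single Brownian motion `W`. -/
def Solves47 (μ : Measure Ω) (F : ℝ → MeasurableSpace Ω) (g h x₁ x₂ : ℝ)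
    (W X₁ X₂ : ℝ → Ω → ℝ) : Prop :=
  (∀ t : ℝ, 0 ≤ t →
    MeasurableSpace.comap (fun ω => (X₁ t ω, X₂ t ω)) inferInstance ≤ F t) ∧
  (∀ᵐ ω ∂μ, Continuous (fun t => X₁ t ω) ∧ Continuous (fun t => X₂ t ω)) ∧
  ∃ I₁ I₂ : ℝ → Ω → ℝ,
    IsSI μ (fun s ω => if X₁ s ω ≤ X₂ s ω then (0:ℝ) else 1) W I₁ ∧
    IsSI μ (fun s ω => if X₁ s ω ≤ X₂ s ω then (-1:ℝ) else 0) W I₂ ∧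
    ∀ᵐ ω ∂μ, ∀ t : ℝ, 0 ≤ t →
      X₁ t ω = x₁ + (∫ s in (0:ℝ)..t, (if X₁ s ω ≤ X₂ s ω then g else -h)) + I₁ t ω ∧
      X₂ t ω = x₂ + (∫ s in (0:ℝ)..t, (if X₁ s ω ≤ X₂ s ω then -h else g)) + I₂ t ω

/-- `(X₁, X₂)` solves the system (4.9)-(4.10), driven by the single Brownian motion `V`. -/
def Solves49 (μ : Measure Ω) (F : ℝ → MeasurableSpace Ω) (g h x₁ x₂ : ℝ)
    (V X₁ X₂ : ℝ → Ω → ℝ) : Prop :=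
  (∀ t : ℝ, 0 ≤ t →
    MeasurableSpace.comap (fun ω => (X₁ t ω, X₂ t ω)) inferInstance ≤ F t) ∧
  (∀ᵐ ω ∂μ, Continuous (fun t => X₁ t ω) ∧ Continuous (fun t => X₂ t ω)) ∧
  ∃ I₁ I₂ : ℝ → Ω → ℝ,
    IsSI μ (fun s ω => if X₁ s ω ≤ X₂ s ω then (0:ℝ) else 1) V I₁ ∧
    IsSI μ (fun s ω => if X₁ s ω ≤ X₂ s ω then (1:ℝ) else 0) V I₂ ∧
    ∀ᵐ ω ∂μ, ∀ t : ℝ, 0 ≤ t →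
      X₁ t ω = x₁ + (∫ s in (0:ℝ)..t, (if X₁ s ω ≤ X₂ s ω then g else -h)) + I₁ t ω ∧
      X₂ t ω = x₂ + (∫ s in (0:ℝ)..t, (if X₁ s ω ≤ X₂ s ω then -h else g)) + I₂ t ω

/-- `(X₁, X₂)` solves the system (2.12)-(2.13), driven by the planar BM `(W₁, W₂)`. -/
def Solves212 (μ : Measure Ω) (F : ℝ → MeasurableSpace Ω) (g h ρ σ x₁ x₂ : ℝ)
    (W₁ W₂ X₁ X₂ : ℝ → Ω → ℝ) : Prop :=
  (∀ t : ℝ, 0 ≤ t →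
    MeasurableSpace.comap (fun ω => (X₁ t ω, X₂ t ω)) inferInstance ≤ F t) ∧
  (∀ᵐ ω ∂μ, Continuous (fun t => X₁ t ω) ∧ Continuous (fun t => X₂ t ω)) ∧
  ∃ I₁ I₂ : ℝ → Ω → ℝ,
    IsSI2 μ (fun s ω => if X₁ s ω ≤ X₂ s ω then 0 else ρ) W₁
            (fun s ω => if X₁ s ω ≤ X₂ s ω then σ else 0) W₂ I₁ ∧
    IsSI2 μ (fun s ω => if X₁ s ω ≤ X₂ s ω then -ρ else 0) W₁
            (fun s ω => if X₁ s ω ≤ X₂ s ω then 0 else -σ) W₂ I₂ ∧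
    ∀ᵐ ω ∂μ, ∀ t : ℝ, 0 ≤ t →
      X₁ t ω = x₁ + (∫ s in (0:ℝ)..t, (if X₁ s ω ≤ X₂ s ω then g else -h)) + I₁ t ω ∧
      X₂ t ω = x₂ + (∫ s in (0:ℝ)..t, (if X₁ s ω ≤ X₂ s ω then -h else g)) + I₂ t ω

/-- `(X₁, X₂)` solves the system (2.14)-(2.15), driven by the planar BM `(V₁, V₂)`. -/
def Solves214 (μ : Measure Ω) (F : ℝ → MeasurableSpace Ω) (g h ρ σ x₁ x₂ : ℝ)
    (V₁ V₂ X₁ X₂ : ℝ → Ω → ℝ) : Prop :=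
  (∀ t : ℝ, 0 ≤ t →
    MeasurableSpace.comap (fun ω => (X₁ t ω, X₂ t ω)) inferInstance ≤ F t) ∧
  (∀ᵐ ω ∂μ, Continuous (fun t => X₁ t ω) ∧ Continuous (fun t => X₂ t ω)) ∧
  ∃ I₁ I₂ : ℝ → Ω → ℝ,
    IsSI2 μ (fun s ω => if X₁ s ω ≤ X₂ s ω then 0 else ρ) V₁
            (fun s ω => if X₁ s ω ≤ X₂ s ω then σ else 0) V₂ I₁ ∧
    IsSI2 μ (fun s ω => if X₁ s ω ≤ X₂ s ω then ρ else 0) V₁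
            (fun s ω => if X₁ s ω ≤ X₂ s ω then 0 else σ) V₂ I₂ ∧
    ∀ᵐ ω ∂μ, ∀ t : ℝ, 0 ≤ t →
      X₁ t ω = x₁ + (∫ s in (0:ℝ)..t, (if X₁ s ω ≤ X₂ s ω then g else -h)) + I₁ t ω ∧
      X₂ t ω = x₂ + (∫ s in (0:ℝ)..t, (if X₁ s ω ≤ X₂ s ω then -h else g)) + I₂ t ω

/-- `(X₁, X₂)` solves the system `dX = Σ(X) dU + G(X) dt` of (eq:xSigma), where
`Σ(x) = Σ₊ 1{x₁ > x₂} + Σ₋ 1{x₁ ≤ x₂}`. -/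
def SolvesGen (μ : Measure Ω) (F : ℝ → MeasurableSpace Ω) (g h : ℝ)
    (Sp Sm : Matrix (Fin 2) (Fin 2) ℝ) (x₁ x₂ : ℝ)
    (U₁ U₂ X₁ X₂ : ℝ → Ω → ℝ) : Prop :=
  (∀ t : ℝ, 0 ≤ t →
    MeasurableSpace.comap (fun ω => (X₁ t ω, X₂ t ω)) inferInstance ≤ F t) ∧
  (∀ᵐ ω ∂μ, Continuous (fun t => X₁ t ω) ∧ Continuous (fun t => X₂ t ω)) ∧
  ∃ I₁ I₂ : ℝ → Ω → ℝ,
    IsSI2 μ (fun s ω => if X₁ s ω ≤ X₂ s ω then Sm 0 0 else Sp 0 0) U₁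
            (fun s ω => if X₁ s ω ≤ X₂ s ω then Sm 0 1 else Sp 0 1) U₂ I₁ ∧
    IsSI2 μ (fun s ω => if X₁ s ω ≤ X₂ s ω then Sm 1 0 else Sp 1 0) U₁
            (fun s ω => if X₁ s ω ≤ X₂ s ω then Sm 1 1 else Sp 1 1) U₂ I₂ ∧
    ∀ᵐ ω ∂μ, ∀ t : ℝ, 0 ≤ t →
      X₁ t ω = x₁ + (∫ s in (0:ℝ)..t, (if X₁ s ω ≤ X₂ s ω then g else -h)) + I₁ t ω ∧
      X₂ t ω = x₂ + (∫ s in (0:ℝ)..t, (if X₁ s ω ≤ X₂ s ω then -h else g)) + I₂ t ω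



set_option autoImplicit false
set_option linter.unusedSectionVars false
set_option linter.unusedVariables false
set_option linter.unusedSimpArgs false
set_option linter.style.longLine false

section tools

/-- a σ-algebra containing all null sets -/
def NullC {Ω : Type*} [m : MeasurableSpace Ω] (μ : Measure Ω) (𝒢 : MeasurableSpace Ω) : Prop :=
  ∀ A : Set Ω, μ A = 0 → MeasurableSet[𝒢] A

lemma NullC.congr {Ω : Type*} {𝒢 : MeasurableSpace Ω} [m : MeasurableSpace Ω] {μ : Measure Ω} (h𝒢 : NullC μ 𝒢)
    {β : Type*} [MeasurableSpace β] {f g : Ω → β}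
    (hf : Measurable[𝒢] f) (hfg : ∀ᵐ ω ∂μ, f ω = g ω) : Measurable[𝒢] g := by
  intro s hs
  have hN : μ {ω | ¬ f ω = g ω} = 0 := hfg
  have h1 : MeasurableSet[𝒢] ({ω | ¬ f ω = g ω} ∩ g ⁻¹' s) :=
    h𝒢 _ (measure_mono_null inter_subset_left hN)
  have h2 : MeasurableSet[𝒢] (f ⁻¹' s \ {ω | ¬ f ω = g ω}) :=
    (hf hs).diff (h𝒢 _ hN)
  have : g ⁻¹' s = ({ω | ¬ f ω = g ω} ∩ g ⁻¹' s) ∪ (f ⁻¹' s \ {ω | ¬ f ω = g ω}) := by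
    ext ω
    simp only [mem_preimage, mem_union, mem_inter_iff, mem_ofPred_eq, Set.mem_sdiff, not_not]
    constructor
    · intro h
      by_cases h' : f ω = g ω
      · right; exact ⟨by rw [h']; exact h, h'⟩
      · left; exact ⟨h', h⟩
    · rintro (h | h)
      · exact h.2
      · rw [← h.2]; exact h.1
  rw [this]
  exact h1.union h2

lemma NullC.lim_ae {Ω : Type*} {𝒢 : MeasurableSpace Ω} [m : MeasurableSpace Ω] {μ : Measure Ω} (h𝒢 : NullC μ 𝒢)
    {f : ℕ → Ω → ℝ} {g : Ω → ℝ} (hf : ∀ n, Measurable[𝒢] (f n))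
    (hlim : ∀ᵐ ω ∂μ, Tendsto (fun n => f n ω) atTop (nhds (g ω))) : Measurable[𝒢] g := by
  have hN : μ {ω | ¬ Tendsto (fun n => f n ω) atTop (nhds (g ω))} = 0 := hlim
  set N := {ω | ¬ Tendsto (fun n => f n ω) atTop (nhds (g ω))} with hNdef
  have h1 : ∀ n, Measurable[𝒢] (Nᶜ.indicator (f n)) := fun n =>
    (hf n).indicator (h𝒢 _ hN).compl
  have h2 : Measurable[𝒢] (Nᶜ.indicator g) := by
    refine @measurable_of_tendsto_metrizable _ _ 𝒢 _ _ _ _ _ _ h1 ?_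
    rw [tendsto_pi_nhds]
    intro ω
    by_cases hω : ω ∈ N
    · simp [hω]
    · have : ω ∈ Nᶜ := hω
      simp only [indicator_of_mem this]
      simpa [hNdef] using hω
  refine h𝒢.congr h2 ?_
  have : ∀ᵐ ω ∂μ, ω ∉ N := measure_eq_zero_iff_ae_notMem.1 hN
  filter_upwards [this] with ω hω
  exact indicator_of_mem (s := Nᶜ) hω g

lemma NullC.lim_measure {Ω : Type*} {𝒢 : MeasurableSpace Ω} [m : MeasurableSpace Ω] {μ : Measure Ω} (h𝒢 : NullC μ 𝒢)
    {f : ℕ → Ω → ℝ} {g : Ω → ℝ} (hf : ∀ n, Measurable[𝒢] (f n))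
    (hlim : TendstoInMeasure μ f atTop g) : Measurable[𝒢] g := by
  obtain ⟨ns, -, hns⟩ := hlim.exists_seq_tendsto_ae
  exact h𝒢.lim_ae (fun n => hf (ns n)) hns

lemma NullC.mono {Ω : Type*} {𝒢 𝒢' : MeasurableSpace Ω} [m : MeasurableSpace Ω] {μ : Measure Ω} (h𝒢 : NullC μ 𝒢) (hle : 𝒢 ≤ 𝒢') :
    NullC μ 𝒢' := fun A hA => hle _ (h𝒢 A hA)

lemma nullC_augSA {Ω : Type*} (m' : MeasurableSpace Ω) [m : MeasurableSpace Ω] (μ : Measure Ω) : NullC μ (augSA μ m') := by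
  intro A hA
  exact (le_sup_right : _ ≤ augSA μ m') _ (MeasurableSpace.measurableSet_generateFrom hA)

lemma augSA_le {Ω : Type*} {m' 𝒢 : MeasurableSpace Ω} [m : MeasurableSpace Ω] {μ : Measure Ω} (h𝒢 : NullC μ 𝒢) (h : m' ≤ 𝒢) :
    augSA μ m' ≤ 𝒢 :=
  sup_le h (MeasurableSpace.generateFrom_le h𝒢)

/-- every augmented-measurable set is a.e. equal to a measurable one -/
lemma augSA_ae {Ω : Type*} {m' : MeasurableSpace Ω} [m : MeasurableSpace Ω] {μ : Measure Ω} {A : Set Ω}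
    (hA : MeasurableSet[augSA μ m'] A) : ∃ A', MeasurableSet[m'] A' ∧ A =ᵐ[μ] A' := by
  have h : augSA μ m' ≤ eventuallyMeasurableSpace m' (ae μ) := by
    refine augSA_le ?_ (le_eventuallyMeasurableSpace)
    intro B hB
    exact ⟨∅, @MeasurableSet.empty _ m', ae_eq_empty.2 hB⟩
  exact h _ hA

lemma natFilt_le_iff {Ω : Type*} {𝒢 : MeasurableSpace Ω} [m : MeasurableSpace Ω] {μ : Measure Ω} {P Q : ℝ → Ω → ℝ} {t : ℝ}
    (h𝒢 : NullC μ 𝒢) (hP : ∀ s ∈ Icc (0:ℝ) t, Measurable[𝒢] (P s))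
    (hQ : ∀ s ∈ Icc (0:ℝ) t, Measurable[𝒢] (Q s)) :
    natFilt μ (fun s ω => (P s ω, Q s ω)) t ≤ 𝒢 := by
  refine augSA_le h𝒢 ?_
  refine iSup₂_le fun s hs => ?_
  exact ((hP s hs).prodMk (hQ s hs)).comap_le

lemma natFilt_meas (μ : Measure Ω) (P Q : ℝ → Ω → ℝ) {s t : ℝ} (hs : s ∈ Icc (0:ℝ) t) :
    Measurable[natFilt μ (fun s ω => (P s ω, Q s ω)) t] (P s) ∧
    Measurable[natFilt μ (fun s ω => (P s ω, Q s ω)) t] (Q s) := by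
  have h1 : MeasurableSpace.comap (fun ω => (P s ω, Q s ω)) inferInstance ≤
      natFilt μ (fun s ω => (P s ω, Q s ω)) t := by
    refine le_trans ?_ (le_sup_left : natSA (fun s ω => (P s ω, Q s ω)) t ≤ _)
    exact le_iSup₂_of_le s hs le_rfl
  have h2 : Measurable[natFilt μ (fun s ω => (P s ω, Q s ω)) t] (fun ω => (P s ω, Q s ω)) :=
    measurable_iff_comap_le.2 h1
  exact ⟨measurable_fst.comp h2, measurable_snd.comp h2⟩

/-- comparison principle for convergence in measure -/
lemma tim_of_le {μ : Measure Ω} {f f' h : ℕ → Ω → ℝ} {g g' k : Ω → ℝ} (C : ℝ) (hC : 0 < C)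
    (hf : TendstoInMeasure μ f atTop g) (hf' : TendstoInMeasure μ f' atTop g')
    (hle : ∀ n ω, |h n ω - k ω| ≤ C * |f n ω - g ω| + C * |f' n ω - g' ω|) :
    TendstoInMeasure μ h atTop k := by
  rw [tendstoInMeasure_iff_norm] at *
  intro ε hε
  have h1 := hf (ε / (2 * C)) (by positivity)
  have h2 := hf' (ε / (2 * C)) (by positivity)
  have h3 := h1.add h2
  rw [add_zero] at h3
  refine tendsto_of_tendsto_of_tendsto_of_le_of_le tendsto_const_nhds h3 (fun _ => zero_le) ?_
  intro n
  refine le_trans (measure_mono ?_) (measure_union_le _ _)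
  intro ω hω
  simp only [mem_ofPred_eq, Real.norm_eq_abs, mem_union] at *
  by_contra hcon
  push Not at hcon
  have e1 := hle n ω
  have a1 : C * |f n ω - g ω| < ε / 2 := by
    have := mul_lt_mul_of_pos_left hcon.1 hC
    rwa [show C * (ε / (2 * C)) = ε / 2 by field_simp] at this
  have a2 : C * |f' n ω - g' ω| < ε / 2 := by
    have := mul_lt_mul_of_pos_left hcon.2 hC
    rwa [show C * (ε / (2 * C)) = ε / 2 by field_simp] at this
  linarith

lemma tim_lin {μ : Measure Ω} {f f' : ℕ → Ω → ℝ} {g g' : Ω → ℝ} (a b : ℝ)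
    (hf : TendstoInMeasure μ f atTop g) (hf' : TendstoInMeasure μ f' atTop g') :
    TendstoInMeasure μ (fun n ω => a * f n ω + b * f' n ω) atTop
      (fun ω => a * g ω + b * g' ω) := by
  refine tim_of_le (|a| + |b| + 1) (by positivity) hf hf' ?_
  intro n ω
  have : a * f n ω + b * f' n ω - (a * g ω + b * g' ω) =
    a * (f n ω - g ω) + b * (f' n ω - g' ω) := by ring
  rw [this]
  refine (abs_add_le _ _).trans ?_
  rw [abs_mul, abs_mul]
  have h1 := abs_nonneg (f n ω - g ω)
  have h2 := abs_nonneg (f' n ω - g' ω)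
  have h3 := abs_nonneg a
  have h4 := abs_nonneg b
  nlinarith [mul_nonneg h3 h2, mul_nonneg h4 h1]

lemma tim_mul {μ : Measure Ω} {f : ℕ → Ω → ℝ} {g G : Ω → ℝ} (C : ℝ) (hG : ∀ ω, |G ω| ≤ C)
    (hf : TendstoInMeasure μ f atTop g) :
    TendstoInMeasure μ (fun n ω => G ω * f n ω) atTop (fun ω => G ω * g ω) := by
  refine tim_of_le (|C| + 1) (by positivity) hf hf ?_
  intro n ω
  rw [← mul_sub, abs_mul]
  have h1 := abs_nonneg (f n ω - g ω)
  have h2 := (hG ω).trans (le_abs_self C)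
  nlinarith [mul_le_mul_of_nonneg_right h2 h1, mul_nonneg (abs_nonneg C) h1]

lemma tim_const {μ : Measure Ω} (g : Ω → ℝ) : TendstoInMeasure μ (fun _ : ℕ => g) atTop g := by
  rw [tendstoInMeasure_iff_norm]
  intro ε hε
  simp [not_le.2 hε]

/-- bounded continuous functionals pass to the limit in measure -/
lemma tim_cexp {μ : Measure Ω} [IsProbabilityMeasure μ] {f : ℕ → Ω → ℝ} {g : Ω → ℝ} {Z : Ω → ℂ}
    (hZ : Measurable Z) (C : ℝ) (hZC : ∀ ω, ‖Z ω‖ ≤ C)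
    (hf : ∀ n, Measurable (f n)) (hlim : TendstoInMeasure μ f atTop g) :
    Tendsto (fun n => ∫ ω, Z ω * Complex.exp (Complex.I * f n ω) ∂μ) atTop
      (nhds (∫ ω, Z ω * Complex.exp (Complex.I * g ω) ∂μ)) := by
  refine tendsto_of_subseq_tendsto fun ns hns => ?_
  have h1 : TendstoInMeasure μ (fun n => f (ns n)) atTop g := hlim.comp hns
  obtain ⟨ms, -, hms⟩ := h1.exists_seq_tendsto_ae
  refine ⟨ms, ?_⟩
  refine tendsto_integral_of_dominated_convergence (fun _ => C) ?_ (integrable_const _) ?_ ?_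
  · intro n
    have := hf (ns (ms n))
    exact (by fun_prop : Measurable _).aestronglyMeasurable
  · intro n
    refine Eventually.of_forall fun ω => ?_
    rw [norm_mul, mul_comm Complex.I, Complex.norm_exp_ofReal_mul_I, mul_one]
    exact hZC ω
  · filter_upwards [hms] with ω hω
    refine Tendsto.const_mul _ ?_
    refine (Complex.continuous_exp.tendsto _).comp ?_
    refine Tendsto.const_mul _ ?_
    exact (Complex.continuous_ofReal.tendsto _).comp hω

end tools

section planar

lemma integrable_of_bdd {μ : Measure Ω} [IsProbabilityMeasure μ] {E : Type*} [NormedAddCommGroup E]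
    [MeasurableSpace E] [BorelSpace E] [SecondCountableTopology E] {f : Ω → E} (hf : Measurable f) (C : ℝ) (hC : ∀ ω, ‖f ω‖ ≤ C) : Integrable f μ :=
  Integrable.of_bound hf.aestronglyMeasurable C (Eventually.of_forall hC)

lemma abs_mart_prod {μ : Measure Ω} [IsProbabilityMeasure μ] (N : ℕ) (D1 D2 : ℕ → Ω → ℂ) (Z : Ω → ℂ)
    (C C' K η : ℝ) (hη : 0 < η) 
    (hZ : Measurable Z) (hD1 : ∀ k, Measurable (D1 k)) (hD2 : ∀ k, Measurable (D2 k))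
    (hZC : ∀ ω, ‖Z ω‖ ≤ C) (hD1C : ∀ k ∈ Finset.range N, ∀ ω, ‖D1 k ω‖ ≤ C')
    (hD2C : ∀ k ∈ Finset.range N, ∀ ω, ‖D2 k ω‖ ≤ C')
    (ha : ∀ k ∈ Finset.range N, ∀ l ∈ Finset.range N, k ≠ l → ∫ ω, Z ω * (D1 k ω * D2 l ω) ∂μ = 0)
    (hb : ∀ k ∈ Finset.range N, ∀ l ∈ Finset.range N, k ≠ l → ∫ ω, D1 k ω * (starRingEnd ℂ) (D1 l ω) ∂μ = 0)
    (hc : ∀ k l, ∫ ω, (D1 k ω * (starRingEnd ℂ) (D1 l ω)) * (D2 k ω * (starRingEnd ℂ) (D2 l ω)) ∂μ =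
      (∫ ω, D1 k ω * (starRingEnd ℂ) (D1 l ω) ∂μ) * ∫ ω, D2 k ω * (starRingEnd ℂ) (D2 l ω) ∂μ)
    (hd1 : ∀ k ∈ Finset.range N, ‖∫ ω, D1 k ω * (starRingEnd ℂ) (D1 k ω) ∂μ‖ ≤ K)
    (hd2 : ∀ k ∈ Finset.range N, ‖∫ ω, D2 k ω * (starRingEnd ℂ) (D2 k ω) ∂μ‖ ≤ K) :
    ‖∫ ω, Z ω * ((∑ k ∈ Finset.range N, D1 k ω) * (∑ l ∈ Finset.range N, D2 l ω)) ∂μ‖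
      ≤ C * (η / 2 + N * K ^ 2 / (2 * η)) := by
  have hC0 : 0 ≤ C := by
    have : Nonempty Ω := μ.nonempty_of_neZero
    exact (norm_nonneg _).trans (hZC (Classical.arbitrary Ω))
  have int1 : ∀ k ∈ Finset.range N, ∀ l ∈ Finset.range N, Integrable (fun ω => Z ω * (D1 k ω * D2 l ω)) μ := by
    intro k hk l hl
    refine integrable_of_bdd (by fun_prop) (C * (C' * C')) fun ω => ?_
    rw [norm_mul, norm_mul]
    have := hZC ω; have := hD1C k hk ω; have := hD2C l hl ω
    have h0 := norm_nonneg (D1 k ω)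
    gcongr
    exact h0.trans (hD1C k hk ω)
  set S : Ω → ℂ := fun ω => ∑ k ∈ Finset.range N, D1 k ω * D2 k ω with hS
  have hSm : Measurable S := by fun_prop
  have e1 : ∫ ω, Z ω * ((∑ k ∈ Finset.range N, D1 k ω) * (∑ l ∈ Finset.range N, D2 l ω)) ∂μ
      = ∫ ω, Z ω * S ω ∂μ := by
    have : ∀ ω, Z ω * ((∑ k ∈ Finset.range N, D1 k ω) * (∑ l ∈ Finset.range N, D2 l ω)) =
        ∑ k ∈ Finset.range N, ∑ l ∈ Finset.range N, Z ω * (D1 k ω * D2 l ω) := by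
      intro ω
      rw [Finset.sum_mul_sum, Finset.mul_sum]
      refine Finset.sum_congr rfl fun k _ => ?_
      rw [Finset.mul_sum]
    simp_rw [this]
    have this2 : ∀ ω, Z ω * S ω = ∑ k ∈ Finset.range N, Z ω * (D1 k ω * D2 k ω) := by
      intro ω; rw [hS, Finset.mul_sum]
    simp_rw [this2]
    rw [integral_finsetSum _ fun k hk => integrable_finsetSum _ fun l hl => int1 k hk l hl,
      integral_finsetSum _ fun k hk => int1 k hk k hk]
    refine Finset.sum_congr rfl fun k hk => ?_
    rw [integral_finsetSum _ fun l hl => int1 k hk l hl]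
    refine Finset.sum_eq_single_of_mem k hk ?_
    intro l hl hlk
    exact ha k hk l hl (Ne.symm hlk)
  have int2 : ∀ k ∈ Finset.range N, ∀ l ∈ Finset.range N, Integrable (fun ω => (D1 k ω * (starRingEnd ℂ) (D1 l ω)) * (D2 k ω * (starRingEnd ℂ) (D2 l ω))) μ := by
    intro k hk l hl
    refine integrable_of_bdd ?_ ((C' * C') * (C' * C')) fun ω => ?_
    · have h1 := hD1 l
      have h2 := hD2 l
      have h3 := hD1 k
      have h4 := hD2 k
      have h5 : Measurable (starRingEnd ℂ) := Complex.continuous_conj.measurable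
      exact (h3.mul (h5.comp h1)).mul (h4.mul (h5.comp h2))
    rw [norm_mul, norm_mul, norm_mul, RCLike.norm_conj, RCLike.norm_conj]
    have := hD1C k hk ω; have := hD2C l hl ω;  have := hD1C l hl ω; have := hD2C k hk ω
    have h0 := norm_nonneg (D1 k ω)
    have h1 : 0 ≤ C' := h0.trans (hD1C k hk ω)
    gcongr
  have hbound : ∃ C'', ∀ ω, ‖S ω‖ ≤ C'' := by
    refine ⟨∑ k ∈ Finset.range N, C' * C', fun ω => ?_⟩
    refine (norm_sum_le _ _).trans (Finset.sum_le_sum fun k hk => ?_)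
    rw [norm_mul]
    have h0 := norm_nonneg (D1 k ω)
    have h1 : 0 ≤ C' := h0.trans (hD1C k hk ω)
    exact mul_le_mul (hD1C k hk ω) (hD2C k hk ω) (norm_nonneg _) h1
  obtain ⟨C'', hC''⟩ := hbound
  have e2 : ∫ ω, ‖S ω‖ ^ 2 ∂μ ≤ N * K ^ 2 := by
    have h1 : ((∫ ω, ‖S ω‖ ^ 2 ∂μ : ℝ) : ℂ) = ∑ k ∈ Finset.range N,
        (∫ ω, D1 k ω * (starRingEnd ℂ) (D1 k ω) ∂μ) * ∫ ω, D2 k ω * (starRingEnd ℂ) (D2 k ω) ∂μ := by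
      rw [← integral_complex_ofReal]
      have : ∀ ω, ((‖S ω‖ ^ 2 : ℝ) : ℂ) = ∑ k ∈ Finset.range N, ∑ l ∈ Finset.range N, (D1 k ω * (starRingEnd ℂ) (D1 l ω)) * (D2 k ω * (starRingEnd ℂ) (D2 l ω)) := by
        intro ω
        push_cast
        rw [← Complex.mul_conj', hS, map_sum, Finset.sum_mul_sum]
        refine Finset.sum_congr rfl fun k _ => Finset.sum_congr rfl fun l _ => ?_
        rw [map_mul]; ring
      simp_rw [this]
      rw [integral_finsetSum _ fun k hk => integrable_finsetSum _ fun l hl => int2 k hk l hl]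
      refine Finset.sum_congr rfl fun k hk => ?_
      rw [integral_finsetSum _ fun l hl => int2 k hk l hl]
      rw [Finset.sum_eq_single_of_mem k hk]
      · exact hc k k
      intro l hl hlk
      rw [hc, hb k hk l hl (Ne.symm hlk), zero_mul]
    have h2 : ‖((∫ ω, ‖S ω‖ ^ 2 ∂μ : ℝ) : ℂ)‖ ≤ N * K ^ 2 := by
      rw [h1]
      refine (norm_sum_le _ _).trans ?_
      calc _ ≤ ∑ k ∈ Finset.range N, K ^ 2 := Finset.sum_le_sum fun k hk => by
            rw [norm_mul, sq]
            have := hd1 k hk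
            exact mul_le_mul this (hd2 k hk) (norm_nonneg _) ((norm_nonneg _).trans this)
        _ = _ := by simp
    rw [Complex.norm_real] at h2
    exact (le_abs_self _).trans h2
  rw [e1]
  have hi1 : Integrable (fun ω => ‖S ω‖ ^ 2) μ := by
    refine integrable_of_bdd (by fun_prop) (C'' ^ 2) fun ω => ?_
    rw [norm_pow, norm_norm]
    have := hC'' ω
    gcongr
  calc ‖∫ ω, Z ω * S ω ∂μ‖ ≤ ∫ ω, C * (η / 2 + ‖S ω‖ ^ 2 / (2 * η)) ∂μ := by
        refine norm_integral_le_of_norm_le ?_ (Eventually.of_forall fun ω => ?_)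
        · exact (((integrable_const _).add (hi1.div_const _))).const_mul _
        · rw [norm_mul]
          have : ‖S ω‖ ≤ η / 2 + ‖S ω‖ ^ 2 / (2 * η) := by
            rw [← sub_nonneg]
            have : η / 2 + ‖S ω‖ ^ 2 / (2 * η) - ‖S ω‖ = (η - ‖S ω‖) ^ 2 / (2 * η) := by
              field_simp; ring
            rw [this]; positivity
          exact mul_le_mul (hZC ω) this (norm_nonneg _) hC0
    _ = C * (η / 2 + (∫ ω, ‖S ω‖ ^ 2 ∂μ) / (2 * η)) := by
        rw [integral_const_mul, integral_add (integrable_const _) (hi1.div_const _)]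
        simp [integral_div]
    _ ≤ _ := by gcongr

lemma isBM_cf {μ : Measure Ω} [IsProbabilityMeasure μ] {F : ℝ → MeasurableSpace Ω} {B : ℝ → Ω → ℝ}
    (hB : IsBM μ F B) {u v : ℝ} (hu : 0 ≤ u) (huv : u ≤ v) (θ : ℝ) {Z : Ω → ℂ}
    (hZ : Measurable[F u] Z) :
    ∫ ω, Z ω * Complex.exp (Complex.I * ((θ * (B v ω - B u ω) : ℝ) : ℂ)) ∂μ =
      Complex.exp (((-(θ ^ 2 * (v - u) / 2) : ℝ)) : ℂ) * ∫ ω, Z ω ∂μ := by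
  have hBv : Measurable (B v) := (measurable_iff_comap_le.2 (hB.adapted v (hu.trans huv))).mono (hB.le v) le_rfl
  have hBu : Measurable (B u) := (measurable_iff_comap_le.2 (hB.adapted u hu)).mono (hB.le u) le_rfl
  have hZm : Measurable Z := hZ.mono (hB.le u) le_rfl
  set X : Ω → ℝ := fun ω => B v ω - B u ω with hX
  have hXm : Measurable X := hBv.sub hBu
  have hind : IndepFun Z X μ := by
    have h1 := hB.indep u v hu huv
    have h2 : Indep (MeasurableSpace.comap Z inferInstance) (MeasurableSpace.comap X inferInstance) μ :=
      indep_of_indep_of_le_left h1.symm hZ.comap_le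
    exact h2
  have hφ : Measurable (fun x : ℝ => Complex.exp (Complex.I * ((θ * x : ℝ) : ℂ))) := by fun_prop
  have h3 : IndepFun Z (fun ω => Complex.exp (Complex.I * ((θ * X ω : ℝ) : ℂ))) μ :=
    hind.comp measurable_id hφ
  rw [h3.integral_fun_mul_eq_mul_integral hZm.aestronglyMeasurable
    (hφ.comp hXm).aestronglyMeasurable]
  have h4 : ∫ ω, Complex.exp (Complex.I * ((θ * X ω : ℝ) : ℂ)) ∂μ =
      charFun (μ.map X) θ := by
    rw [charFun_apply_real, integral_map hXm.aemeasurable (by fun_prop)]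
    refine integral_congr_ae (Eventually.of_forall fun ω => ?_)
    simp only
    congr 1
    push_cast; ring
  rw [h4, hB.law u v hu huv, charFun_gaussianReal, mul_comm]
  congr 2
  rw [Real.coe_toNNReal _ (sub_nonneg.2 huv)]
  push_cast; ring

/-- characteristic-function form of the planar Brownian property -/
structure PB (μ : Measure Ω) (F : ℝ → MeasurableSpace Ω) (B₁ B₂ : ℝ → Ω → ℝ) : Prop where
  le : ∀ t : ℝ, F t ≤ m
  mono : Monotone F
  meas₁ : ∀ t : ℝ, 0 ≤ t → Measurable[F t] (B₁ t)
  meas₂ : ∀ t : ℝ, 0 ≤ t → Measurable[F t] (B₂ t)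
  cf : ∀ s t : ℝ, 0 ≤ s → s ≤ t → ∀ a b : ℝ, ∀ Z : Ω → ℂ, Measurable[F s] Z → ∀ C : ℝ,
    (∀ ω, ‖Z ω‖ ≤ C) →
    ∫ ω, Z ω * Complex.exp (Complex.I * ((a * (B₁ t ω - B₁ s ω) + b * (B₂ t ω - B₂ s ω) : ℝ) : ℂ)) ∂μ =
      Complex.exp (((-((a ^ 2 + b ^ 2) * (t - s) / 2) : ℝ)) : ℂ) * ∫ ω, Z ω ∂μ

/-- exponential martingale along a process -/
def eM (B : ℝ → Ω → ℝ) (θ s u : ℝ) (ω : Ω) : ℂ :=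
  Complex.exp (Complex.I * ((θ * (B u ω - B s ω) : ℝ) : ℂ)) * Complex.exp (((θ ^ 2 * (u - s) / 2 : ℝ)) : ℂ)

lemma eM_norm (B : ℝ → Ω → ℝ) (θ s u : ℝ) (ω : Ω) : ‖eM B θ s u ω‖ = Real.exp (θ ^ 2 * (u - s) / 2) := by
  rw [eM, norm_mul, mul_comm Complex.I, Complex.norm_exp_ofReal_mul_I, one_mul, ← Complex.ofReal_exp, Complex.norm_real,
    Real.norm_eq_abs, Real.abs_exp]

lemma eM_mul (B : ℝ → Ω → ℝ) (θ s u v : ℝ) (ω : Ω) : eM B θ s v ω = eM B θ s u ω * eM B θ u v ω := by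
  simp only [eM, ← Complex.exp_add]
  congr 1
  push_cast; ring

lemma eM_self (B : ℝ → Ω → ℝ) (θ s : ℝ) (ω : Ω) : eM B θ s s ω = 1 := by
  simp [eM]

lemma isBM_eM {μ : Measure Ω} [IsProbabilityMeasure μ] {F : ℝ → MeasurableSpace Ω} {B : ℝ → Ω → ℝ}
    (hB : IsBM μ F B) {u v : ℝ} (hu : 0 ≤ u) (huv : u ≤ v) (θ : ℝ) {Z : Ω → ℂ}
    (hZ : Measurable[F u] Z) :
    ∫ ω, Z ω * eM B θ u v ω ∂μ = ∫ ω, Z ω ∂μ := by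
  simp only [eM, ← mul_assoc]
  rw [integral_mul_const, isBM_cf hB hu huv θ hZ, mul_right_comm, ← Complex.exp_add]
  push_cast
  rw [show (-((θ:ℂ) ^ 2 * (v - u) / 2) + θ ^ 2 * (v - u) / 2) = 0 by ring]
  simp

lemma eM_meas {Ω : Type*} {𝒢 : MeasurableSpace Ω} {B : ℝ → Ω → ℝ} {s u : ℝ} (θ : ℝ)
    (hs : Measurable[𝒢] (B s)) (hu : Measurable[𝒢] (B u)) : Measurable[𝒢] (eM B θ s u) := by
  unfold eM
  fun_prop

/-- increments of eM -/
def eD (B : ℝ → Ω → ℝ) (θ s u v : ℝ) (ω : Ω) : ℂ := eM B θ s v ω - eM B θ s u ω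

lemma eD_zero {μ : Measure Ω} [IsProbabilityMeasure μ] {F : ℝ → MeasurableSpace Ω} {B : ℝ → Ω → ℝ}
    (hB : IsBM μ F B) {s u v : ℝ} (hs : 0 ≤ s) (hsu : s ≤ u) (huv : u ≤ v) (θ : ℝ) {Z : Ω → ℂ}
    (hZ : Measurable[F u] Z) (C : ℝ) (hC : ∀ ω, ‖Z ω‖ ≤ C) :
    ∫ ω, Z ω * eD B θ s u v ω ∂μ = 0 := by
  have hu := hs.trans hsu
  have hBv : Measurable (B v) := (measurable_iff_comap_le.2 (hB.adapted v (hu.trans huv))).mono (hB.le v) le_rfl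
  have hBu : Measurable[F u] (B u) := (measurable_iff_comap_le.2 (hB.adapted u hu))
  have hBu' : Measurable (B u) := hBu.mono (hB.le u) le_rfl
  have hBs : Measurable[F u] (B s) := (measurable_iff_comap_le.2 (hB.adapted s hs)).mono (hB.mono hsu) le_rfl
  have hM : Measurable[F u] (eM B θ s u) := eM_meas θ hBs hBu
  have hZM : Measurable[F u] (fun ω => Z ω * eM B θ s u ω) := hZ.mul hM
  have h1 : ∀ ω, Z ω * eD B θ s u v ω = (Z ω * eM B θ s u ω) * eM B θ u v ω - Z ω * eM B θ s u ω := by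
    intro ω
    rw [eD, eM_mul B θ s u v]; ring
  simp_rw [h1]
  have hm1 : Measurable (fun ω => Z ω * eM B θ s u ω) := hZM.mono (hB.le u) le_rfl
  have hb1 : ∀ ω, ‖Z ω * eM B θ s u ω‖ ≤ C * Real.exp (θ ^ 2 * (u - s) / 2) := by
    intro ω
    rw [norm_mul, eM_norm]
    have := hC ω
    gcongr
  rw [integral_sub, isBM_eM hB hu huv θ hZM, sub_self]
  · refine integrable_of_bdd (hm1.mul (eM_meas θ hBu' hBv)) (C * Real.exp (θ ^ 2 * (u - s) / 2) * Real.exp (θ ^ 2 * (v - u) / 2)) fun ω => ?_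
    rw [norm_mul _ (eM B θ u v ω), eM_norm]
    have := hb1 ω
    gcongr
  · exact integrable_of_bdd hm1 _ hb1

lemma eD_norm_le (B : ℝ → Ω → ℝ) (θ s u v : ℝ) (hsu : s ≤ u) (huv : u ≤ v) (ω : Ω) :
    ‖eD B θ s u v ω‖ ≤ 2 * Real.exp (θ ^ 2 * (v - s) / 2) := by
  rw [eD]
  refine (norm_sub_le _ _).trans ?_
  rw [eM_norm, eM_norm]
  have : Real.exp (θ ^ 2 * (u - s) / 2) ≤ Real.exp (θ ^ 2 * (v - s) / 2) := by
    apply Real.exp_le_exp.2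
    have : θ ^ 2 * (u - s) ≤ θ ^ 2 * (v - s) := by gcongr
    linarith
  linarith

lemma eD_sq {μ : Measure Ω} [IsProbabilityMeasure μ] {F : ℝ → MeasurableSpace Ω} {B : ℝ → Ω → ℝ}
    (hB : IsBM μ F B) {s u v : ℝ} (hs : 0 ≤ s) (hsu : s ≤ u) (huv : u ≤ v) (θ : ℝ) :
    ‖∫ ω, eD B θ s u v ω * (starRingEnd ℂ) (eD B θ s u v ω) ∂μ‖ ≤
      Real.exp (θ ^ 2 * (u - s)) * (Real.exp (θ ^ 2 * (v - u)) - 1) := by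
  have hu := hs.trans hsu
  have hBv : Measurable (B v) := (measurable_iff_comap_le.2 (hB.adapted v (hu.trans huv))).mono (hB.le v) le_rfl
  have hBu : Measurable (B u) := (measurable_iff_comap_le.2 (hB.adapted u hu)).mono (hB.le u) le_rfl
  have he : Measurable (eM B θ u v) := eM_meas θ hBu hBv
  have hei : Integrable (eM B θ u v) μ := integrable_of_bdd he _ fun ω => (eM_norm B θ u v ω).le
  have hintg : ∫ ω, eM B θ u v ω ∂μ = 1 := by
    have := isBM_eM hB hu huv θ (Z := fun _ => 1) measurable_const
    simpa using this
  have h1 : ∀ ω, ‖eD B θ s u v ω * (starRingEnd ℂ) (eD B θ s u v ω)‖ =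
      Real.exp (θ ^ 2 * (u - s)) * (Real.exp (θ ^ 2 * (v - u)) + 1 - 2 * (eM B θ u v ω).re) := by
    intro ω
    have e0 : eD B θ s u v ω = eM B θ s u ω * (eM B θ u v ω - 1) := by
      rw [eD, eM_mul B θ s u v]; ring
    rw [norm_mul, RCLike.norm_conj, e0, norm_mul, eM_norm]
    have e1 : ‖eM B θ u v ω - 1‖ ^ 2 = Real.exp (θ ^ 2 * (v - u)) + 1 - 2 * (eM B θ u v ω).re := by
      have e2 : ‖eM B θ u v ω‖ ^ 2 = Real.exp (θ ^ 2 * (v - u)) := by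
        rw [eM_norm, ← Real.exp_nat_mul]; congr 1; push_cast; ring
      rw [← e2, ← Complex.normSq_eq_norm_sq, ← Complex.normSq_eq_norm_sq, Complex.normSq_apply, Complex.normSq_apply]
      simp; ring
    have e3 : Real.exp (θ ^ 2 * (u - s) / 2) * Real.exp (θ ^ 2 * (u - s) / 2) = Real.exp (θ ^ 2 * (u - s)) := by
      rw [← Real.exp_add]; congr 1; ring
    rw [← e1, ← e3]; ring
  refine (norm_integral_le_integral_norm _).trans ?_
  simp_rw [h1]
  have hre : Integrable (fun ω => (eM B θ u v ω).re) μ := hei.re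
  rw [integral_const_mul, integral_sub (integrable_const _) (hre.const_mul 2), integral_const_mul]
  have : ∫ ω, (eM B θ u v ω).re ∂μ = 1 := by
    have := integral_re hei
    simp only [RCLike.re_to_complex] at this
    rw [this, hintg]; simp
  simp only [RCLike.re_to_complex, this]
  simp
  refine le_of_eq ?_
  ring

lemma planar_PB {μ : Measure Ω} [IsProbabilityMeasure μ] {F : ℝ → MeasurableSpace Ω} {B₁ B₂ : ℝ → Ω → ℝ}
    (hB : IsPlanarBM μ F B₁ B₂) : PB μ F B₁ B₂ := by
  obtain ⟨hB1, hB2, hI⟩ := hB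
  have m1 : ∀ t : ℝ, 0 ≤ t → Measurable[F t] (B₁ t) := fun t ht => measurable_iff_comap_le.2 (hB1.adapted t ht)
  have m2 : ∀ t : ℝ, 0 ≤ t → Measurable[F t] (B₂ t) := fun t ht => measurable_iff_comap_le.2 (hB2.adapted t ht)
  refine ⟨hB1.le, hB1.mono, m1, m2, ?_⟩
  intro s t hs hst a b Z hZ C hC
  have hC0 : 0 ≤ C := by
    have : Nonempty Ω := μ.nonempty_of_neZero
    exact (norm_nonneg _).trans (hC (Classical.arbitrary Ω))
  have hZm : Measurable Z := hZ.mono (hB1.le s) le_rfl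
  set T := t - s with hT
  have hT0 : 0 ≤ T := sub_nonneg.2 hst
  set Θ := a ^ 2 + b ^ 2 with hΘ
  have ha0 : 0 ≤ a ^ 2 := sq_nonneg a
  have hb0 : 0 ≤ b ^ 2 := sq_nonneg b
  have M1m : Measurable (eM B₁ a s t) := eM_meas a ((m1 s hs).mono (hB1.le s) le_rfl) ((m1 t (hs.trans hst)).mono (hB1.le t) le_rfl)
  have M2m : Measurable (eM B₂ b s t) := eM_meas b ((m2 s hs).mono (hB1.le s) le_rfl) ((m2 t (hs.trans hst)).mono (hB1.le t) le_rfl)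
  have key : ∫ ω, Z ω * ((eM B₁ a s t ω - 1) * (eM B₂ b s t ω - 1)) ∂μ = 0 := by
    set L := Real.exp (Θ * T) * (Θ * T) * Real.exp (Θ * T) with hL
    have bound : ∀ N : ℕ, 0 < N → ∀ η : ℝ, 0 < η →
        ‖∫ ω, Z ω * ((eM B₁ a s t ω - 1) * (eM B₂ b s t ω - 1)) ∂μ‖ ≤ C * (η / 2 + N * (L / N) ^ 2 / (2 * η)) := by
      intro N hN η hη
      have hN' : (0:ℝ) < N := by exact_mod_cast hN
      set u : ℕ → ℝ := fun k => s + T * k / N with hu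
      have u0 : u 0 = s := by simp [hu]
      have uN : u N = t := by simp only [hu]; field_simp; rw [hT]; ring
      have umono : Monotone u := by
        intro i j hij
        simp only [hu]
        have : (i:ℝ) ≤ j := by exact_mod_cast hij
        gcongr
      have us : ∀ k, s ≤ u k := fun k => by rw [← u0]; exact umono (Nat.zero_le k)
      have u0' : ∀ k, 0 ≤ u k := fun k => hs.trans (us k)
      have ut : ∀ k, k ≤ N → u k ≤ t := fun k hk => by rw [← uN]; exact umono hk
      have ustep : ∀ k, u (k+1) - u k = T / N := by
        intro k; simp only [hu]; push_cast; field_simp; ring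
      have sum1 : ∀ (B : ℝ → Ω → ℝ) (θ : ℝ) ω, eM B θ s t ω - 1 = ∑ k ∈ Finset.range N, eD B θ s (u k) (u (k+1)) ω := by
        intro B θ ω
        simp only [eD]
        rw [Finset.sum_range_sub (fun k => eM B θ s (u k) ω), u0, uN, eM_self]
      simp_rw [sum1]
      have D1m : ∀ k l, k < l → Measurable[F (u l)] (fun ω => eD B₁ a s (u k) (u (k+1)) ω) := by
        intro k l hkl
        have h1 : Measurable[F (u l)] (B₁ s) := (m1 s hs).mono (hB1.mono (us l)) le_rfl
        have h2 : Measurable[F (u l)] (B₁ (u k)) := (m1 _ (u0' k)).mono (hB1.mono (umono hkl.le)) le_rfl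
        have h3 : Measurable[F (u l)] (B₁ (u (k+1))) := (m1 _ (u0' (k+1))).mono (hB1.mono (umono hkl)) le_rfl
        exact (eM_meas a h1 h3).sub (eM_meas a h1 h2)
      have D2m : ∀ k l, k < l → Measurable[F (u l)] (fun ω => eD B₂ b s (u k) (u (k+1)) ω) := by
        intro k l hkl
        have h1 : Measurable[F (u l)] (B₂ s) := (m2 s hs).mono (hB1.mono (us l)) le_rfl
        have h2 : Measurable[F (u l)] (B₂ (u k)) := (m2 _ (u0' k)).mono (hB1.mono (umono hkl.le)) le_rfl
        have h3 : Measurable[F (u l)] (B₂ (u (k+1))) := (m2 _ (u0' (k+1))).mono (hB1.mono (umono hkl)) le_rfl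
        exact (eM_meas b h1 h3).sub (eM_meas b h1 h2)
      have D1M : ∀ k, Measurable (fun ω => eD B₁ a s (u k) (u (k+1)) ω) := fun k => (D1m k (k+1) (Nat.lt_succ_self k)).mono (hB1.le _) le_rfl
      have D2M : ∀ k, Measurable (fun ω => eD B₂ b s (u k) (u (k+1)) ω) := fun k => (D2m k (k+1) (Nat.lt_succ_self k)).mono (hB1.le _) le_rfl
      set C' := 2 * Real.exp (Θ * T / 2) with hC'
      have bD : ∀ (B : ℝ → Ω → ℝ) (θ : ℝ), θ ^ 2 ≤ Θ → ∀ k ∈ Finset.range N, ∀ ω, ‖eD B θ s (u k) (u (k+1)) ω‖ ≤ C' := by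
        intro B θ hθ k hk ω
        refine (eD_norm_le B θ s _ _ (us k) (umono (Nat.le_succ k)) ω).trans ?_
        rw [hC']
        have : u (k+1) - s ≤ T := by
          have := ut (k+1) (Finset.mem_range.1 hk); rw [hT]; linarith
        have : 0 ≤ u (k+1) - s := sub_nonneg.2 (us (k+1))
        gcongr
      have bK : ∀ (B : ℝ → Ω → ℝ) (θ : ℝ), IsBM μ F B → θ ^ 2 ≤ Θ → ∀ k ∈ Finset.range N,
          ‖∫ ω, eD B θ s (u k) (u (k+1)) ω * (starRingEnd ℂ) (eD B θ s (u k) (u (k+1)) ω) ∂μ‖ ≤ L / N := by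
        intro B θ hBM hθ k hk
        refine (eD_sq hBM hs (us k) (umono (Nat.le_succ k)) θ).trans ?_
        rw [ustep]
        have hθ0 : 0 ≤ θ ^ 2 := sq_nonneg θ
        have h1 : u k - s ≤ T := by
          have := ut k (Finset.mem_range.1 hk).le; rw [hT]; linarith
        have h2 : Real.exp (θ ^ 2 * (T / N)) - 1 ≤ (Θ * T) * Real.exp (Θ * T) / N := by
          have e1 : Real.exp (θ ^ 2 * (T / N)) - 1 ≤ θ ^ 2 * (T / N) * Real.exp (θ ^ 2 * (T / N)) := by
            have := Real.add_one_le_exp (-(θ ^ 2 * (T / N)))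
            have e2 := mul_le_mul_of_nonneg_right this (Real.exp_pos (θ ^ 2 * (T / N))).le
            rw [← Real.exp_add, neg_add_cancel, Real.exp_zero] at e2
            linarith
          refine e1.trans ?_
          have e3 : T / N ≤ T := div_le_self hT0 (by exact_mod_cast hN)
          have e4 : θ ^ 2 * (T / N) ≤ Θ * T := by gcongr
          calc θ ^ 2 * (T / N) * Real.exp (θ ^ 2 * (T / N)) ≤ Θ * (T / N) * Real.exp (Θ * T) := by gcongr
            _ = _ := by ring
        calc Real.exp (θ ^ 2 * (u k - s)) * (Real.exp (θ ^ 2 * (T / N)) - 1) ≤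
            Real.exp (Θ * T) * ((Θ * T) * Real.exp (Θ * T) / N) := by
              have : 0 ≤ Real.exp (θ ^ 2 * (T / N)) - 1 := by
                rw [sub_nonneg]; apply Real.one_le_exp; positivity
              have : 0 ≤ u k - s := sub_nonneg.2 (us k)
              gcongr
          _ = L / N := by rw [hL]; ring
      have hmc : Measurable (starRingEnd ℂ) := Complex.continuous_conj.measurable
      have haΘ : a ^ 2 ≤ Θ := by rw [hΘ]; linarith
      have hbΘ : b ^ 2 ≤ Θ := by rw [hΘ]; linarith
      refine abs_mart_prod N (fun k ω => eD B₁ a s (u k) (u (k+1)) ω) (fun k ω => eD B₂ b s (u k) (u (k+1)) ω) Z C C' (L / N) η hη hZm D1M D2M hC (bD B₁ a haΘ) (bD B₂ b hbΘ) ?_ ?_ ?_ (bK B₁ a hB1 haΘ) (bK B₂ b hB2 hbΘ)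
      · intro k hk l hl hkl
        have hZ' : ∀ j, Measurable[F (u j)] Z := fun j => hZ.mono (hB1.mono (us j)) le_rfl
        rcases lt_or_gt_of_ne hkl with h | h
        · have := eD_zero hB2 hs (us l) (umono (Nat.le_succ l)) b ((hZ' l).mul (D1m k l h)) (C * C') (fun ω => by
            rw [Pi.mul_apply, norm_mul]
            exact mul_le_mul (hC ω) (bD B₁ a haΘ k hk ω) (norm_nonneg _) hC0)
          rw [← this]
          refine integral_congr_ae (Eventually.of_forall fun ω => ?_)
          simp only [Pi.mul_apply, Nat.succ_eq_add_one]; ring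
        · have := eD_zero hB1 hs (us k) (umono (Nat.le_succ k)) a ((hZ' k).mul (D2m l k h)) (C * C') (fun ω => by
            rw [Pi.mul_apply, norm_mul]
            exact mul_le_mul (hC ω) (bD B₂ b hbΘ l hl ω) (norm_nonneg _) hC0)
          rw [← this]
          refine integral_congr_ae (Eventually.of_forall fun ω => ?_)
          simp only [Pi.mul_apply, Nat.succ_eq_add_one]; ring
      · intro k hk l hl hkl
        rcases lt_or_gt_of_ne hkl with h | h
        · have := eD_zero hB1 hs (us l) (umono (Nat.le_succ l)) a (hmc.comp (D1m k l h)) C' (fun ω => by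
            simp only [Function.comp_apply]
            rw [RCLike.norm_conj]
            exact (bD B₁ a haΘ k hk ω))
          have h2 := integral_conj (μ := μ) (f := fun ω => (starRingEnd ℂ ∘ fun ω => eD B₁ a s (u k) (u (k + 1)) ω) ω * eD B₁ a s (u l) (u (l + 1)) ω)
          rw [this] at h2
          simpa using h2
        · have := eD_zero hB1 hs (us k) (umono (Nat.le_succ k)) a (hmc.comp (D1m l k h)) C' (fun ω => by
            simp only [Function.comp_apply]
            rw [RCLike.norm_conj]
            exact (bD B₁ a haΘ l hl ω))
          rw [← this]
          refine integral_congr_ae (Eventually.of_forall fun ω => ?_)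
          simp only [Function.comp_apply]; ring
      · intro k l
        have hco : ∀ v : ℝ, Measurable ((fun v x => x v : ℝ → (ℝ → ℝ) → ℝ) v) := fun v => measurable_pi_apply v
        have hφ : ∀ θ k, Measurable (fun x => eD (fun v x => x v : ℝ → (ℝ → ℝ) → ℝ) θ s (u k) (u (k+1)) x) := by
          intro θ k
          exact (eM_meas θ (hco _) (hco _)).sub (eM_meas θ (hco _) (hco _))
        have h1 := hI.comp ((hφ a k).mul (hmc.comp (hφ a l))) ((hφ b k).mul (hmc.comp (hφ b l)))
        exact h1.integral_fun_mul_eq_mul_integral ((D1M k).mul (hmc.comp (D1M l))).aestronglyMeasurable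
          ((D2M k).mul (hmc.comp (D2M l))).aestronglyMeasurable
    have lim1 : ∀ η : ℝ, 0 < η → ‖∫ ω, Z ω * ((eM B₁ a s t ω - 1) * (eM B₂ b s t ω - 1)) ∂μ‖ ≤ C * (η / 2) := by
      intro η hη
      have h1 : Tendsto (fun N : ℕ => C * (η / 2 + (L ^ 2 / (2 * η)) * (1 / (N : ℝ)))) atTop (nhds (C * (η / 2 + (L ^ 2 / (2 * η)) * 0))) :=
        ((tendsto_one_div_atTop_nhds_zero_nat.const_mul _).const_add _).const_mul _
      rw [mul_zero, add_zero] at h1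
      refine ge_of_tendsto h1 ?_
      filter_upwards [eventually_gt_atTop 0] with N hN
      refine (bound N hN η hη).trans (le_of_eq ?_)
      have hN' : (0:ℝ) < N := by exact_mod_cast hN
      field_simp
    have lim2 : Tendsto (fun η : ℝ => C * (η / 2)) (nhdsWithin 0 (Ioi 0)) (nhds (C * (0 / 2))) :=
      (Continuous.tendsto (by fun_prop : Continuous fun η : ℝ => C * (η / 2)) 0).mono_left nhdsWithin_le_nhds
    have lim3 := ge_of_tendsto lim2 (eventually_nhdsWithin_of_forall fun η hη => lim1 η hη)
    simp only [zero_div, mul_zero, norm_le_zero_iff] at lim3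
    exact lim3
  have hi0 : Integrable Z μ := integrable_of_bdd hZm C hC
  have hi : ∀ (f : Ω → ℂ), Measurable f → ∀ K : ℝ, (∀ ω, ‖f ω‖ = K) → Integrable (fun ω => Z ω * f ω) μ := by
    intro f hf K hK
    refine integrable_of_bdd (hZm.mul hf) (C * K) fun ω => ?_
    rw [norm_mul, hK]
    have := hC ω
    have : 0 ≤ K := by rw [← hK ω]; exact norm_nonneg _
    gcongr
  have i1 := hi _ M1m _ (eM_norm B₁ a s t)
  have i2 := hi _ M2m _ (eM_norm B₂ b s t)
  have i12 : Integrable (fun ω => Z ω * (eM B₁ a s t ω * eM B₂ b s t ω)) μ := 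
    hi _ (M1m.mul M2m) (Real.exp (a ^ 2 * (t - s) / 2) * Real.exp (b ^ 2 * (t - s) / 2)) fun ω => by
      rw [norm_mul, eM_norm, eM_norm]
  have e1 : ∫ ω, Z ω * (eM B₁ a s t ω * eM B₂ b s t ω) ∂μ = ∫ ω, Z ω ∂μ := by
    have : ∀ ω, Z ω * ((eM B₁ a s t ω - 1) * (eM B₂ b s t ω - 1)) =
      Z ω * (eM B₁ a s t ω * eM B₂ b s t ω) - Z ω * eM B₁ a s t ω - Z ω * eM B₂ b s t ω + Z ω := by intro ω; ring
    simp_rw [this] at key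
    have i3 : Integrable (fun ω => Z ω * (eM B₁ a s t ω * eM B₂ b s t ω) - Z ω * eM B₁ a s t ω) μ := i12.sub i1
    have i4 : Integrable (fun ω => Z ω * (eM B₁ a s t ω * eM B₂ b s t ω) - Z ω * eM B₁ a s t ω - Z ω * eM B₂ b s t ω) μ := i3.sub i2
    rw [integral_add i4 hi0, integral_sub i3 i2, integral_sub i12 i1,
      isBM_eM hB1 hs hst a hZ, isBM_eM hB2 hs hst b hZ] at key
    linear_combination key
  rw [← e1, ← integral_const_mul]
  refine integral_congr_ae (Eventually.of_forall fun ω => ?_)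
  simp only [eM]
  rw [show Complex.exp (((-(Θ * T / 2) : ℝ)) : ℂ) = Complex.exp (((-(a ^ 2 * (t - s) / 2) : ℝ)) : ℂ) * Complex.exp (((-(b ^ 2 * (t - s) / 2) : ℝ)) : ℂ) by
    rw [← Complex.exp_add]; congr 1; push_cast [hΘ, hT]; ring]
  rw [show Complex.exp (Complex.I * ((a * (B₁ t ω - B₁ s ω) + b * (B₂ t ω - B₂ s ω) : ℝ) : ℂ)) =
    Complex.exp (Complex.I * ((a * (B₁ t ω - B₁ s ω) : ℝ) : ℂ)) * Complex.exp (Complex.I * ((b * (B₂ t ω - B₂ s ω) : ℝ) : ℂ)) by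
    rw [← Complex.exp_add]; congr 1; push_cast; ring]
  have n1 : ∀ x : ℝ, Complex.exp (((-x : ℝ)) : ℂ) * Complex.exp ((x : ℝ) : ℂ) = 1 := by
    intro x; rw [← Complex.exp_add]; simp
  have n2 := n1 (a ^ 2 * (t - s) / 2)
  have n3 := n1 (b ^ 2 * (t - s) / 2)
  generalize Complex.exp (((-(a ^ 2 * (t - s) / 2) : ℝ)) : ℂ) = p at *
  generalize Complex.exp (((a ^ 2 * (t - s) / 2 : ℝ)) : ℂ) = p' at *
  generalize Complex.exp (((-(b ^ 2 * (t - s) / 2) : ℝ)) : ℂ) = q at *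
  generalize Complex.exp (((b ^ 2 * (t - s) / 2 : ℝ)) : ℂ) = q' at *
  generalize Complex.exp (Complex.I * ((a * (B₁ t ω - B₁ s ω) : ℝ) : ℂ)) = x
  generalize Complex.exp (Complex.I * ((b * (B₂ t ω - B₂ s ω) : ℝ) : ℂ)) = y
  linear_combination (-(Z ω) * x * y * (q * q')) * n2 - (Z ω) * x * y * n3

end planar

section incr

/-- linear combination of increments with complex-coded coefficient -/
def dB (B₁ B₂ : ℝ → Ω → ℝ) (a : ℂ) (s t : ℝ) (ω : Ω) : ℝ :=
  a.re * (B₁ t ω - B₁ s ω) + a.im * (B₂ t ω - B₂ s ω)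

lemma dB_add (B₁ B₂ : ℝ → Ω → ℝ) (a : ℂ) (s t u : ℝ) (ω : Ω) :
    dB B₁ B₂ a s u ω = dB B₁ B₂ a s t ω + dB B₁ B₂ a t u ω := by
  simp only [dB]; ring

variable {μ : Measure Ω} [IsProbabilityMeasure μ] {F : ℝ → MeasurableSpace Ω} {B₁ B₂ : ℝ → Ω → ℝ}

lemma PB.measF (hP : PB μ F B₁ B₂) (a : ℂ) {s t r : ℝ} (hs : 0 ≤ s) (hst : s ≤ t) (htr : t ≤ r) :
    Measurable[F r] (dB B₁ B₂ a s t) := by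
  have h1 := (hP.meas₁ s hs).mono (hP.mono (hst.trans htr)) le_rfl
  have h2 := (hP.meas₂ s hs).mono (hP.mono (hst.trans htr)) le_rfl
  have h3 := (hP.meas₁ t (hs.trans hst)).mono (hP.mono htr) le_rfl
  have h4 := (hP.meas₂ t (hs.trans hst)).mono (hP.mono htr) le_rfl
  exact ((h3.sub h1).const_mul _).add ((h4.sub h2).const_mul _)

lemma PB.meas (hP : PB μ F B₁ B₂) (a : ℂ) {s t : ℝ} (hs : 0 ≤ s) (hst : s ≤ t) :
    Measurable (dB B₁ B₂ a s t) := (hP.measF a hs hst le_rfl).mono (hP.le t) le_rfl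

lemma PB.restrict_law (hP : PB μ F B₁ B₂) (a : ℂ) {s t : ℝ} (hs : 0 ≤ s) (hst : s ≤ t)
    {A : Set Ω} (hA : MeasurableSet[F s] A) :
    (μ.restrict A).map (dB B₁ B₂ a s t) =
      (μ A) • gaussianReal 0 (Complex.normSq a * (t - s)).toNNReal := by
  have hAm : MeasurableSet A := hP.le s _ hA
  have hm := hP.meas a hs hst
  have hfin : IsFiniteMeasure (μ A • gaussianReal 0 (Complex.normSq a * (t - s)).toNNReal) :=
    Measure.smul_finite _ (measure_ne_top μ A)
  apply Measure.ext_of_charFun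
  ext κ
  rw [charFun_apply_real, integral_map hm.aemeasurable (by fun_prop)]
  have h1 := hP.cf s t hs hst (κ * a.re) (κ * a.im) (A.indicator fun _ => (1:ℂ))
    (measurable_const.indicator hA) 1 (fun ω => by
      by_cases h : ω ∈ A <;> simp [h])
  have h2 : ∫ ω in A, Complex.exp (κ * (dB B₁ B₂ a s t ω : ℂ) * Complex.I) ∂μ =
      ∫ ω, A.indicator (fun _ => (1:ℂ)) ω * Complex.exp (Complex.I * ((κ * a.re * (B₁ t ω - B₁ s ω) + κ * a.im * (B₂ t ω - B₂ s ω) : ℝ) : ℂ)) ∂μ := by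
    rw [← integral_indicator hAm]
    refine integral_congr_ae (Eventually.of_forall fun ω => ?_)
    by_cases h : ω ∈ A
    · simp only [h, indicator_of_mem, one_mul, dB]
      congr 1; push_cast; ring
    · simp [h]
  rw [h2, h1]
  have h3 : ∫ ω, A.indicator (fun _ => (1:ℂ)) ω ∂μ = (μ.real A : ℂ) := by
    rw [integral_indicator hAm]; simp
  rw [h3]
  have h4 : charFun (μ A • gaussianReal 0 (Complex.normSq a * (t - s)).toNNReal) κ =
      (μ.real A : ℂ) * charFun (gaussianReal 0 (Complex.normSq a * (t - s)).toNNReal) κ := by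
    rw [charFun_apply_real, charFun_apply_real, integral_smul_measure]
    simp [Measure.real, Complex.real_smul]
  rw [h4, charFun_gaussianReal, mul_comm]
  congr 2
  rw [Real.coe_toNNReal _ (mul_nonneg (Complex.normSq_nonneg _) (sub_nonneg.2 hst)), Complex.normSq_apply]
  push_cast; ring

lemma PB.law (hP : PB μ F B₁ B₂) (a : ℂ) {s t : ℝ} (hs : 0 ≤ s) (hst : s ≤ t) :
    μ.map (dB B₁ B₂ a s t) = gaussianReal 0 (Complex.normSq a * (t - s)).toNNReal := by
  have := hP.restrict_law a hs hst (A := univ) MeasurableSet.univ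
  simpa using this

lemma PB.indepFun (hP : PB μ F B₁ B₂) (a : ℂ) {s t : ℝ} (hs : 0 ≤ s) (hst : s ≤ t)
    {β : Type*} [MeasurableSpace β] {G : Ω → β} (hG : Measurable[F s] G) :
    IndepFun G (dB B₁ B₂ a s t) μ := by
  have hm := hP.meas a hs hst
  rw [IndepFun_iff_Indep]
  refine indep_of_indep_of_le_left ?_ hG.comap_le
  rw [Indep_iff]
  rintro A _ hA ⟨S, hS, rfl⟩
  have h1 := hP.restrict_law a hs hst hA
  have h2 := congrArg (fun ν : Measure ℝ => ν S) h1
  have h3 := congrArg (fun ν : Measure ℝ => ν S) (hP.law a hs hst)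
  rw [Measure.map_apply hm hS, Measure.restrict_apply (hm hS), ← h1] at h2
  rw [Measure.map_apply hm hS] at h3
  rw [h1, Measure.smul_apply, smul_eq_mul, ← h3] at h2
  rw [inter_comm]; exact h2

lemma PB.memLp (hP : PB μ F B₁ B₂) (a : ℂ) {s t : ℝ} (hs : 0 ≤ s) (hst : s ≤ t) :
    MemLp (dB B₁ B₂ a s t) 2 μ := by
  have hm := hP.meas a hs hst
  have h := memLp_id_gaussianReal' (μ := 0) (v := (Complex.normSq a * (t - s)).toNNReal) 2 (by simp)
  rw [← hP.law a hs hst, memLp_map_measure_iff (by fun_prop) hm.aemeasurable] at h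
  exact h

lemma PB.mean (hP : PB μ F B₁ B₂) (a : ℂ) {s t : ℝ} (hs : 0 ≤ s) (hst : s ≤ t) :
    ∫ ω, dB B₁ B₂ a s t ω ∂μ = 0 := by
  have hm := hP.meas a hs hst
  have h := integral_map (μ := μ) hm.aemeasurable (f := fun x : ℝ => x) (by fun_prop)
  rw [← h, hP.law a hs hst, integral_id_gaussianReal]

lemma PB.sq (hP : PB μ F B₁ B₂) (a : ℂ) {s t : ℝ} (hs : 0 ≤ s) (hst : s ≤ t) :
    ∫ ω, dB B₁ B₂ a s t ω ^ 2 ∂μ = Complex.normSq a * (t - s) := by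
  have hm := hP.meas a hs hst
  have h := integral_map (μ := μ) hm.aemeasurable (f := fun x : ℝ => x ^ 2) (by fun_prop)
  rw [← h, hP.law a hs hst]
  have h2 := variance_id_gaussianReal (μ := 0) (v := (Complex.normSq a * (t - s)).toNNReal)
  rw [variance_eq_integral aemeasurable_id] at h2
  simp only [id, integral_id_gaussianReal, sub_zero] at h2
  rw [h2, Real.coe_toNNReal _ (mul_nonneg (Complex.normSq_nonneg _) (sub_nonneg.2 hst))]

lemma PB.mul_zero (hP : PB μ F B₁ B₂) (a : ℂ) {s t : ℝ} (hs : 0 ≤ s) (hst : s ≤ t)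
    {G : Ω → ℝ} (hG : Measurable[F s] G) : ∫ ω, G ω * dB B₁ B₂ a s t ω ∂μ = 0 := by
  rw [(hP.indepFun a hs hst hG).integral_fun_mul_eq_mul_integral
    (hG.mono (hP.le s) le_rfl).aestronglyMeasurable (hP.meas a hs hst).aestronglyMeasurable,
    hP.mean a hs hst, MulZeroClass.mul_zero]

lemma memLp_bdd_mul {G f : Ω → ℝ} (hG : Measurable G) {C : ℝ} (hC : ∀ ω, |G ω| ≤ C) (hf : MemLp f 2 μ) :
    MemLp (fun ω => G ω * f ω) 2 μ := by
  have hG' : MemLp G ⊤ μ := memLp_top_of_bound hG.aestronglyMeasurable C (Eventually.of_forall hC)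
  have := hf.smul (r := 2) hG'
  exact this

lemma PB.mul_sq (hP : PB μ F B₁ B₂) (a : ℂ) {s t : ℝ} (hs : 0 ≤ s) (hst : s ≤ t)
    {G : Ω → ℝ} (hG : Measurable[F s] G) :
    ∫ ω, G ω * dB B₁ B₂ a s t ω ^ 2 ∂μ = Complex.normSq a * (t - s) * ∫ ω, G ω ∂μ := by
  have h := (hP.indepFun a hs hst hG).comp measurable_id (measurable_id.pow_const 2)
  have h2 := h.integral_fun_mul_eq_mul_integral
    (hG.mono (hP.le s) le_rfl).aestronglyMeasurable ((hP.meas a hs hst).pow_const 2).aestronglyMeasurable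
  simp only [Function.comp_apply, id] at h2
  rw [h2]
  have h3 := hP.sq a hs hst
  rw [mul_comm]
  congr 1

lemma PB.mul_pol (hP : PB μ F B₁ B₂) (a b : ℂ) {s t : ℝ} (hs : 0 ≤ s) (hst : s ≤ t)
    {G : Ω → ℝ} (hG : Measurable[F s] G) {C : ℝ} (hC : ∀ ω, |G ω| ≤ C) :
    ∫ ω, G ω * (dB B₁ B₂ a s t ω * dB B₁ B₂ b s t ω) ∂μ = (a.re * b.re + a.im * b.im) * (t - s) * ∫ ω, G ω ∂μ := by
  have h1 := hP.mul_sq (a + b) hs hst hG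
  have h2 := hP.mul_sq (a - b) hs hst hG
  have hGm : Measurable G := hG.mono (hP.le s) le_rfl
  have hi : ∀ c, Integrable (fun ω => G ω * dB B₁ B₂ c s t ω ^ 2) μ := by
    intro c
    have := (memLp_bdd_mul hGm hC (hP.memLp c hs hst)).integrable_mul (hP.memLp c hs hst)
    refine this.congr (Eventually.of_forall fun ω => ?_)
    simp only [Pi.mul_apply]; ring
  have h3 : ∀ ω, G ω * (dB B₁ B₂ a s t ω * dB B₁ B₂ b s t ω) =
      (1/4) * (G ω * dB B₁ B₂ (a+b) s t ω ^ 2 - G ω * dB B₁ B₂ (a-b) s t ω ^ 2) := by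
    intro ω; simp only [dB, Complex.add_re, Complex.add_im, Complex.sub_re, Complex.sub_im]; ring
  simp_rw [h3]
  rw [integral_const_mul, integral_sub (hi _) (hi _), h1, h2]
  simp only [Complex.normSq_apply, Complex.add_re, Complex.add_im, Complex.sub_re, Complex.sub_im]
  ring

/-- the pairwise inner product, ordered case -/
lemma PB.inner_aux (hP : PB μ F B₁ B₂) (a b : ℂ) {u v u' v' : ℝ} (hu : 0 ≤ u) (huv : u ≤ v)
    (huu : u ≤ u') (huv' : u' ≤ v')
    {G G' : Ω → ℝ} (hG : Measurable[F u] G) {C : ℝ} (hC : ∀ ω, |G ω| ≤ C)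
    (hG' : Measurable[F u'] G') {C' : ℝ} (hC' : ∀ ω, |G' ω| ≤ C') :
    ∫ ω, (G ω * dB B₁ B₂ a u v ω) * (G' ω * dB B₁ B₂ b u' v' ω) ∂μ =
      (a.re * b.re + a.im * b.im) * max 0 (min v v' - u') * ∫ ω, G ω * G' ω ∂μ := by
  have hu' : 0 ≤ u' := hu.trans huu
  have hGu' : Measurable[F u'] G := hG.mono (hP.mono huu) le_rfl
  have hGm : Measurable G := hG.mono (hP.le _) le_rfl
  have hGm' : Measurable G' := hG'.mono (hP.le _) le_rfl
  -- early part contributes zero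
  have early : ∀ w, u ≤ w → w ≤ u' → ∫ ω, (G ω * dB B₁ B₂ a u w ω) * (G' ω * dB B₁ B₂ b u' v' ω) ∂μ = 0 := by
    intro w hw hw'
    have := hP.mul_zero b hu' huv' ((hGu'.mul (hP.measF a hu hw hw')).mul hG')
    rw [← this]
    refine integral_congr_ae (Eventually.of_forall fun ω => ?_)
    simp only [Pi.mul_apply]; ring
  have late : ∀ w w', u' ≤ w → w ≤ w' → ∀ c d, ∫ ω, (G ω * dB B₁ B₂ c u' w ω) * (G' ω * dB B₁ B₂ d w w' ω) ∂μ = 0 := by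
    intro w w' hw hw' c d
    have := hP.mul_zero d (hu'.trans hw) hw' (((hGu'.mono (hP.mono hw) le_rfl).mul (hP.measF c hu' hw le_rfl)).mul (hG'.mono (hP.mono hw) le_rfl))
    rw [← this]
    refine integral_congr_ae (Eventually.of_forall fun ω => ?_)
    simp only [Pi.mul_apply]; ring
  have late' : ∀ w w', u' ≤ w → w ≤ w' → ∀ c d, ∫ ω, (G ω * dB B₁ B₂ c w w' ω) * (G' ω * dB B₁ B₂ d u' w ω) ∂μ = 0 := by
    intro w w' hw hw' c d
    have := hP.mul_zero c (hu'.trans hw) hw' (((hGu'.mono (hP.mono hw) le_rfl).mul (hP.measF d hu' hw le_rfl)).mul (hG'.mono (hP.mono hw) le_rfl))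
    rw [← this]
    refine integral_congr_ae (Eventually.of_forall fun ω => ?_)
    simp only [Pi.mul_apply]; ring
  have same : ∀ w, u' ≤ w → ∫ ω, (G ω * dB B₁ B₂ a u' w ω) * (G' ω * dB B₁ B₂ b u' w ω) ∂μ =
      (a.re * b.re + a.im * b.im) * (w - u') * ∫ ω, G ω * G' ω ∂μ := by
    intro w hw
    have := hP.mul_pol a b hu' hw (hGu'.mul hG') (C := |C| * |C'|) (fun ω => by
      rw [Pi.mul_apply, abs_mul]
      exact mul_le_mul ((hC ω).trans (le_abs_self _)) ((hC' ω).trans (le_abs_self _)) (abs_nonneg _) (abs_nonneg _))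
    simp only [Pi.mul_apply] at this
    rw [← this]
    refine integral_congr_ae (Eventually.of_forall fun ω => ?_)
    simp only; ring
  have int : ∀ c d p q p' q', 0 ≤ p → p ≤ q → 0 ≤ p' → p' ≤ q' →
      Integrable (fun ω => (G ω * dB B₁ B₂ c p q ω) * (G' ω * dB B₁ B₂ d p' q' ω)) μ := by
    intro c d p q p' q' h1 h2 h3 h4
    exact (memLp_bdd_mul hGm hC (hP.memLp c h1 h2)).integrable_mul (memLp_bdd_mul hGm' hC' (hP.memLp d h3 h4))
  rcases le_total v u' with h | h
  · rw [early v huv h]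
    have : max 0 (min v v' - u') = 0 := max_eq_left (by linarith [min_le_left v v'])
    rw [this]; ring
  · have e1 : ∀ ω, (G ω * dB B₁ B₂ a u v ω) * (G' ω * dB B₁ B₂ b u' v' ω) =
        (G ω * dB B₁ B₂ a u u' ω) * (G' ω * dB B₁ B₂ b u' v' ω) +
        (G ω * dB B₁ B₂ a u' v ω) * (G' ω * dB B₁ B₂ b u' v' ω) := by
      intro ω; rw [dB_add B₁ B₂ a u u' v]; ring
    simp_rw [e1]
    rw [integral_add (int _ _ _ _ _ _ hu huu hu' huv') (int _ _ _ _ _ _ hu' h hu' huv'), early u' huu le_rfl, zero_add]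
    rcases le_total v v' with h' | h'
    · have e2 : ∀ ω, (G ω * dB B₁ B₂ a u' v ω) * (G' ω * dB B₁ B₂ b u' v' ω) =
        (G ω * dB B₁ B₂ a u' v ω) * (G' ω * dB B₁ B₂ b u' v ω) +
        (G ω * dB B₁ B₂ a u' v ω) * (G' ω * dB B₁ B₂ b v v' ω) := by
        intro ω; rw [dB_add B₁ B₂ b u' v v']; ring
      simp_rw [e2]
      rw [integral_add (int _ _ _ _ _ _ hu' h hu' h) (int _ _ _ _ _ _ hu' h (hu'.trans h) h'), late v v' h h', add_zero, same v h,
        min_eq_left h', max_eq_right (by linarith)]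
    · have e2 : ∀ ω, (G ω * dB B₁ B₂ a u' v ω) * (G' ω * dB B₁ B₂ b u' v' ω) =
        (G ω * dB B₁ B₂ a u' v' ω) * (G' ω * dB B₁ B₂ b u' v' ω) +
        (G ω * dB B₁ B₂ a v' v ω) * (G' ω * dB B₁ B₂ b u' v' ω) := by
        intro ω; rw [dB_add B₁ B₂ a u' v' v]; ring
      simp_rw [e2]
      rw [integral_add (int _ _ _ _ _ _ hu' huv' hu' huv') (int _ _ _ _ _ _ (hu'.trans huv') h' hu' huv'), late' v' v huv' h', add_zero, same v' huv',
        min_eq_right h', max_eq_right (by linarith)]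

lemma PB.inner (hP : PB μ F B₁ B₂) (a b : ℂ) {u v u' v' : ℝ} (hu : 0 ≤ u) (huv : u ≤ v)
    (hu' : 0 ≤ u') (huv' : u' ≤ v')
    {G G' : Ω → ℝ} (hG : Measurable[F u] G) {C : ℝ} (hC : ∀ ω, |G ω| ≤ C)
    (hG' : Measurable[F u'] G') {C' : ℝ} (hC' : ∀ ω, |G' ω| ≤ C') :
    ∫ ω, (G ω * dB B₁ B₂ a u v ω) * (G' ω * dB B₁ B₂ b u' v' ω) ∂μ =
      (a.re * b.re + a.im * b.im) * max 0 (min v v' - max u u') * ∫ ω, G ω * G' ω ∂μ := by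
  rcases le_total u u' with h | h
  · rw [hP.inner_aux a b hu huv h huv' hG hC hG' hC', max_eq_right h]
  · have := hP.inner_aux b a hu' huv' h huv hG' hC' hG hC
    rw [max_eq_left h, min_comm]
    simp_rw [mul_comm (G _) (G' _)]
    rw [show a.re * b.re + a.im * b.im = b.re * a.re + b.im * a.im by ring, ← this]
    refine integral_congr_ae (Eventually.of_forall fun ω => ?_)
    simp only; ring

end incr

section itorel

/-- generators of the Ito relation -/
def itoGen (μ : Measure Ω) [IsProbabilityMeasure μ] (F : ℝ → MeasurableSpace Ω) (B₁ B₂ : ℝ → Ω → ℝ) :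
    Set (Lp ℂ 2 ((volume : Measure ℝ).prod μ) × Lp ℝ 2 μ) :=
  {p | ∃ (u v : ℝ) (a : ℂ) (G : Ω → ℝ) (C : ℝ), 0 ≤ u ∧ u ≤ v ∧ Measurable[F u] G ∧ (∀ ω, |G ω| ≤ C) ∧
    (p.1 =ᵐ[(volume : Measure ℝ).prod μ] fun x => (Ioc u v).indicator (fun _ => (G x.2 : ℂ) * a) x.1) ∧
    (p.2 =ᵐ[μ] fun ω => G ω * dB B₁ B₂ a u v ω)}

def itoSub (μ : Measure Ω) [IsProbabilityMeasure μ] (F : ℝ → MeasurableSpace Ω) (B₁ B₂ : ℝ → Ω → ℝ) :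
    Submodule ℝ (Lp ℂ 2 ((volume : Measure ℝ).prod μ) × Lp ℝ 2 μ) :=
  (Submodule.span ℝ (itoGen μ F B₁ B₂)).topologicalClosure

/-- `I` is the Ito integral of the planar integrand `f`. -/
def Ito (μ : Measure Ω) [IsProbabilityMeasure μ] (F : ℝ → MeasurableSpace Ω) (B₁ B₂ : ℝ → Ω → ℝ)
    (f : ℝ × Ω → ℂ) (I : Ω → ℝ) : Prop :=
  ∃ p ∈ itoSub μ F B₁ B₂, p.1 =ᵐ[(volume : Measure ℝ).prod μ] f ∧ p.2 =ᵐ[μ] I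

variable {μ : Measure Ω} [IsProbabilityMeasure μ] {F : ℝ → MeasurableSpace Ω} {B₁ B₂ : ℝ → Ω → ℝ}

lemma gen_inner (hP : PB μ F B₁ B₂) {p q} (hp : p ∈ itoGen μ F B₁ B₂) (hq : q ∈ itoGen μ F B₁ B₂) :
    inner ℝ p.1 q.1 = inner ℝ p.2 q.2 := by
  obtain ⟨u, v, a, G, C, hu, huv, hG, hC, hp1, hp2⟩ := hp
  obtain ⟨u', v', b, G', C', hu', huv', hG', hC', hq1, hq2⟩ := hq
  have hGm : Measurable G := hG.mono (hP.le _) le_rfl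
  have hGm' : Measurable G' := hG'.mono (hP.le _) le_rfl
  rw [L2.inner_def, L2.inner_def]
  have h2 : ∫ ω, inner ℝ (p.2 ω) (q.2 ω) ∂μ = ∫ ω, (G ω * dB B₁ B₂ a u v ω) * (G' ω * dB B₁ B₂ b u' v' ω) ∂μ := by
    refine integral_congr_ae ?_
    filter_upwards [hp2, hq2] with ω h1 h2
    rw [h1, h2]
    simp only [RCLike.inner_apply, conj_trivial]; ring
  rw [h2, hP.inner a b hu huv hu' huv' hG hC hG' hC']
  have h1 : ∫ x, inner ℝ (p.1 x) (q.1 x) ∂((volume : Measure ℝ).prod μ) =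
      ∫ x : ℝ × Ω, (Ioc u v ∩ Ioc u' v').indicator (fun _ => (1:ℝ)) x.1 * ((a.re * b.re + a.im * b.im) * (G x.2 * G' x.2)) ∂((volume : Measure ℝ).prod μ) := by
    refine integral_congr_ae ?_
    filter_upwards [hp1, hq1] with x h1 h2
    rw [h1, h2]
    by_cases hx : x.1 ∈ Ioc u v
    · by_cases hx' : x.1 ∈ Ioc u' v'
      · have : x.1 ∈ Ioc u v ∩ Ioc u' v' := ⟨hx, hx'⟩
        rw [indicator_of_mem hx, indicator_of_mem hx', indicator_of_mem this]
        rw [Complex.inner]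
        simp; ring
      · have : x.1 ∉ Ioc u v ∩ Ioc u' v' := fun h => hx' h.2
        rw [indicator_of_notMem hx', indicator_of_notMem this]; simp
    · have : x.1 ∉ Ioc u v ∩ Ioc u' v' := fun h => hx h.1
      rw [indicator_of_notMem hx, indicator_of_notMem this]; simp
  rw [h1, integral_prod_mul (μ := (volume : Measure ℝ)) (ν := μ) (fun x => (Ioc u v ∩ Ioc u' v').indicator (fun _ => (1:ℝ)) x) (fun ω => (a.re * b.re + a.im * b.im) * (G ω * G' ω)),
    integral_const_mul, Ioc_inter_Ioc, integral_indicator measurableSet_Ioc]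
  have : ∫ _ in Ioc (max u u') (min v v'), (1:ℝ) = max 0 (min v v' - max u u') := by
    simp only [integral_const, smul_eq_mul, mul_one, Measure.real, Measure.restrict_apply MeasurableSet.univ, univ_inter, Real.volume_Ioc]
    rw [ENNReal.toReal_ofReal']; exact max_comm _ _
  rw [show max u u' = u ⊔ u' from rfl, show min v v' = v ⊓ v' from rfl] at *
  rw [this]; ring

lemma itoSub_isom (hP : PB μ F B₁ B₂) {p} (hp : p ∈ itoSub μ F B₁ B₂) : ‖p.1‖ = ‖p.2‖ := by
  have h1 : ∀ p ∈ Submodule.span ℝ (itoGen μ F B₁ B₂), ∀ q ∈ Submodule.span ℝ (itoGen μ F B₁ B₂),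
      inner ℝ p.1 q.1 = inner ℝ p.2 q.2 := by
    intro p hp q hq
    induction hp, hq using Submodule.span_induction₂ with
    | mem_mem x y hx hy => exact gen_inner hP hx hy
    | zero_left y hy => simp
    | zero_right x hx => simp
    | add_left x y z hx hy hz h1 h2 => simp only [Prod.fst_add, Prod.snd_add, inner_add_left, h1, h2]
    | add_right x y z hx hy hz h1 h2 => simp only [Prod.fst_add, Prod.snd_add, inner_add_right, h1, h2]
    | smul_left r x y hx hy h => simp only [Prod.smul_fst, Prod.smul_snd, real_inner_smul_left, h]
    | smul_right r x y hx hy h => simp only [Prod.smul_fst, Prod.smul_snd, real_inner_smul_right, h]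
  have hcl : IsClosed {p : Lp ℂ 2 ((volume : Measure ℝ).prod μ) × Lp ℝ 2 μ | ‖p.1‖ = ‖p.2‖} :=
    isClosed_eq (continuous_fst.norm) (continuous_snd.norm)
  refine closure_minimal ?_ hcl hp
  intro q hq
  have := h1 q hq q hq
  rw [real_inner_self_eq_norm_sq, real_inner_self_eq_norm_sq] at this
  exact (sq_eq_sq₀ (norm_nonneg _) (norm_nonneg _)).1 this

namespace Ito

lemma congr {f f' I I'} (h : Ito μ F B₁ B₂ f I) (hf : f =ᵐ[(volume : Measure ℝ).prod μ] f') (hI : I =ᵐ[μ] I') :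
    Ito μ F B₁ B₂ f' I' := by
  obtain ⟨p, hp, h1, h2⟩ := h
  exact ⟨p, hp, h1.trans hf, h2.trans hI⟩

lemma memLp {f I} (h : Ito μ F B₁ B₂ f I) : MemLp f 2 ((volume : Measure ℝ).prod μ) ∧ MemLp I 2 μ := by
  obtain ⟨p, hp, h1, h2⟩ := h
  exact ⟨(memLp_congr_ae h1).1 (Lp.memLp p.1), (memLp_congr_ae h2).1 (Lp.memLp p.2)⟩

lemma add {f f' I I'} (h : Ito μ F B₁ B₂ f I) (h' : Ito μ F B₁ B₂ f' I') :
    Ito μ F B₁ B₂ (fun x => f x + f' x) (fun ω => I ω + I' ω) := by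
  obtain ⟨p, hp, h1, h2⟩ := h
  obtain ⟨p', hp', h1', h2'⟩ := h'
  refine ⟨p + p', Submodule.add_mem _ hp hp', ?_, ?_⟩
  · exact (Lp.coeFn_add p.1 p'.1).trans (h1.add h1')
  · exact (Lp.coeFn_add p.2 p'.2).trans (h2.add h2')

lemma sub {f f' I I'} (h : Ito μ F B₁ B₂ f I) (h' : Ito μ F B₁ B₂ f' I') :
    Ito μ F B₁ B₂ (fun x => f x - f' x) (fun ω => I ω - I' ω) := by
  obtain ⟨p, hp, h1, h2⟩ := h
  obtain ⟨p', hp', h1', h2'⟩ := h'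
  refine ⟨p - p', Submodule.sub_mem _ hp hp', ?_, ?_⟩
  · exact (Lp.coeFn_sub p.1 p'.1).trans (h1.sub h1')
  · exact (Lp.coeFn_sub p.2 p'.2).trans (h2.sub h2')

lemma smul (c : ℝ) {f I} (h : Ito μ F B₁ B₂ f I) :
    Ito μ F B₁ B₂ (fun x => (c : ℂ) * f x) (fun ω => c * I ω) := by
  obtain ⟨p, hp, h1, h2⟩ := h
  refine ⟨c • p, Submodule.smul_mem _ c hp, ?_, ?_⟩
  · refine (Lp.coeFn_smul c p.1).trans ?_
    filter_upwards [h1] with x hx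
    simp [hx]
  · refine (Lp.coeFn_smul c p.2).trans ?_
    filter_upwards [h2] with x hx
    simp [hx]

lemma zero : Ito μ F B₁ B₂ (fun _ => 0) (fun _ => 0) :=
  ⟨0, Submodule.zero_mem _, Lp.coeFn_zero _ _ _, Lp.coeFn_zero _ _ _⟩

lemma sum {ι : Type*} (s : Finset ι) {f : ι → ℝ × Ω → ℂ} {I : ι → Ω → ℝ} (h : ∀ i ∈ s, Ito μ F B₁ B₂ (f i) (I i)) :
    Ito μ F B₁ B₂ (fun x => ∑ i ∈ s, f i x) (fun ω => ∑ i ∈ s, I i ω) := by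
  classical
  induction s using Finset.induction_on with
  | empty => simpa using zero
  | insert i s hi ih =>
    simp only [Finset.sum_insert hi]
    exact (h i (Finset.mem_insert_self _ _)).add (ih fun j hj => h j (Finset.mem_insert_of_mem hj))

lemma isom (hP : PB μ F B₁ B₂) {f I} (h : Ito μ F B₁ B₂ f I) : eLpNorm f 2 ((volume : Measure ℝ).prod μ) = eLpNorm I 2 μ := by
  obtain ⟨p, hp, h1, h2⟩ := h
  have := itoSub_isom hP hp
  rw [← eLpNorm_congr_ae h1, ← eLpNorm_congr_ae h2, ← Lp.enorm_def, ← Lp.enorm_def]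
  rw [← ofReal_norm_eq_enorm, ← ofReal_norm_eq_enorm, this]

lemma unique (hP : PB μ F B₁ B₂) {f I I'} (h : Ito μ F B₁ B₂ f I) (h' : Ito μ F B₁ B₂ f I') : I =ᵐ[μ] I' := by
  have h1 := (h.sub h')
  have h2 := h1.isom hP
  simp only [sub_self] at h2
  have h3 : eLpNorm (fun x : ℝ × Ω => (0:ℂ)) 2 ((volume : Measure ℝ).prod μ) = 0 := eLpNorm_zero
  rw [h3] at h2
  have h4 := (eLpNorm_eq_zero_iff h1.memLp.2.aestronglyMeasurable (by simp)).1 h2.symm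
  filter_upwards [h4] with ω hω
  exact sub_eq_zero.1 hω

lemma tendsto (hP : PB μ F B₁ B₂) {f : ℕ → ℝ × Ω → ℂ} {I : ℕ → Ω → ℝ} {f' I'} (h : ∀ n, Ito μ F B₁ B₂ (f n) (I n)) (h' : Ito μ F B₁ B₂ f' I')
    (hlim : Tendsto (fun n => eLpNorm (fun x => f n x - f' x) 2 ((volume : Measure ℝ).prod μ)) atTop (nhds 0)) :
    TendstoInMeasure μ I atTop I' := by
  refine tendstoInMeasure_of_tendsto_eLpNorm (p := 2) (by simp) (fun n => (h n).memLp.2.aestronglyMeasurable) h'.memLp.2.aestronglyMeasurable ?_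
  refine hlim.congr fun n => ?_
  exact ((h n).sub h').isom hP

lemma closure (hP : PB μ F B₁ B₂) {f : ℕ → ℝ × Ω → ℂ} {I : ℕ → Ω → ℝ} {f' I'} (h : ∀ n, Ito μ F B₁ B₂ (f n) (I n))
    (hf' : MemLp f' 2 ((volume : Measure ℝ).prod μ))
    (hlim : Tendsto (fun n => eLpNorm (fun x => f n x - f' x) 2 ((volume : Measure ℝ).prod μ)) atTop (nhds 0))
    (hI : TendstoInMeasure μ I atTop I') :
    Ito μ F B₁ B₂ f' I' := by
  choose p hp hp1 hp2 using h
  have e1 : Tendsto (fun n => (p n).1) atTop (nhds (hf'.toLp f')) := by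
    rw [tendsto_iff_edist_tendsto_0]
    refine hlim.congr fun n => ?_
    rw [Lp.edist_def]
    refine eLpNorm_congr_ae ?_
    filter_upwards [hp1 n, hf'.coeFn_toLp] with x h1 h2
    simp only [Pi.sub_apply, h1, h2]
  have e2 : CauchySeq (fun n => (p n).2) := by
    have hc := e1.cauchySeq
    rw [Metric.cauchySeq_iff] at hc ⊢
    intro ε hε
    obtain ⟨N, hN⟩ := hc ε hε
    refine ⟨N, fun i hi j hj => ?_⟩
    have := itoSub_isom hP (Submodule.sub_mem _ (hp i) (hp j))
    rw [dist_eq_norm]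
    rw [Prod.fst_sub, Prod.snd_sub] at this
    rw [← this, ← dist_eq_norm]
    exact hN i hi j hj
  obtain ⟨J, hJ⟩ := cauchySeq_tendsto_of_complete e2
  have e3 : Tendsto p atTop (nhds (hf'.toLp f', J)) := e1.prodMk_nhds hJ
  have e4 : (hf'.toLp f', J) ∈ itoSub μ F B₁ B₂ :=
    (Submodule.isClosed_topologicalClosure _).mem_of_tendsto e3 (Eventually.of_forall hp)
  refine ⟨_, e4, hf'.coeFn_toLp, ?_⟩
  have e5 : TendstoInMeasure μ (fun n => ((p n).2 : Ω → ℝ)) atTop J := tendstoInMeasure_of_tendsto_Lp hJ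
  have e6 : TendstoInMeasure μ I atTop J := e5.congr_left hp2
  exact tendstoInMeasure_ae_unique e6 hI

end Ito

lemma memLp_prod_bdd {f : ℝ × Ω → ℂ} (hf : Measurable f) {C : ℝ} {u v : ℝ}
    (hC : ∀ x, ‖f x‖ ≤ C) (hs : ∀ x, x.1 ∉ Ioc u v → f x = 0) : MemLp f 2 ((volume : Measure ℝ).prod μ) := by
  have hfin : ((volume : Measure ℝ).prod μ) (Ioc u v ×ˢ univ) ≠ ⊤ := by
    rw [Measure.prod_prod]; simp
  have h1 : MemLp ((Ioc u v ×ˢ (univ : Set Ω)).indicator (fun _ => (C : ℝ))) 2 ((volume : Measure ℝ).prod μ) :=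
    memLp_indicator_const 2 (measurableSet_Ioc.prod MeasurableSet.univ) C (Or.inr hfin)
  refine h1.mono hf.aestronglyMeasurable (Eventually.of_forall fun x => ?_)
  by_cases hx : x.1 ∈ Ioc u v
  · have : x ∈ Ioc u v ×ˢ (univ : Set Ω) := ⟨hx, trivial⟩
    rw [indicator_of_mem this]
    exact (hC x).trans (le_abs_self _)
  · rw [hs x hx]; simp

lemma Ito.gen (hP : PB μ F B₁ B₂) {u v : ℝ} (hu : 0 ≤ u) (huv : u ≤ v) (a : ℂ) {G : Ω → ℝ} (hG : Measurable[F u] G) {C : ℝ} (hC : ∀ ω, |G ω| ≤ C) :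
    Ito μ F B₁ B₂ (fun x => (Ioc u v).indicator (fun _ => (G x.2 : ℂ) * a) x.1) (fun ω => G ω * dB B₁ B₂ a u v ω) := by
  have hGm : Measurable G := hG.mono (hP.le _) le_rfl
  have hm : Measurable (fun x : ℝ × Ω => (Ioc u v).indicator (fun _ => (G x.2 : ℂ) * a) x.1) := by
    have : (fun x : ℝ × Ω => (Ioc u v).indicator (fun _ => (G x.2 : ℂ) * a) x.1) =
      (Prod.fst ⁻¹' (Ioc u v)).indicator (fun x : ℝ × Ω => (G x.2 : ℂ) * a) := by
      ext x; simp [indicator]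
    rw [this]
    exact (by fun_prop : Measurable fun x : ℝ × Ω => (G x.2 : ℂ) * a).indicator (measurable_fst measurableSet_Ioc)
  have h1 : MemLp (fun x : ℝ × Ω => (Ioc u v).indicator (fun _ => (G x.2 : ℂ) * a) x.1) 2 ((volume : Measure ℝ).prod μ) := by
    refine memLp_prod_bdd (u := u) (v := v) (C := |C| * ‖a‖) hm (fun x => ?_) (fun x hx => indicator_of_notMem hx _)
    by_cases hx : x.1 ∈ Ioc u v
    · rw [indicator_of_mem hx, norm_mul, Complex.norm_real]
      have := (hC x.2).trans (le_abs_self C)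
      exact mul_le_mul_of_nonneg_right this (norm_nonneg _)
    · rw [indicator_of_notMem hx]; simp; positivity
  have h2 : MemLp (fun ω => G ω * dB B₁ B₂ a u v ω) 2 μ := memLp_bdd_mul hGm hC (hP.memLp a hu huv)
  refine ⟨(h1.toLp _, h2.toLp _), Submodule.le_topologicalClosure _ (Submodule.subset_span ?_), h1.coeFn_toLp, h2.coeFn_toLp⟩
  exact ⟨u, v, a, G, C, hu, huv, hG, hC, h1.coeFn_toLp, h2.coeFn_toLp⟩

/-- bounded convergence in L² of the product space -/
lemma l2_of_ae {f : ℕ → ℝ × Ω → ℂ} {f' : ℝ × Ω → ℂ} (hf : ∀ n, Measurable (f n)) (hf' : Measurable f') {C : ℝ} {u v : ℝ}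
    (hC : ∀ n x, ‖f n x‖ ≤ C) (hC' : ∀ x, ‖f' x‖ ≤ C) (hs : ∀ n x, x.1 ∉ Ioc u v → f n x = 0) (hs' : ∀ x, x.1 ∉ Ioc u v → f' x = 0)
    (hlim : ∀ᵐ x ∂((volume : Measure ℝ).prod μ), Tendsto (fun n => f n x) atTop (nhds (f' x))) :
    Tendsto (fun n => eLpNorm (fun x => f n x - f' x) 2 ((volume : Measure ℝ).prod μ)) atTop (nhds 0) := by
  have hfin : ((volume : Measure ℝ).prod μ) (Ioc u v ×ˢ univ) ≠ ⊤ := by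
    rw [Measure.prod_prod]; simp
  have hbound : ∀ n, ∀ x, ‖f n x - f' x‖ₑ ^ (2:ℝ) ≤ (Ioc u v ×ˢ (univ : Set Ω)).indicator (fun _ => ENNReal.ofReal (2 * C) ^ (2:ℝ)) x := by
    intro n x
    by_cases hx : x.1 ∈ Ioc u v
    · have : x ∈ Ioc u v ×ˢ (univ : Set Ω) := ⟨hx, trivial⟩
      rw [indicator_of_mem this]
      refine ENNReal.rpow_le_rpow ?_ (by norm_num)
      rw [← ofReal_norm_eq_enorm]
      refine ENNReal.ofReal_le_ofReal ((norm_sub_le _ _).trans ?_)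
      linarith [hC n x, hC' x]
    · rw [hs n x hx, hs' x hx]; simp
  have h0 : Tendsto (fun n => ∫⁻ x, ‖f n x - f' x‖ₑ ^ (2:ℝ) ∂((volume : Measure ℝ).prod μ)) atTop (nhds (∫⁻ x : ℝ × Ω, 0 ∂((volume : Measure ℝ).prod μ))) := by
    refine tendsto_lintegral_of_dominated_convergence ((Ioc u v ×ˢ (univ : Set Ω)).indicator (fun _ => ENNReal.ofReal (2 * C) ^ (2:ℝ))) ?_ ?_ ?_ ?_
    · intro n
      exact (((hf n).sub hf').enorm).pow_const _
    · intro n; exact Eventually.of_forall (hbound n)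
    · rw [lintegral_indicator_const (measurableSet_Ioc.prod MeasurableSet.univ)]
      exact ENNReal.mul_ne_top (ENNReal.rpow_ne_top_of_nonneg (by norm_num) ENNReal.ofReal_ne_top) hfin
    · filter_upwards [hlim] with x hx
      have h1 : Tendsto (fun n => f n x - f' x) atTop (nhds 0) := by
        have := hx.sub_const (f' x); rwa [sub_self] at this
      have h2 : Tendsto (fun n => ‖f n x - f' x‖ₑ) atTop (nhds 0) := by
        have := (continuous_enorm.tendsto (0:ℂ)).comp h1
        simpa [Function.comp_def] using this
      have h3 := (ENNReal.continuous_rpow_const (y := 2)).tendsto 0 |>.comp h2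
      simpa [Function.comp_def] using h3
  rw [lintegral_zero] at h0
  have h4 := (ENNReal.continuous_rpow_const (y := (1/2 : ℝ))).tendsto 0 |>.comp h0
  have h5 : ((0:ENNReal)) ^ (1/2 : ℝ) = 0 := by simp
  rw [h5] at h4
  refine h4.congr fun n => ?_
  rw [eLpNorm_eq_lintegral_rpow_enorm_toReal (by simp) (by simp)]
  simp

end itorel


section twoval

def gr (u v : ℝ) (n : ℕ) (i : ℕ) : ℝ := u + (v - u) * i / 2 ^ n

lemma gr_zero (u v : ℝ) (n : ℕ) : gr u v n 0 = u := by simp [gr]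
lemma gr_last (u v : ℝ) (n : ℕ) : gr u v n (2 ^ n) = v := by
  simp [gr]
lemma gr_step (u v : ℝ) (n i : ℕ) : gr u v n (i + 1) - gr u v n i = (v - u) / 2 ^ n := by
  simp only [gr]; push_cast; ring
lemma gr_succ (u v : ℝ) (n i : ℕ) : gr u v n (i + 1) = gr u v n i + (v - u) / 2 ^ n := by
  simp only [gr]; push_cast; ring
lemma gr_mono {u v : ℝ} (huv : u ≤ v) (n : ℕ) : Monotone (gr u v n) := by
  intro i j hij
  have : (i : ℝ) ≤ j := by exact_mod_cast hij
  have h0 : 0 ≤ v - u := by linarith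
  simp only [gr]
  gcongr
lemma gr_ge {u v : ℝ} (huv : u ≤ v) (n i : ℕ) : u ≤ gr u v n i := by
  have := gr_mono huv n (Nat.zero_le i); rwa [gr_zero] at this
lemma gr_le {u v : ℝ} (huv : u ≤ v) (n i : ℕ) (hi : i ≤ 2 ^ n) : gr u v n i ≤ v := by
  have := gr_mono huv n hi; rwa [gr_last] at this
lemma gr_0 (t : ℝ) (n i : ℕ) : gr 0 t n i = t * i / 2 ^ n := by simp [gr]

variable {μ : Measure Ω} [IsProbabilityMeasure μ] {F : ℝ → MeasurableSpace Ω} {B₁ B₂ : ℝ → Ω → ℝ}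

lemma dB_meas_var (hP : PB μ F B₁ B₂) {s t r : ℝ} (hs : 0 ≤ s) (hst : s ≤ t) (htr : t ≤ r) {c : Ω → ℂ} (hc : Measurable[F s] c) :
    Measurable[F r] (fun ω => dB B₁ B₂ (c ω) s t ω) := by
  have hc' : Measurable[F r] c := hc.mono (hP.mono (hst.trans htr)) le_rfl
  have h1 := hP.measF 1 hs hst htr
  have h2 := hP.measF Complex.I hs hst htr
  have e : (fun ω => dB B₁ B₂ (c ω) s t ω) = fun ω => (c ω).re * dB B₁ B₂ 1 s t ω + (c ω).im * dB B₁ B₂ Complex.I s t ω := by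
    funext ω; simp [dB]
  rw [e]
  exact ((Complex.measurable_re.comp hc').mul h1).add ((Complex.measurable_im.comp hc').mul h2)

lemma two_step (hP : PB μ F B₁ B₂) {s t : ℝ} (hs : 0 ≤ s) (hst : s ≤ t) {c : Ω → ℂ} (hc : Measurable[F s] c) {α β : ℂ}
    (hv : ∀ ω, c ω = α ∨ c ω = β) {r : ℝ} (hα : Complex.normSq α = r) (hβ : Complex.normSq β = r)
    {Z : Ω → ℂ} (hZ : Measurable[F s] Z) {C : ℝ} (hZC : ∀ ω, ‖Z ω‖ ≤ C) :
    ∫ ω, Z ω * Complex.exp (Complex.I * (dB B₁ B₂ (c ω) s t ω : ℝ)) ∂μ =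
      Complex.exp ((-(r * (t - s) / 2) : ℝ) : ℂ) * ∫ ω, Z ω ∂μ := by
  classical
  have hA : MeasurableSet[F s] {ω | c ω = α} := hc (measurableSet_singleton α)
  have hZ1 : Measurable[F s] (({ω | c ω = α}).indicator Z) := hZ.indicator hA
  have hZ2 : Measurable[F s] (({ω | c ω = α}ᶜ).indicator Z) := hZ.indicator hA.compl
  have b1 : ∀ ω, ‖({ω | c ω = α}).indicator Z ω‖ ≤ C := fun ω => (norm_indicator_le_norm_self Z ω).trans (hZC ω)
  have b2 : ∀ ω, ‖({ω | c ω = α}ᶜ).indicator Z ω‖ ≤ C := fun ω => (norm_indicator_le_norm_self Z ω).trans (hZC ω)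
  have e1 := hP.cf s t hs hst α.re α.im _ hZ1 C b1
  have e2 := hP.cf s t hs hst β.re β.im _ hZ2 C b2
  have r1 : α.re ^ 2 + α.im ^ 2 = r := by rw [← hα, Complex.normSq_apply]; ring
  have r2 : β.re ^ 2 + β.im ^ 2 = r := by rw [← hβ, Complex.normSq_apply]; ring
  rw [r1] at e1; rw [r2] at e2
  have hle := hP.le s
  have key : ∀ (a : ℂ) (Z' : Ω → ℂ), Measurable[F s] Z' → (∀ ω, ‖Z' ω‖ ≤ C) →
      Integrable (fun ω => Z' ω * Complex.exp (Complex.I * ((a.re * (B₁ t ω - B₁ s ω) + a.im * (B₂ t ω - B₂ s ω) : ℝ) : ℂ))) μ := by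
    intro a Z' hZ' hb
    have hm : Measurable (dB B₁ B₂ a s t) := hP.meas a hs hst
    refine integrable_of_bdd ?_ C ?_
    · exact (hZ'.mono hle le_rfl).mul (Complex.measurable_exp.comp ((Complex.measurable_ofReal.comp hm).const_mul _))
    · intro ω
      rw [norm_mul, mul_comm Complex.I, Complex.norm_exp_ofReal_mul_I, mul_one]; exact hb ω
  have i1 : Integrable (({ω | c ω = α}).indicator Z) μ := integrable_of_bdd (hZ1.mono hle le_rfl) C b1
  have i2 : Integrable (({ω | c ω = α}ᶜ).indicator Z) μ := integrable_of_bdd (hZ2.mono hle le_rfl) C b2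
  have split : ∫ ω, Z ω ∂μ = ∫ ω, ({ω | c ω = α}).indicator Z ω ∂μ + ∫ ω, ({ω | c ω = α}ᶜ).indicator Z ω ∂μ := by
    rw [← integral_add i1 i2]
    congr 1; funext ω; exact (congrFun (Set.indicator_self_add_compl _ Z) ω).symm
  rw [split, mul_add, ← e1, ← e2, ← integral_add (key α _ hZ1 b1) (key β _ hZ2 b2)]
  congr 1; funext ω
  by_cases h : c ω = α
  · have h1 : ω ∈ {ω | c ω = α} := h
    have h2 : ω ∉ {ω | c ω = α}ᶜ := fun hh => hh h
    rw [indicator_of_mem h1, indicator_of_notMem h2, h]; simp [dB]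
  · have h1 : ω ∉ {ω | c ω = α} := h
    have h2 : ω ∈ {ω | c ω = α}ᶜ := h
    rw [indicator_of_notMem h1, indicator_of_mem h2, (hv ω).resolve_left h]; simp [dB]

lemma gsum_meas (hP : PB μ F B₁ B₂) {τ : ℕ → ℝ} (hτ : Monotone τ) (h0 : 0 ≤ τ 0) {c : ℕ → Ω → ℂ} (k0 k1 : ℕ)
    (hc : ∀ i, k0 ≤ i → i < k1 → Measurable[F (τ i)] (c i)) :
    Measurable[F (τ k1)] (fun ω => ∑ i ∈ Finset.Ico k0 k1, dB B₁ B₂ (c i ω) (τ i) (τ (i + 1)) ω) := by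
  refine Finset.measurable_sum _ fun i hi => ?_
  rw [Finset.mem_Ico] at hi
  exact dB_meas_var hP (h0.trans (hτ (Nat.zero_le _))) (hτ (Nat.le_succ i)) (hτ (by omega)) (hc i hi.1 hi.2)

lemma two_valued (hP : PB μ F B₁ B₂) {τ : ℕ → ℝ} (hτ : Monotone τ) (h0 : 0 ≤ τ 0) {c : ℕ → Ω → ℂ} (k0 k1 : ℕ) (hk : k0 ≤ k1)
    (hc : ∀ i, k0 ≤ i → i < k1 → Measurable[F (τ i)] (c i)) {α β : ℕ → ℂ} (hv : ∀ i ω, c i ω = α i ∨ c i ω = β i)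
    {r : ℕ → ℝ} (hα : ∀ i, Complex.normSq (α i) = r i) (hβ : ∀ i, Complex.normSq (β i) = r i)
    {Z : Ω → ℂ} (hZ : Measurable[F (τ k0)] Z) {C : ℝ} (hZC : ∀ ω, ‖Z ω‖ ≤ C) :
    ∫ ω, Z ω * Complex.exp (Complex.I * ((∑ i ∈ Finset.Ico k0 k1, dB B₁ B₂ (c i ω) (τ i) (τ (i + 1)) ω : ℝ) : ℂ)) ∂μ =
      Complex.exp ((-(∑ i ∈ Finset.Ico k0 k1, r i * (τ (i + 1) - τ i) / 2) : ℝ) : ℂ) * ∫ ω, Z ω ∂μ := by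
  induction k1, hk using Nat.le_induction with
  | base => simp
  | succ k hk ih =>
    have ih := ih (fun i h1 h2 => hc i h1 (by omega))
    have hs : 0 ≤ τ k := h0.trans (hτ (Nat.zero_le _))
    set Z' : Ω → ℂ := fun ω => Z ω * Complex.exp (Complex.I * ((∑ i ∈ Finset.Ico k0 k, dB B₁ B₂ (c i ω) (τ i) (τ (i + 1)) ω : ℝ) : ℂ)) with hZ'
    have hm : Measurable[F (τ k)] Z' :=
      (hZ.mono (hP.mono (hτ hk)) le_rfl).mul (Complex.measurable_exp.comp ((Complex.measurable_ofReal.comp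
        (gsum_meas hP hτ h0 k0 k (fun i h1 h2 => hc i h1 (by omega)))).const_mul _))
    have hb : ∀ ω, ‖Z' ω‖ ≤ C := by
      intro ω
      rw [hZ', norm_mul, mul_comm Complex.I, Complex.norm_exp_ofReal_mul_I, mul_one]; exact hZC ω
    have st := two_step hP hs (hτ (Nat.le_succ k)) (hc k hk (Nat.lt_succ_self k)) (hv k) (hα k) (hβ k) hm hb
    rw [ih, ← mul_assoc, ← Complex.exp_add] at st
    rw [Finset.sum_Ico_succ_top hk]
    have : (∫ ω, Z ω * Complex.exp (Complex.I * ((∑ i ∈ Finset.Ico k0 (k + 1), dB B₁ B₂ (c i ω) (τ i) (τ (i + 1)) ω : ℝ) : ℂ)) ∂μ) =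
        ∫ ω, Z' ω * Complex.exp (Complex.I * (dB B₁ B₂ (c k ω) (τ k) (τ (k + 1)) ω : ℝ)) ∂μ := by
      congr 1; funext ω
      rw [Finset.sum_Ico_succ_top hk, hZ', mul_assoc, ← Complex.exp_add]
      push_cast
      rw [mul_add]
    rw [this, st]
    congr 2
    push_cast; ring

end twoval


section core

def KK (p q : ℂ) (y : ℝ) : ℂ := if 0 < y then p else q

lemma KK_or (p q : ℂ) (y : ℝ) : KK p q y = p ∨ KK p q y = q := by
  unfold KK; split_ifs <;> simp

lemma KK_meas (p q : ℂ) : Measurable (KK p q) :=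
  Measurable.ite measurableSet_Ioi measurable_const measurable_const

lemma psgn_meas : Measurable psgn := Measurable.ite measurableSet_Ioi measurable_const measurable_const

lemma psgn_abs (y : ℝ) : |psgn y| = 1 := by unfold psgn; split_ifs <;> simp

/-- sum of sign-field against increments on grid -/
def ksum (B₁ B₂ Y : ℝ → Ω → ℝ) (p q : ℂ) (u v : ℝ) (n : ℕ) (ω : Ω) : ℝ :=
  ∑ i ∈ Finset.range (2 ^ n), dB B₁ B₂ (KK p q (Y (gr u v n i) ω)) (gr u v n i) (gr u v n (i + 1)) ω

def SI (μ : Measure Ω) (B₁ B₂ Y : ℝ → Ω → ℝ) (p q : ℂ) (I : ℝ → Ω → ℝ) : Prop :=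
  ∀ t : ℝ, 0 ≤ t → TendstoInMeasure μ (fun n => ksum B₁ B₂ Y p q 0 t n) atTop (I t)

def AA (Y : ℝ → Ω → ℝ) (t : ℝ) (ω : Ω) : ℝ := ∫ s in (0:ℝ)..t, psgn (Y s ω)

/-- the driving noise of `Y` -/
def WW (Y : ℝ → Ω → ℝ) (lam y : ℝ) (t : ℝ) (ω : Ω) : ℝ := Y t ω - y + lam * AA Y t ω

structure Core (μ : Measure Ω) (F : ℝ → MeasurableSpace Ω) (B₁ B₂ Y : ℝ → Ω → ℝ) (ρ σ lam y : ℝ) : Prop where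
  pb : PB μ F B₁ B₂
  null : NullC μ (F 0)
  meas : ∀ t, 0 ≤ t → Measurable[F t] (Y t)
  measm : ∀ t, Measurable (Y t)
  cont : ∀ ω, Continuous fun t => Y t ω
  lam_pos : 0 < lam
  norm : ρ ^ 2 + σ ^ 2 = 1
  hρ : 0 < ρ
  hσ : 0 < σ
  W : SI μ B₁ B₂ Y (ρ - σ * Complex.I) (σ - ρ * Complex.I) (WW Y lam y)

lemma psgn_intervalIntegrable {f : ℝ → ℝ} (hf : Continuous f) (a b : ℝ) : IntervalIntegrable (fun s => psgn (f s)) volume a b := by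
  have : Measurable fun s => psgn (f s) := psgn_meas.comp hf.measurable
  refine (intervalIntegrable_const (c := (1:ℝ))).mono_fun' this.aestronglyMeasurable ?_
  exact Eventually.of_forall fun s => by simp [Real.norm_eq_abs, psgn_abs]

lemma AA_sub {Y : ℝ → Ω → ℝ} (hY : ∀ ω, Continuous fun t => Y t ω) (s t : ℝ) (ω : Ω) :
    AA Y t ω - AA Y s ω = ∫ r in s..t, psgn (Y r ω) := by
  unfold AA
  rw [intervalIntegral.integral_interval_sub_left (psgn_intervalIntegrable (hY ω) _ _) (psgn_intervalIntegrable (hY ω) _ _)]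

lemma AA_lip {Y : ℝ → Ω → ℝ} (hY : ∀ ω, Continuous fun t => Y t ω) (s t : ℝ) (ω : Ω) :
    |AA Y t ω - AA Y s ω| ≤ |t - s| := by
  rw [AA_sub hY]
  have := intervalIntegral.norm_integral_le_of_norm_le_const (a := s) (b := t) (C := 1) (f := fun r => psgn (Y r ω))
    (fun x _ => by simp [Real.norm_eq_abs, psgn_abs])
  simpa [Real.norm_eq_abs] using this

lemma AA_cont {Y : ℝ → Ω → ℝ} (hY : ∀ ω, Continuous fun t => Y t ω) (ω : Ω) : Continuous fun t => AA Y t ω := by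
  have : LipschitzWith 1 (fun t => AA Y t ω) := by
    refine LipschitzWith.of_dist_le_mul fun a b => ?_
    rw [Real.dist_eq, Real.dist_eq]; simpa using AA_lip hY b a ω
  exact this.continuous

lemma AA_meas {Ω : Type*} {𝒢 : MeasurableSpace Ω} {Y : ℝ → Ω → ℝ} (hY : ∀ ω, Continuous fun t => Y t ω) {t : ℝ} (ht : 0 ≤ t)
    (hm : ∀ s ∈ Icc (0:ℝ) t, Measurable[𝒢] (Y s)) : Measurable[𝒢] (AA Y t) := by
  have h1 : Measurable (Function.uncurry fun (s : ℝ) (ω : Ω) => Y (max 0 (min s t)) ω) := by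
    refine measurable_uncurry_of_continuous_of_measurable (u := fun (s : ℝ) (ω : Ω) => Y (max 0 (min s t)) ω) ?_ ?_
    · intro ω; exact (hY ω).comp (by fun_prop)
    · intro s; exact hm _ ⟨le_max_left _ _, max_le ht (min_le_right _ _)⟩
  have h2 : Measurable (Function.uncurry fun (ω : Ω) (s : ℝ) => psgn (Y (max 0 (min s t)) ω)) :=
    psgn_meas.comp (h1.comp measurable_swap)
  have h3 : StronglyMeasurable fun ω => ∫ s in Ioc 0 t, psgn (Y (max 0 (min s t)) ω) :=
    (h2.stronglyMeasurable).integral_prod_right' (ν := volume.restrict (Ioc (0:ℝ) t))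
  have : AA Y t = fun ω => ∫ s in Ioc 0 t, psgn (Y (max 0 (min s t)) ω) := by
    funext ω
    unfold AA
    rw [intervalIntegral.integral_of_le ht]
    refine setIntegral_congr_fun measurableSet_Ioc fun s hs => ?_
    have : max 0 (min s t) = s := by rw [min_eq_left hs.2, max_eq_right hs.1.le]
    simp only [this]
  rw [this]
  exact h3.measurable

variable {μ : Measure Ω} [IsProbabilityMeasure μ] {F : ℝ → MeasurableSpace Ω} {B₁ B₂ Y : ℝ → Ω → ℝ} {ρ σ lam y : ℝ}

lemma Core.nullC (H : Core μ F B₁ B₂ Y ρ σ lam y) {t : ℝ} (ht : 0 ≤ t) : NullC μ (F t) := H.null.mono (H.pb.mono ht)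

lemma Core.Km (H : Core μ F B₁ B₂ Y ρ σ lam y) (p q : ℂ) {t : ℝ} (ht : 0 ≤ t) : Measurable[F t] fun ω => KK p q (Y t ω) :=
  (KK_meas p q).comp (H.meas t ht)

lemma Core.AAm (H : Core μ F B₁ B₂ Y ρ σ lam y) {t : ℝ} (ht : 0 ≤ t) : Measurable[F t] (AA Y t) :=
  AA_meas H.cont ht fun s hs => (H.meas s hs.1).mono (H.pb.mono hs.2) le_rfl

lemma Core.WWm (H : Core μ F B₁ B₂ Y ρ σ lam y) {t : ℝ} (ht : 0 ≤ t) : Measurable[F t] (WW Y lam y t) :=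
  ((H.meas t ht).sub_const y).add ((H.AAm ht).const_mul lam)

lemma Core.WW_cont (H : Core μ F B₁ B₂ Y ρ σ lam y) (ω : Ω) : Continuous fun t => WW Y lam y t ω :=
  ((H.cont ω).sub continuous_const).add ((AA_cont H.cont ω).const_mul lam)

lemma Core.ksum_meas (H : Core μ F B₁ B₂ Y ρ σ lam y) (p q : ℂ) {u v : ℝ} (hu : 0 ≤ u) (huv : u ≤ v) (n : ℕ) :
    Measurable[F v] (ksum B₁ B₂ Y p q u v n) := by
  have := gsum_meas H.pb (gr_mono huv n) (by rw [gr_zero]; exact hu) (c := fun i ω => KK p q (Y (gr u v n i) ω)) 0 (2 ^ n)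
    (fun i _ _ => H.Km p q (hu.trans (gr_ge huv n i)))
  rw [gr_last] at this
  have e : ksum B₁ B₂ Y p q u v n = fun ω => ∑ i ∈ Finset.Ico 0 (2 ^ n), dB B₁ B₂ (KK p q (Y (gr u v n i) ω)) (gr u v n i) (gr u v n (i + 1)) ω := by
    funext ω; rw [ksum, Finset.range_eq_Ico]
  rw [e]; exact this

/-- characteristic function bound along a late dyadic piece -/
lemma Core.cf_tail (H : Core μ F B₁ B₂ Y ρ σ lam y) {p q : ℂ} (hp : Complex.normSq p = 1) (hq : Complex.normSq q = 1)
    {I : Ω → ℝ} {t : ℝ} (ht : 0 ≤ t) (hI : TendstoInMeasure μ (fun n => ksum B₁ B₂ Y p q 0 t n) atTop I) (k : ℕ)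
    {G : Ω → ℝ} (hG : Measurable[F (t * (1 - 1 / 2 ^ k))] G) (κ : ℝ) :
    ‖∫ ω, Complex.exp (Complex.I * ((κ * (G ω + I ω) : ℝ) : ℂ)) ∂μ‖ ≤ Real.exp (-(κ ^ 2 * (t / 2 ^ k) / 2)) := by
  have hs0 : 0 ≤ t * (1 - 1 / 2 ^ k) := by
    have : (1:ℝ) / 2 ^ k ≤ 1 := by rw [div_le_one (by positivity)]; exact one_le_pow₀ (by norm_num)
    exact mul_nonneg ht (by linarith)
  have hle := H.pb.le (t * (1 - 1 / 2 ^ k))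
  set Z : Ω → ℂ := fun ω => Complex.exp (Complex.I * ((κ * G ω : ℝ) : ℂ)) with hZ
  have hZm : Measurable[F (t * (1 - 1 / 2 ^ k))] Z :=
    Complex.measurable_exp.comp ((Complex.measurable_ofReal.comp (hG.const_mul κ)).const_mul _)
  have nrm : ∀ x : ℝ, ‖Complex.exp (Complex.I * (x : ℂ))‖ = 1 := fun x => by
    rw [mul_comm Complex.I, Complex.norm_exp_ofReal_mul_I]
  have lim1 := tim_lin κ 0 hI (tim_const (fun _ => (0:ℝ)))
  have lim := tim_cexp (μ := μ) (Z := Z) (hZm.mono hle le_rfl) 1 (fun ω => (nrm _).le)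
    (f := fun n ω => κ * ksum B₁ B₂ Y p q 0 t n ω + 0 * 0)
    (fun n => (((H.ksum_meas p q le_rfl ht n).mono (H.pb.le t) le_rfl).const_mul κ).add_const _) lim1
  have e1 : (∫ ω, Complex.exp (Complex.I * ((κ * (G ω + I ω) : ℝ) : ℂ)) ∂μ) =
      ∫ ω, Z ω * Complex.exp (Complex.I * ((κ * I ω + 0 * 0 : ℝ) : ℂ)) ∂μ := by
    congr 1; funext ω; rw [hZ, ← Complex.exp_add]; push_cast; congr 1; ring
  rw [e1]
  refine le_of_tendsto lim.norm ?_
  filter_upwards [eventually_ge_atTop k] with n hn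
  -- split the sum
  obtain ⟨j, rfl⟩ := Nat.exists_eq_add_of_le hn
  set N := 2 ^ (k + j) with hN
  set M := 2 ^ (k + j) - 2 ^ j with hM
  have hjN : 2 ^ j ≤ 2 ^ (k + j) := Nat.pow_le_pow_right (by norm_num) (by omega)
  have hMN : M ≤ N := Nat.sub_le _ _
  have hgM : gr 0 t (k + j) M = t * (1 - 1 / 2 ^ k) := by
    rw [gr_0, hM, Nat.cast_sub hjN]; push_cast
    field_simp
    rw [pow_add]; field_simp
  have hτ := gr_mono ht (k + j)
  set c : ℕ → Ω → ℂ := fun i ω => (κ : ℂ) * KK p q (Y (gr 0 t (k + j) i) ω) with hc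
  have hcm : ∀ i, Measurable[F (gr 0 t (k + j) i)] (c i) := fun i => (H.Km p q (gr_ge ht _ i)).const_mul _
  have dBc : ∀ (a : ℂ) (s t : ℝ) ω, κ * dB B₁ B₂ a s t ω = dB B₁ B₂ (κ * a) s t ω := by
    intro a s t ω; simp [dB]; ring
  set Z' : Ω → ℂ := fun ω => Z ω * Complex.exp (Complex.I * ((∑ i ∈ Finset.Ico 0 M, dB B₁ B₂ (c i ω) (gr 0 t (k+j) i) (gr 0 t (k+j) (i + 1)) ω : ℝ) : ℂ)) with hZ'
  have hZ'm : Measurable[F (gr 0 t (k + j) M)] Z' := by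
    refine Measurable.mul (by rw [hgM]; exact hZm) ?_
    exact Complex.measurable_exp.comp ((Complex.measurable_ofReal.comp (gsum_meas H.pb hτ (by rw [gr_zero]) 0 M (fun i _ _ => hcm i))).const_mul _)
  have hZ'1 : ∀ ω, ‖Z' ω‖ ≤ 1 := fun ω => by rw [hZ', norm_mul, hZ, nrm, nrm, mul_one]
  have tv := two_valued H.pb hτ (by rw [gr_zero]) (c := c) M N hMN (fun i _ _ => hcm i) (α := fun _ => κ * p) (β := fun _ => κ * q)
    (fun i ω => by rcases KK_or p q (Y (gr 0 t (k + j) i) ω) with h | h <;> simp [hc, h]) (r := fun _ => κ ^ 2)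
    (fun i => by rw [map_mul, hp, Complex.normSq_ofReal]; ring) (fun i => by rw [map_mul, hq, Complex.normSq_ofReal]; ring) hZ'm hZ'1
  have e2 : (∫ ω, Z ω * Complex.exp (Complex.I * ((κ * ksum B₁ B₂ Y p q 0 t (k + j) ω + 0 * 0 : ℝ) : ℂ)) ∂μ) =
      ∫ ω, Z' ω * Complex.exp (Complex.I * ((∑ i ∈ Finset.Ico M N, dB B₁ B₂ (c i ω) (gr 0 t (k+j) i) (gr 0 t (k+j) (i + 1)) ω : ℝ) : ℂ)) ∂μ := by
    congr 1; funext ω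
    simp only [hZ']
    rw [mul_assoc, ← Complex.exp_add (Complex.I * ((∑ i ∈ Finset.Ico 0 M, _ : ℝ) : ℂ)), ← mul_add, ← Complex.ofReal_add, Finset.sum_Ico_consecutive _ (Nat.zero_le _) hMN]
    congr 4
    rw [ksum, Finset.mul_sum, zero_mul, add_zero, Finset.range_eq_Ico]
    exact Finset.sum_congr rfl fun i _ => dBc _ _ _ _
  rw [e2, tv, norm_mul, Complex.norm_exp, Complex.ofReal_re]
  have e3 : (∑ i ∈ Finset.Ico M N, κ ^ 2 * (gr 0 t (k + j) (i + 1) - gr 0 t (k + j) i) / 2) = κ ^ 2 * (t / 2 ^ k) / 2 := by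
    have : ∀ i, κ ^ 2 * (gr 0 t (k + j) (i + 1) - gr 0 t (k + j) i) / 2 = κ ^ 2 * (t / 2 ^ (k + j)) / 2 := fun i => by
      rw [gr_step]; simp
    simp only [this]
    rw [Finset.sum_const, Nat.card_Ico, hM, hN, Nat.sub_sub_self hjN, nsmul_eq_mul]
    push_cast; rw [pow_add]; field_simp
  rw [e3]
  have : ‖∫ ω, Z' ω ∂μ‖ ≤ 1 := by
    have := norm_integral_le_of_norm_le_const (μ := μ) (Eventually.of_forall hZ'1)
    simpa using this
  exact mul_le_of_le_one_right (Real.exp_pos _).le this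

end core


section zeronull
variable {μ : Measure Ω} [IsProbabilityMeasure μ] {F : ℝ → MeasurableSpace Ω} {B₁ B₂ Y : ℝ → Ω → ℝ} {ρ σ lam y : ℝ}

lemma gauss_fubini {X : Ω → ℝ} (hX : Measurable X) (c : ℝ) (b : ℝ → ℝ) (hbm : Measurable b) (hb1 : ∀ x, |b x| ≤ 1)
    (hb : ∀ N : ℝ, ‖∫ ω, Complex.exp (Complex.I * ((N * c * X ω : ℝ) : ℂ)) ∂μ‖ ≤ b N) :
    ∫ ω, Real.exp (-(c * X ω) ^ 2 / 2) ∂μ ≤ ∫ N, b N ∂(gaussianReal 0 1) := by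
  have h1 : ∀ ω, ((Real.exp (-(c * X ω) ^ 2 / 2) : ℝ) : ℂ) = ∫ N, Complex.exp (Complex.I * ((N * c * X ω : ℝ) : ℂ)) ∂(gaussianReal 0 1) := by
    intro ω
    have := charFun_gaussianReal (μ := 0) (v := 1) (c * X ω)
    rw [charFun_apply_real] at this
    have e : ∀ N : ℝ, Complex.exp (Complex.I * ((N * c * X ω : ℝ) : ℂ)) = Complex.exp (((c * X ω : ℝ) : ℂ) * N * Complex.I) := by
      intro N; congr 1; push_cast; ring
    simp only [e]
    rw [this]
    push_cast; congr 1; simp; ring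
  have nrm : ∀ x : ℝ, ‖Complex.exp (Complex.I * (x : ℂ))‖ = 1 := fun x => by
    rw [mul_comm Complex.I, Complex.norm_exp_ofReal_mul_I]
  have hintg : Integrable (Function.uncurry fun ω (N : ℝ) => Complex.exp (Complex.I * ((N * c * X ω : ℝ) : ℂ))) (μ.prod (gaussianReal 0 1)) := by
    refine integrable_of_bdd ?_ 1 ?_
    · refine Complex.measurable_exp.comp (Measurable.const_mul (Complex.measurable_ofReal.comp ?_) _)
      exact (measurable_snd.mul_const c).mul (hX.comp measurable_fst)
    · rintro ⟨ω, N⟩; exact (nrm _).le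
  have h2 : ((∫ ω, Real.exp (-(c * X ω) ^ 2 / 2) ∂μ : ℝ) : ℂ) = ∫ N, ∫ ω, Complex.exp (Complex.I * ((N * c * X ω : ℝ) : ℂ)) ∂μ ∂(gaussianReal 0 1) := by
    rw [← integral_complex_ofReal]
    simp only [h1]
    exact integral_integral_swap hintg
  have h3 : ∫ ω, Real.exp (-(c * X ω) ^ 2 / 2) ∂μ ≤ ‖((∫ ω, Real.exp (-(c * X ω) ^ 2 / 2) ∂μ : ℝ) : ℂ)‖ := by
    rw [Complex.norm_real]; exact le_abs_self _
  rw [h2] at h3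
  refine h3.trans (norm_integral_le_of_norm_le ?_ (Eventually.of_forall hb))
  exact integrable_of_bdd hbm 1 hb1

lemma Core.zero_null (H : Core μ F B₁ B₂ Y ρ σ lam y) {t : ℝ} (ht : 0 < t) : μ {ω | Y t ω = 0} = 0 := by
  have hn := H.norm
  have hp : Complex.normSq (ρ - σ * Complex.I) = 1 := by
    rw [Complex.normSq_apply]; simp; nlinarith
  have hq : Complex.normSq (σ - ρ * Complex.I) = 1 := by
    rw [Complex.normSq_apply]; simp; nlinarith
  have hl := H.lam_pos
  -- the bound
  have bound : ∀ k : ℕ, μ.real {ω | Y t ω = 0} ≤ Real.exp (1/2) * ∫ N, Real.exp (-((N / (lam * (t / 2 ^ k))) ^ 2 * (t / 2 ^ k) / 2)) ∂(gaussianReal 0 1) := by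
    intro k
    set δ : ℝ := t / 2 ^ k with hδ
    have hδ0 : 0 < δ := by positivity
    set s : ℝ := t * (1 - 1 / 2 ^ k) with hs
    have hts : t - s = δ := by rw [hs, hδ]; ring
    have hs0 : 0 ≤ s := by
      have : (1:ℝ) / 2 ^ k ≤ 1 := by rw [div_le_one (by positivity)]; exact one_le_pow₀ (by norm_num)
      exact mul_nonneg ht.le (by linarith)
    have hG : Measurable[F s] fun ω => y - lam * AA Y s ω := ((H.AAm hs0).const_mul lam).const_sub y
    set X : Ω → ℝ := fun ω => (y - lam * AA Y s ω) + WW Y lam y t ω with hX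
    have hXm : Measurable X := (hG.mono (H.pb.le s) le_rfl).add ((H.WWm ht.le).mono (H.pb.le t) le_rfl)
    have hcf : ∀ N : ℝ, ‖∫ ω, Complex.exp (Complex.I * ((N * (1 / (lam * δ)) * X ω : ℝ) : ℂ)) ∂μ‖ ≤ Real.exp (-((N / (lam * δ)) ^ 2 * δ / 2)) := by
      intro N
      have := H.cf_tail hp hq ht.le (H.W t ht.le) k hG (N * (1 / (lam * δ)))
      rwa [mul_one_div] at this ⊢
    have fub := gauss_fubini (μ := μ) hXm (1 / (lam * δ)) _ (by fun_prop) (fun x => by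
      rw [abs_of_pos (Real.exp_pos _), Real.exp_le_one_iff]
      have : 0 ≤ (x / (lam * δ)) ^ 2 * δ / 2 := by positivity
      linarith) hcf
    have hms : MeasurableSet {ω | Y t ω = 0} := ((H.meas t ht.le).mono (H.pb.le t) le_rfl) (measurableSet_singleton 0)
    have step : μ.real {ω | Y t ω = 0} ≤ Real.exp (1/2) * ∫ ω, Real.exp (-(1 / (lam * δ) * X ω) ^ 2 / 2) ∂μ := by
      rw [← integral_const_mul, ← integral_indicator_one hms]
      refine integral_mono ((integrable_const (1:ℝ)).indicator hms) ?_ ?_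
      · refine Integrable.const_mul (integrable_of_bdd (by fun_prop) 1 fun ω => ?_) _
        rw [Real.norm_eq_abs, abs_of_pos (Real.exp_pos _), Real.exp_le_one_iff]
        have : 0 ≤ (1 / (lam * δ) * X ω) ^ 2 := by positivity
        linarith
      · intro ω
        by_cases h : ω ∈ {ω | Y t ω = 0}
        · rw [indicator_of_mem h]
          simp only [Pi.one_apply]
          rw [← Real.exp_add]
          have h0 : Y t ω = 0 := h
          have hXe : X ω = lam * (AA Y t ω - AA Y s ω) := by simp only [hX, WW, h0]; ring
          have hA := AA_lip H.cont s t ω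
          rw [hts, abs_of_pos hδ0] at hA
          have hc : |1 / (lam * δ) * X ω| ≤ 1 := by
            rw [hXe, abs_mul, abs_mul, abs_of_pos hl, abs_of_pos (by positivity : 0 < 1 / (lam * δ)), one_div_mul_eq_div, div_le_one (by positivity)]
            gcongr
          have : (1 / (lam * δ) * X ω) ^ 2 ≤ 1 := by rw [← sq_abs]; exact pow_le_one₀ (abs_nonneg _) hc
          rw [Real.one_le_exp_iff]; linarith
        · rw [indicator_of_notMem h]; positivity
    exact step.trans (mul_le_mul_of_nonneg_left fub (Real.exp_pos _).le)
  have lim : Tendsto (fun k : ℕ => Real.exp (1/2) * ∫ N, Real.exp (-((N / (lam * (t / 2 ^ k))) ^ 2 * (t / 2 ^ k) / 2)) ∂(gaussianReal 0 1)) atTop (nhds (Real.exp (1/2) * ∫ N : ℝ, (0:ℝ) ∂(gaussianReal 0 1))) := by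
    refine Tendsto.const_mul _ ?_
    refine tendsto_integral_of_dominated_convergence (fun _ => 1) ?_ (integrable_const _) ?_ ?_
    · intro k; exact Measurable.aestronglyMeasurable (by fun_prop)
    · intro k; refine Eventually.of_forall fun N => ?_
      rw [Real.norm_eq_abs, abs_of_pos (Real.exp_pos _), Real.exp_le_one_iff]
      have : 0 ≤ (N / (lam * (t / 2 ^ k))) ^ 2 * (t / 2 ^ k) / 2 := by positivity
      linarith
    · have hna : NullSingletonClass (gaussianReal 0 1) := nullSingletonClass_gaussianReal (by norm_num)
      have h0 : ∀ᵐ N ∂(gaussianReal 0 1), N ≠ 0 := by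
        rw [ae_iff]; simp only [ne_eq, not_not]; exact measure_singleton (0:ℝ)
      filter_upwards [h0] with N hN
      refine Real.tendsto_exp_neg_atTop_nhds_zero.comp ?_
      have e : ∀ k : ℕ, (N / (lam * (t / 2 ^ k))) ^ 2 * (t / 2 ^ k) / 2 = (N ^ 2 / (2 * lam ^ 2 * t)) * 2 ^ k := by
        intro k; field_simp
      simp only [e]
      have : 0 < N ^ 2 / (2 * lam ^ 2 * t) := by positivity
      exact Tendsto.const_mul_atTop this (tendsto_pow_atTop_atTop_of_one_lt (by norm_num))
  rw [integral_zero, MulZeroClass.mul_zero] at lim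
  have : μ.real {ω | Y t ω = 0} ≤ 0 := ge_of_tendsto' lim bound
  have h0 : μ.real {ω | Y t ω = 0} = 0 := le_antisymm this measureReal_nonneg
  exact (measureReal_eq_zero_iff (by simp)).1 h0

end zeronull


section grid

def idx (u v : ℝ) (n : ℕ) (s : ℝ) : ℕ := ⌈(s - u) * 2 ^ n / (v - u)⌉₊ - 1

lemma idx_spec {u v s : ℝ} (n : ℕ) (hs : s ∈ Ioc u v) :
    idx u v n s < 2 ^ n ∧ s ∈ Ioc (gr u v n (idx u v n s)) (gr u v n (idx u v n s + 1)) := by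
  have huv : 0 < v - u := by linarith [hs.1, hs.2]
  have hx : 0 < (s - u) * 2 ^ n / (v - u) := by
    have : 0 < s - u := by linarith [hs.1]
    positivity
  set x := (s - u) * 2 ^ n / (v - u) with hxd
  have hc : 1 ≤ ⌈x⌉₊ := Nat.one_le_iff_ne_zero.2 (by rw [Ne, Nat.ceil_eq_zero]; linarith)
  have hi : idx u v n s + 1 = ⌈x⌉₊ := by
    have : idx u v n s = ⌈x⌉₊ - 1 := rfl
    omega
  have hx2 : x ≤ 2 ^ n := by
    rw [hxd, div_le_iff₀ huv, mul_comm]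
    exact mul_le_mul_of_nonneg_left (by linarith [hs.2]) (by positivity)
  have h1 : (idx u v n s : ℝ) < x := by
    have := Nat.ceil_lt_add_one hx.le
    have h2 : ((idx u v n s + 1 : ℕ) : ℝ) < x + 1 := by rw [hi]; exact this
    push_cast at h2; linarith
  have h2 : x ≤ ((idx u v n s + 1 : ℕ) : ℝ) := by rw [hi]; exact Nat.le_ceil x
  have hsx : s = u + (v - u) * x / 2 ^ n := by rw [hxd]; field_simp; ring
  refine ⟨?_, ?_, ?_⟩
  · have : (idx u v n s : ℝ) < (2:ℝ) ^ n := h1.trans_le hx2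
    exact_mod_cast this
  · rw [gr]
    calc _ < u + (v - u) * x / 2 ^ n := by gcongr
      _ = s := hsx.symm
  · rw [gr]
    calc s = u + (v - u) * x / 2 ^ n := hsx
      _ ≤ _ := by gcongr

lemma idx_unique {u v s : ℝ} (n i : ℕ) (huv : u ≤ v) (hs : s ∈ Ioc (gr u v n i) (gr u v n (i + 1))) (hs' : s ∈ Ioc u v) : i = idx u v n s := by
  obtain ⟨-, h2⟩ := idx_spec n hs'
  rcases lt_trichotomy i (idx u v n s) with h | h | h
  · have := gr_mono huv n (show i + 1 ≤ idx u v n s by omega)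
    linarith [hs.2, h2.1]
  · exact h
  · have := gr_mono huv n (show idx u v n s + 1 ≤ i by omega)
    linarith [hs.1, h2.2]

lemma gr_idx_tendsto {u v s : ℝ} (hs : s ∈ Ioc u v) {ν : ℕ → ℕ} (hν : Tendsto ν atTop atTop) :
    Tendsto (fun n => gr u v (ν n) (idx u v (ν n) s)) atTop (nhds s) := by
  have h0 : Tendsto (fun n => s - (v - u) * (1 / 2) ^ (ν n)) atTop (nhds s) := by
    have := ((tendsto_pow_atTop_nhds_zero_of_lt_one (r := (1/2 : ℝ)) (by norm_num) (by norm_num)).comp hν).const_mul (v - u)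
    have := this.const_sub s
    simpa using this
  refine tendsto_of_tendsto_of_tendsto_of_le_of_le h0 tendsto_const_nhds (fun n => ?_) (fun n => ?_)
  · have h := (idx_spec (ν n) hs).2.2
    rw [gr_succ] at h
    simp only [one_div, inv_pow]
    rw [← div_eq_mul_inv]; linarith
  · exact (idx_spec (ν n) hs).2.1.le

def stp {E : Type*} [AddCommMonoid E] (u v : ℝ) (n : ℕ) (φ : ℕ → E) (s : ℝ) : E :=
  ∑ i ∈ Finset.range (2 ^ n), (Ioc (gr u v n i) (gr u v n (i + 1))).indicator (fun _ => φ i) s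

lemma stp_of_mem {E : Type*} [AddCommMonoid E] {u v s : ℝ} (n : ℕ) (φ : ℕ → E) (hs : s ∈ Ioc u v) : stp u v n φ s = φ (idx u v n s) := by
  have huv : u ≤ v := hs.1.le.trans hs.2
  obtain ⟨h1, h2⟩ := idx_spec n hs
  unfold stp
  rw [Finset.sum_eq_single (idx u v n s)]
  · rw [indicator_of_mem h2]
  · intro i _ hne
    exact indicator_of_notMem (fun h => hne (idx_unique n i huv h hs)) _
  · intro h; exact absurd (Finset.mem_range.2 h1) h

lemma stp_of_notMem {E : Type*} [AddCommMonoid E] {u v s : ℝ} (huv : u ≤ v) (n : ℕ) (φ : ℕ → E) (hs : s ∉ Ioc u v) : stp u v n φ s = 0 := by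
  unfold stp
  refine Finset.sum_eq_zero fun i hi => indicator_of_notMem (fun h => hs ⟨?_, ?_⟩) _
  · exact (gr_ge huv n i).trans_lt h.1
  · exact h.2.trans (gr_le huv n _ (Finset.mem_range.1 hi))

variable {μ : Measure Ω} [IsProbabilityMeasure μ] {F : ℝ → MeasurableSpace Ω} {B₁ B₂ Y : ℝ → Ω → ℝ} {ρ σ lam y : ℝ}

lemma stp_meas (u v : ℝ) (n : ℕ) {c : ℕ → Ω → ℂ} (hc : ∀ i < 2 ^ n, Measurable (c i)) :
    Measurable fun x : ℝ × Ω => stp u v n (fun i => c i x.2) x.1 := by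
  unfold stp
  refine Finset.measurable_sum _ fun i hi => ?_
  have : (fun x : ℝ × Ω => (Ioc (gr u v n i) (gr u v n (i + 1))).indicator (fun _ => c i x.2) x.1) =
      ((Prod.fst : ℝ × Ω → ℝ) ⁻¹' (Ioc (gr u v n i) (gr u v n (i + 1)))).indicator (fun x => c i x.2) := by
    funext x; simp [indicator]
  rw [this]
  exact ((hc i (Finset.mem_range.1 hi)).comp measurable_snd).indicator (measurable_fst measurableSet_Ioc)

lemma ito_one (hP : PB μ F B₁ B₂) {u v : ℝ} (hu : 0 ≤ u) (huv : u ≤ v) {c : Ω → ℂ} (hc : Measurable[F u] c) {C : ℝ} (hC : ∀ ω, ‖c ω‖ ≤ C) :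
    Ito μ F B₁ B₂ (fun x => (Ioc u v).indicator (fun _ => c x.2) x.1) (fun ω => dB B₁ B₂ (c ω) u v ω) := by
  have h1 := Ito.gen hP hu huv 1 (Complex.measurable_re.comp hc) (fun ω => (Complex.abs_re_le_norm _).trans (hC ω))
  have h2 := Ito.gen hP hu huv Complex.I (Complex.measurable_im.comp hc) (fun ω => (Complex.abs_im_le_norm _).trans (hC ω))
  refine (h1.add h2).congr (Eventually.of_forall fun x => ?_) (Eventually.of_forall fun ω => ?_)
  · simp only [indicator, Function.comp]; split_ifs
    · rw [mul_one, Complex.re_add_im]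
    · simp
  · simp [dB]

lemma ito_grid (hP : PB μ F B₁ B₂) {u v : ℝ} (hu : 0 ≤ u) (huv : u ≤ v) (n : ℕ) {c : ℕ → Ω → ℂ}
    (hc : ∀ i < 2 ^ n, Measurable[F (gr u v n i)] (c i)) {C : ℝ} (hC : ∀ i ω, ‖c i ω‖ ≤ C) :
    Ito μ F B₁ B₂ (fun x => stp u v n (fun i => c i x.2) x.1)
      (fun ω => ∑ i ∈ Finset.range (2 ^ n), dB B₁ B₂ (c i ω) (gr u v n i) (gr u v n (i + 1)) ω) := by
  unfold stp
  refine Ito.sum _ fun i hi => ?_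
  exact ito_one hP (hu.trans (gr_ge huv n i)) (gr_mono huv n (Nat.le_succ i)) (hc i (Finset.mem_range.1 hi)) (hC i)

lemma stp_l2 {u v : ℝ} (huv : u ≤ v) {ν : ℕ → ℕ} {c : ℕ → ℕ → Ω → ℂ}
    (hc : ∀ k, ∀ i < 2 ^ (ν k), Measurable (c k i)) {C : ℝ} (hC : ∀ k i ω, ‖c k i ω‖ ≤ C) {c' : ℝ × Ω → ℂ} (hc' : Measurable c')
    (hC' : ∀ x, ‖c' x‖ ≤ C)
    (hlim : ∀ᵐ x ∂((volume : Measure ℝ).prod μ), x.1 ∈ Ioc u v → Tendsto (fun k => c k (idx u v (ν k) x.1) x.2) atTop (nhds (c' x))) :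
    Tendsto (fun k => eLpNorm (fun x : ℝ × Ω => stp u v (ν k) (fun i => c k i x.2) x.1 - (Ioc u v).indicator (fun _ => c' x) x.1) 2
      ((volume : Measure ℝ).prod μ)) atTop (nhds 0) := by
  have hCp : ∀ x : ℝ × Ω, 0 ≤ C := fun x => (norm_nonneg _).trans (hC' x)
  refine l2_of_ae (C := C) (u := u) (v := v) (fun k => stp_meas u v (ν k) (hc k)) ?_ ?_ ?_ ?_ ?_ ?_
  · have : (fun x : ℝ × Ω => (Ioc u v).indicator (fun _ => c' x) x.1) =
      ((Prod.fst : ℝ × Ω → ℝ) ⁻¹' (Ioc u v)).indicator c' := by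
      funext x; simp [indicator]
    rw [this]; exact hc'.indicator (measurable_fst measurableSet_Ioc)
  · intro k x
    by_cases hx : x.1 ∈ Ioc u v
    · rw [stp_of_mem _ _ hx]; exact hC _ _ _
    · rw [stp_of_notMem huv _ _ hx]; simpa using hCp x
  · intro x
    by_cases hx : x.1 ∈ Ioc u v
    · rw [indicator_of_mem hx]; exact hC' x
    · rw [indicator_of_notMem hx]; simpa using hCp x
  · intro k x hx; exact stp_of_notMem huv _ _ hx
  · intro x hx; exact indicator_of_notMem hx _
  · filter_upwards [hlim] with x hx
    by_cases h : x.1 ∈ Ioc u v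
    · rw [indicator_of_mem h]; simp only [stp_of_mem _ _ h]; exact hx h
    · rw [indicator_of_notMem h]; simp only [stp_of_notMem huv _ _ h]; exact tendsto_const_nhds

/-- Ito property of limits of grid sums. -/
lemma ito_of_lim (hP : PB μ F B₁ B₂) {u v : ℝ} (hu : 0 ≤ u) (huv : u ≤ v) {ν : ℕ → ℕ} {c : ℕ → ℕ → Ω → ℂ}
    (hc : ∀ k, ∀ i < 2 ^ (ν k), Measurable[F (gr u v (ν k) i)] (c k i)) {C : ℝ} (hC : ∀ k i ω, ‖c k i ω‖ ≤ C) {c' : ℝ × Ω → ℂ} (hc' : Measurable c')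
    (hC' : ∀ x, ‖c' x‖ ≤ C)
    (hlim : ∀ᵐ x ∂((volume : Measure ℝ).prod μ), x.1 ∈ Ioc u v → Tendsto (fun k => c k (idx u v (ν k) x.1) x.2) atTop (nhds (c' x)))
    {J : Ω → ℝ} (hJ : TendstoInMeasure μ (fun k ω => ∑ i ∈ Finset.range (2 ^ (ν k)), dB B₁ B₂ (c k i ω) (gr u v (ν k) i) (gr u v (ν k) (i + 1)) ω) atTop J) :
    Ito μ F B₁ B₂ (fun x => (Ioc u v).indicator (fun _ => c' x) x.1) J := by
  refine Ito.closure hP (fun k => ito_grid hP hu huv (ν k) (hc k) (hC k)) ?_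
    (stp_l2 huv (fun k i hi => (hc k i hi).mono (hP.le _) le_rfl) hC hc' hC' hlim) hJ
  have : (fun x : ℝ × Ω => (Ioc u v).indicator (fun _ => c' x) x.1) =
      ((Prod.fst : ℝ × Ω → ℝ) ⁻¹' (Ioc u v)).indicator c' := by
      funext x; simp [indicator]
  refine memLp_prod_bdd (C := C) (u := u) (v := v) ?_ ?_ ?_
  · rw [this]; exact hc'.indicator (measurable_fst measurableSet_Ioc)
  · intro x
    by_cases hx : x.1 ∈ Ioc u v
    · rw [indicator_of_mem hx]; exact hC' x
    · rw [indicator_of_notMem hx]; simpa using (norm_nonneg _).trans (hC' x)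
  · intro x hx; exact indicator_of_notMem hx _

lemma lim_of_ito (hP : PB μ F B₁ B₂) {u v : ℝ} (hu : 0 ≤ u) (huv : u ≤ v) {ν : ℕ → ℕ} {c : ℕ → ℕ → Ω → ℂ}
    (hc : ∀ k, ∀ i < 2 ^ (ν k), Measurable[F (gr u v (ν k) i)] (c k i)) {C : ℝ} (hC : ∀ k i ω, ‖c k i ω‖ ≤ C) {c' : ℝ × Ω → ℂ} (hc' : Measurable c')
    (hC' : ∀ x, ‖c' x‖ ≤ C)
    (hlim : ∀ᵐ x ∂((volume : Measure ℝ).prod μ), x.1 ∈ Ioc u v → Tendsto (fun k => c k (idx u v (ν k) x.1) x.2) atTop (nhds (c' x)))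
    {J : Ω → ℝ} (hJ : Ito μ F B₁ B₂ (fun x => (Ioc u v).indicator (fun _ => c' x) x.1) J) :
    TendstoInMeasure μ (fun k ω => ∑ i ∈ Finset.range (2 ^ (ν k)), dB B₁ B₂ (c k i ω) (gr u v (ν k) i) (gr u v (ν k) (i + 1)) ω) atTop J :=
  Ito.tendsto hP (fun k => ito_grid hP hu huv (ν k) (hc k) (hC k)) hJ
    (stp_l2 huv (fun k i hi => (hc k i hi).mono (hP.le _) le_rfl) hC hc' hC' hlim)

lemma Core.jm (H : Core μ F B₁ B₂ Y ρ σ lam y) : Measurable fun x : ℝ × Ω => Y x.1 x.2 :=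
  measurable_uncurry_of_continuous_of_measurable (u := fun s ω => Y s ω) H.cont H.measm

lemma Core.ne_zero_ae (H : Core μ F B₁ B₂ Y ρ σ lam y) : ∀ᵐ x ∂((volume : Measure ℝ).prod μ), 0 < x.1 → Y x.1 x.2 ≠ 0 := by
  have hms : MeasurableSet {x : ℝ × Ω | 0 < x.1 → Y x.1 x.2 ≠ 0} := by
    have : {x : ℝ × Ω | 0 < x.1 → Y x.1 x.2 ≠ 0} = ({x : ℝ × Ω | 0 < x.1} ∩ {x | Y x.1 x.2 = 0})ᶜ := by
      ext x; simp
    rw [this]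
    exact ((measurableSet_lt measurable_const measurable_fst).inter (H.jm (measurableSet_singleton 0))).compl
  refine (Measure.ae_prod_iff_ae_ae hms).2 (Eventually.of_forall fun s => ?_)
  by_cases hs : 0 < s
  · have := H.zero_null hs
    rw [ae_iff]; simpa [hs] using this
  · exact Eventually.of_forall fun ω h => absurd h hs

lemma Core.ne_zero_path (H : Core μ F B₁ B₂ Y ρ σ lam y) : ∀ᵐ ω ∂μ, ∀ᵐ s : ℝ, 0 < s → Y s ω ≠ 0 := by
  have h := H.ne_zero_ae
  have hms : MeasurableSet {x : ℝ × Ω | 0 < x.1 → Y x.1 x.2 ≠ 0} := by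
    have : {x : ℝ × Ω | 0 < x.1 → Y x.1 x.2 ≠ 0} = ({x : ℝ × Ω | 0 < x.1} ∩ {x | Y x.1 x.2 = 0})ᶜ := by
      ext x; simp
    rw [this]
    exact ((measurableSet_lt measurable_const measurable_fst).inter (H.jm (measurableSet_singleton 0))).compl
  have h2 : ∀ᵐ x ∂(μ.prod (volume : Measure ℝ)), 0 < x.2 → Y x.2 x.1 ≠ 0 := by
    have := (Measure.measurePreserving_swap (μ := μ) (ν := (volume : Measure ℝ))).quasiMeasurePreserving.ae h
    exact this
  exact Measure.ae_ae_of_ae_prod h2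

lemma psgn_cont {a : ℝ} (ha : a ≠ 0) : ContinuousAt psgn a := by
  rcases lt_or_gt_of_ne ha with h | h
  · have : psgn =ᶠ[nhds a] fun _ => -1 := by
      filter_upwards [Iio_mem_nhds h] with x hx
      simp only [psgn, if_neg (not_lt.2 (le_of_lt (mem_Iio.1 hx)))]
    exact continuousAt_const.congr this.symm
  · have : psgn =ᶠ[nhds a] fun _ => 1 := by
      filter_upwards [Ioi_mem_nhds h] with x hx
      simp only [psgn, if_pos (mem_Ioi.1 hx)]
    exact continuousAt_const.congr this.symm

lemma KK_cont (p q : ℂ) {a : ℝ} (ha : a ≠ 0) : ContinuousAt (KK p q) a := by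
  rcases lt_or_gt_of_ne ha with h | h
  · have : KK p q =ᶠ[nhds a] fun _ => q := by
      filter_upwards [Iio_mem_nhds h] with x hx
      simp only [KK, if_neg (not_lt.2 (le_of_lt (mem_Iio.1 hx)))]
    exact continuousAt_const.congr this.symm
  · have : KK p q =ᶠ[nhds a] fun _ => p := by
      filter_upwards [Ioi_mem_nhds h] with x hx
      simp only [KK, if_pos (mem_Ioi.1 hx)]
    exact continuousAt_const.congr this.symm

lemma KK_bd (p q : ℂ) (a : ℝ) : ‖KK p q a‖ ≤ ‖p‖ + ‖q‖ := by
  rcases KK_or p q a with h | h <;> rw [h] <;> linarith [norm_nonneg p, norm_nonneg q]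

lemma Core.KK_lim (H : Core μ F B₁ B₂ Y ρ σ lam y) (p q : ℂ) {u v : ℝ} (hu : 0 ≤ u) {ν : ℕ → ℕ} (hν : Tendsto ν atTop atTop) :
    ∀ᵐ x ∂((volume : Measure ℝ).prod μ), x.1 ∈ Ioc u v →
      Tendsto (fun k => KK p q (Y (gr u v (ν k) (idx u v (ν k) x.1)) x.2)) atTop (nhds (KK p q (Y x.1 x.2))) := by
  filter_upwards [H.ne_zero_ae] with x hx hm
  have h0 := hx (hu.trans_lt hm.1)
  exact (KK_cont p q h0).tendsto.comp (((H.cont x.2).tendsto x.1).comp (gr_idx_tendsto hm hν))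

lemma Core.ito_SI (H : Core μ F B₁ B₂ Y ρ σ lam y) {p q : ℂ} {I : ℝ → Ω → ℝ} (hI : SI μ B₁ B₂ Y p q I) {s t : ℝ} (hs : 0 ≤ s) (hst : s ≤ t) :
    Ito μ F B₁ B₂ (fun x => (Ioc s t).indicator (fun _ => KK p q (Y x.1 x.2)) x.1) (fun ω => I t ω - I s ω) := by
  have base : ∀ t, 0 ≤ t → Ito μ F B₁ B₂ (fun x => (Ioc 0 t).indicator (fun _ => KK p q (Y x.1 x.2)) x.1) (I t) := by
    intro t ht
    exact ito_of_lim H.pb le_rfl ht (ν := id) (c := fun k i ω => KK p q (Y (gr 0 t k i) ω))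
      (fun k i _ => H.Km p q (gr_ge ht k i)) (fun k i ω => KK_bd p q _) ((KK_meas p q).comp H.jm) (fun x => KK_bd p q _)
      (H.KK_lim p q le_rfl tendsto_id) (hI t ht)
  refine ((base t (hs.trans hst)).sub (base s hs)).congr (Eventually.of_forall fun x => ?_) (Eventually.of_forall fun ω => rfl)
  have hS : Ioc 0 t = Ioc 0 s ∪ Ioc s t := (Ioc_union_Ioc_eq_Ioc hs hst).symm
  simp only [indicator, mem_Ioc]
  by_cases h1 : 0 < x.1 <;> by_cases h2 : x.1 ≤ s <;> by_cases h3 : x.1 ≤ t <;> simp [h1, h2, h3] <;> intros <;> exfalso <;> linarith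

lemma Core.lim_SI (H : Core μ F B₁ B₂ Y ρ σ lam y) {p q : ℂ} {I : ℝ → Ω → ℝ} (hI : SI μ B₁ B₂ Y p q I) {s t : ℝ} (hs : 0 ≤ s) (hst : s ≤ t) :
    TendstoInMeasure μ (fun n => ksum B₁ B₂ Y p q s t n) atTop (fun ω => I t ω - I s ω) :=
  lim_of_ito H.pb hs hst (ν := id) (c := fun k i ω => KK p q (Y (gr s t k i) ω))
      (fun k i _ => H.Km p q (hs.trans (gr_ge hst k i))) (fun k i ω => KK_bd p q _) ((KK_meas p q).comp H.jm) (fun x => KK_bd p q _)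
      (H.KK_lim p q hs tendsto_id) (H.ito_SI hI hs hst)

lemma dB_smul (g : ℝ) (a : ℂ) (s t : ℝ) (ω : Ω) : dB B₁ B₂ (g * a) s t ω = g * dB B₁ B₂ a s t ω := by simp [dB]; ring

lemma Core.ito_mul (H : Core μ F B₁ B₂ Y ρ σ lam y) {p q : ℂ} {I : ℝ → Ω → ℝ} (hI : SI μ B₁ B₂ Y p q I) {s t : ℝ} (hs : 0 ≤ s) (hst : s ≤ t)
    {G : Ω → ℝ} (hG : Measurable[F s] G) {C : ℝ} (hC : ∀ ω, |G ω| ≤ C) :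
    Ito μ F B₁ B₂ (fun x => (Ioc s t).indicator (fun _ => (G x.2 : ℂ) * KK p q (Y x.1 x.2)) x.1) (fun ω => G ω * (I t ω - I s ω)) := by
  have h1 := tim_mul C hC (H.lim_SI hI hs hst)
  have bd : ∀ ω a, ‖(G ω : ℂ) * KK p q a‖ ≤ C * (‖p‖ + ‖q‖) := by
    intro ω a
    rw [norm_mul, Complex.norm_real, Real.norm_eq_abs]
    exact mul_le_mul (hC ω) (KK_bd p q a) (norm_nonneg _) ((abs_nonneg _).trans (hC ω))
  have hGm : Measurable G := hG.mono (H.pb.le s) le_rfl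
  refine ito_of_lim H.pb hs hst (ν := id) (c := fun k i ω => (G ω : ℂ) * KK p q (Y (gr s t k i) ω)) (C := C * (‖p‖ + ‖q‖))
      (fun k i _ => ?_) (fun k i ω => bd _ _) ?_ (fun x => bd _ _) ?_ ?_
  · exact (Complex.measurable_ofReal.comp (hG.mono (H.pb.mono (gr_ge hst k i)) le_rfl)).mul (H.Km p q (hs.trans (gr_ge hst k i)))
  · exact (Complex.measurable_ofReal.comp (hGm.comp measurable_snd)).mul ((KK_meas p q).comp H.jm)
  · filter_upwards [H.KK_lim p q (v := t) hs tendsto_id] with x hx hm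
    exact (hx hm).const_mul _
  · refine h1.congr_left fun n => Eventually.of_forall fun ω => ?_
    simp only [ksum, Finset.mul_sum, dB_smul, id]

/-- Lemma N, auxiliary -/
lemma Core.lemN_aux (H : Core μ F B₁ B₂ Y ρ σ lam y) {p q : ℂ} {I : ℝ → Ω → ℝ} (hI : SI μ B₁ B₂ Y p q I) {u v : ℝ} (hu : 0 ≤ u) (huv : u ≤ v)
    {ν : ℕ → ℕ} {G : ℕ → ℕ → Ω → ℝ} (hG : ∀ k, ∀ i < 2 ^ (ν k), Measurable[F (gr u v (ν k) i)] (G k i)) {C : ℝ} (hC : ∀ k i ω, |G k i ω| ≤ C)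
    {Γ : ℝ × Ω → ℂ} (hΓ : Measurable Γ) (hΓC : ∀ x, ‖Γ x‖ ≤ C * (‖p‖ + ‖q‖))
    (hlim : ∀ᵐ x ∂((volume : Measure ℝ).prod μ), x.1 ∈ Ioc u v → Tendsto (fun k => (G k (idx u v (ν k) x.1) x.2 : ℂ) * KK p q (Y x.1 x.2)) atTop (nhds (Γ x))) :
    (∀ k, Ito μ F B₁ B₂ (fun x => stp u v (ν k) (fun i => (G k i x.2 : ℂ) * KK p q (Y x.1 x.2)) x.1)
      (fun ω => ∑ i ∈ Finset.range (2 ^ (ν k)), G k i ω * (I (gr u v (ν k) (i + 1)) ω - I (gr u v (ν k) i) ω))) ∧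
    Tendsto (fun k => eLpNorm (fun x : ℝ × Ω => stp u v (ν k) (fun i => (G k i x.2 : ℂ) * KK p q (Y x.1 x.2)) x.1 - (Ioc u v).indicator (fun _ => Γ x) x.1) 2
      ((volume : Measure ℝ).prod μ)) atTop (nhds 0) := by
  have h1 : ∀ k, Ito μ F B₁ B₂ (fun x => stp u v (ν k) (fun i => (G k i x.2 : ℂ) * KK p q (Y x.1 x.2)) x.1)
      (fun ω => ∑ i ∈ Finset.range (2 ^ (ν k)), G k i ω * (I (gr u v (ν k) (i + 1)) ω - I (gr u v (ν k) i) ω)) := by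
    intro k
    unfold stp
    exact Ito.sum _ fun i hi => H.ito_mul hI (hu.trans (gr_ge huv _ i)) (gr_mono huv _ (Nat.le_succ i)) (hG k i (Finset.mem_range.1 hi)) (hC k i)
  have hCp : ∀ (k : ℕ) (x : ℝ × Ω), 0 ≤ C * (‖p‖ + ‖q‖) := fun k x => mul_nonneg ((abs_nonneg _).trans (hC k 0 x.2)) (by positivity)
  have hK : Measurable fun x : ℝ × Ω => KK p q (Y x.1 x.2) := (KK_meas p q).comp H.jm
  refine ⟨h1, ?_⟩
  refine l2_of_ae (C := C * (‖p‖ + ‖q‖)) (u := u) (v := v) ?_ ?_ ?_ ?_ ?_ ?_ ?_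
  · intro k
    unfold stp
    refine Finset.measurable_sum _ fun i hi => ?_
    have : (fun x : ℝ × Ω => (Ioc (gr u v (ν k) i) (gr u v (ν k) (i + 1))).indicator (fun _ => (G k i x.2 : ℂ) * KK p q (Y x.1 x.2)) x.1) =
        ((Prod.fst : ℝ × Ω → ℝ) ⁻¹' (Ioc (gr u v (ν k) i) (gr u v (ν k) (i + 1)))).indicator (fun x => (G k i x.2 : ℂ) * KK p q (Y x.1 x.2)) := by
      funext x; simp [indicator]
    rw [this]
    refine Measurable.indicator ?_ (measurable_fst measurableSet_Ioc)
    have hm : Measurable (G k i) := (hG k i (Finset.mem_range.1 hi)).mono (H.pb.le _) le_rfl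
    exact (Complex.measurable_ofReal.comp (hm.comp measurable_snd)).mul hK
  · have : (fun x : ℝ × Ω => (Ioc u v).indicator (fun _ => Γ x) x.1) =
      ((Prod.fst : ℝ × Ω → ℝ) ⁻¹' (Ioc u v)).indicator Γ := by
      funext x; simp [indicator]
    rw [this]; exact hΓ.indicator (measurable_fst measurableSet_Ioc)
  · intro k x
    by_cases hx : x.1 ∈ Ioc u v
    · rw [stp_of_mem _ _ hx, norm_mul, Complex.norm_real, Real.norm_eq_abs]
      exact mul_le_mul (hC _ _ _) (KK_bd p q _) (norm_nonneg _) ((abs_nonneg _).trans (hC k 0 x.2))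
    · rw [stp_of_notMem huv _ _ hx]; simpa using hCp k x
  · intro x
    by_cases hx : x.1 ∈ Ioc u v
    · rw [indicator_of_mem hx]; exact hΓC x
    · rw [indicator_of_notMem hx]; simpa using hCp 0 x
  · intro k x hx; exact stp_of_notMem huv _ _ hx
  · intro x hx; exact indicator_of_notMem hx _
  · filter_upwards [hlim] with x hx
    by_cases h : x.1 ∈ Ioc u v
    · rw [indicator_of_mem h]; simp only [stp_of_mem _ _ h]; exact hx h
    · rw [indicator_of_notMem h]; simp only [stp_of_notMem huv _ _ h]; exact tendsto_const_nhds

/-- Lemma N -/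
lemma Core.lemN (H : Core μ F B₁ B₂ Y ρ σ lam y) {p q : ℂ} {I : ℝ → Ω → ℝ} (hI : SI μ B₁ B₂ Y p q I) {u v : ℝ} (hu : 0 ≤ u) (huv : u ≤ v)
    {ν : ℕ → ℕ} {G : ℕ → ℕ → Ω → ℝ} (hG : ∀ k, ∀ i < 2 ^ (ν k), Measurable[F (gr u v (ν k) i)] (G k i)) {C : ℝ} (hC : ∀ k i ω, |G k i ω| ≤ C)
    {Γ : ℝ × Ω → ℂ} (hΓ : Measurable Γ) (hΓC : ∀ x, ‖Γ x‖ ≤ C * (‖p‖ + ‖q‖))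
    (hlim : ∀ᵐ x ∂((volume : Measure ℝ).prod μ), x.1 ∈ Ioc u v → Tendsto (fun k => (G k (idx u v (ν k) x.1) x.2 : ℂ) * KK p q (Y x.1 x.2)) atTop (nhds (Γ x)))
    {J : Ω → ℝ} (hJ : Ito μ F B₁ B₂ (fun x => (Ioc u v).indicator (fun _ => Γ x) x.1) J) :
    TendstoInMeasure μ (fun k ω => ∑ i ∈ Finset.range (2 ^ (ν k)), G k i ω * (I (gr u v (ν k) (i + 1)) ω - I (gr u v (ν k) i) ω)) atTop J := by
  obtain ⟨h1, h2⟩ := H.lemN_aux hI hu huv hG hC hΓ hΓC hlim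
  exact Ito.tendsto H.pb h1 hJ h2

lemma Core.lemN' (H : Core μ F B₁ B₂ Y ρ σ lam y) {p q : ℂ} {I : ℝ → Ω → ℝ} (hI : SI μ B₁ B₂ Y p q I) {u v : ℝ} (hu : 0 ≤ u) (huv : u ≤ v)
    {ν : ℕ → ℕ} {G : ℕ → ℕ → Ω → ℝ} (hG : ∀ k, ∀ i < 2 ^ (ν k), Measurable[F (gr u v (ν k) i)] (G k i)) {C : ℝ} (hC : ∀ k i ω, |G k i ω| ≤ C)
    {Γ : ℝ × Ω → ℂ} (hΓ : Measurable Γ) (hΓC : ∀ x, ‖Γ x‖ ≤ C * (‖p‖ + ‖q‖))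
    (hlim : ∀ᵐ x ∂((volume : Measure ℝ).prod μ), x.1 ∈ Ioc u v → Tendsto (fun k => (G k (idx u v (ν k) x.1) x.2 : ℂ) * KK p q (Y x.1 x.2)) atTop (nhds (Γ x)))
    {J : Ω → ℝ} (hJ : TendstoInMeasure μ (fun k ω => ∑ i ∈ Finset.range (2 ^ (ν k)), G k i ω * (I (gr u v (ν k) (i + 1)) ω - I (gr u v (ν k) i) ω)) atTop J) :
    Ito μ F B₁ B₂ (fun x => (Ioc u v).indicator (fun _ => Γ x) x.1) J := by
  obtain ⟨h1, h2⟩ := H.lemN_aux hI hu huv hG hC hΓ hΓC hlim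
  have : (fun x : ℝ × Ω => (Ioc u v).indicator (fun _ => Γ x) x.1) =
      ((Prod.fst : ℝ × Ω → ℝ) ⁻¹' (Ioc u v)).indicator Γ := by
      funext x; simp [indicator]
  refine Ito.closure H.pb h1 ?_ h2 hJ
  refine memLp_prod_bdd (C := C * (‖p‖ + ‖q‖)) (u := u) (v := v) ?_ ?_ ?_
  · rw [this]; exact hΓ.indicator (measurable_fst measurableSet_Ioc)
  · intro x
    by_cases hx : x.1 ∈ Ioc u v
    · rw [indicator_of_mem hx]; exact hΓC x
    · rw [indicator_of_notMem hx]; simpa using (norm_nonneg _).trans (hΓC x)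
  · intro x hx; exact indicator_of_notMem hx _

end grid


section conseq
variable {μ : Measure Ω} [IsProbabilityMeasure μ] {F : ℝ → MeasurableSpace Ω} {B₁ B₂ Y : ℝ → Ω → ℝ} {ρ σ lam y : ℝ}

lemma Core.SI_meas (H : Core μ F B₁ B₂ Y ρ σ lam y) {p q : ℂ} {I : ℝ → Ω → ℝ} (hI : SI μ B₁ B₂ Y p q I) {t : ℝ} (ht : 0 ≤ t) :
    Measurable[F t] (I t) :=
  (H.nullC ht).lim_measure (fun n => H.ksum_meas p q le_rfl ht n) (hI t ht)

lemma SI.lin {p q p' q' : ℂ} {I J : ℝ → Ω → ℝ} (hI : SI μ B₁ B₂ Y p q I) (hJ : SI μ B₁ B₂ Y p' q' J) (a b : ℝ) :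
    SI μ B₁ B₂ Y (a * p + b * p') (a * q + b * q') (fun t ω => a * I t ω + b * J t ω) := by
  intro t ht
  refine (tim_lin a b (hI t ht) (hJ t ht)).congr_left fun n => Eventually.of_forall fun ω => ?_
  simp only [ksum, Finset.mul_sum, ← Finset.sum_add_distrib]
  refine Finset.sum_congr rfl fun i _ => ?_
  unfold KK; split_ifs <;> simp [dB] <;> ring

lemma SI.unique {p q : ℂ} {I J : ℝ → Ω → ℝ} (hI : SI μ B₁ B₂ Y p q I) (hJ : SI μ B₁ B₂ Y p q J) {t : ℝ} (ht : 0 ≤ t) : I t =ᵐ[μ] J t :=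
  tendstoInMeasure_ae_unique (hI t ht) (hJ t ht)

lemma Core.SI_cf (H : Core μ F B₁ B₂ Y ρ σ lam y) {p q : ℂ} {I : ℝ → Ω → ℝ} (hI : SI μ B₁ B₂ Y p q I) {r : ℝ}
    (hp : Complex.normSq p = r) (hq : Complex.normSq q = r) {s t : ℝ} (hs : 0 ≤ s) (hst : s ≤ t)
    {Z : Ω → ℂ} (hZ : Measurable[F s] Z) {C : ℝ} (hZC : ∀ ω, ‖Z ω‖ ≤ C) :
    ∫ ω, Z ω * Complex.exp (Complex.I * ((I t ω - I s ω : ℝ) : ℂ)) ∂μ = Complex.exp ((-(r * (t - s) / 2) : ℝ) : ℂ) * ∫ ω, Z ω ∂μ := by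
  have lim := tim_cexp (hZ.mono (H.pb.le s) le_rfl) C hZC
    (fun n => (H.ksum_meas p q hs hst n).mono (H.pb.le t) le_rfl) (H.lim_SI hI hs hst)
  refine tendsto_nhds_unique lim (tendsto_const_nhds.congr fun n => ?_)
  have tv := two_valued H.pb (gr_mono hst n) (by rw [gr_zero]; exact hs) (c := fun i ω => KK p q (Y (gr s t n i) ω)) 0 (2 ^ n) (Nat.zero_le _)
    (fun i _ _ => H.Km p q (hs.trans (gr_ge hst n i))) (α := fun _ => p) (β := fun _ => q)
    (fun i ω => KK_or p q _) (r := fun _ => r) (fun _ => hp) (fun _ => hq) (by rw [gr_zero]; exact hZ) hZC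
  have e3 : (∑ i ∈ Finset.Ico 0 (2 ^ n), r * (gr s t n (i + 1) - gr s t n i) / 2) = r * (t - s) / 2 := by
    simp only [gr_step]
    rw [Finset.sum_const, Nat.card_Ico, nsmul_eq_mul]; push_cast; field_simp
    simp only [Nat.sub_zero]; push_cast; ring
  rw [e3] at tv
  rw [← tv]
  simp only [ksum, Finset.range_eq_Ico]

lemma Core.SI_PB (H : Core μ F B₁ B₂ Y ρ σ lam y) {W₁ W₂ : ℝ → Ω → ℝ} (h1 : SI μ B₁ B₂ Y 1 (-Complex.I) W₁) (h2 : SI μ B₁ B₂ Y (-Complex.I) 1 W₂) :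
    PB μ F W₁ W₂ where
  le := H.pb.le
  mono := H.pb.mono
  meas₁ := fun t ht => H.SI_meas h1 ht
  meas₂ := fun t ht => H.SI_meas h2 ht
  cf := by
    intro s t hs hst a b Z hZ C hC
    have := H.SI_cf (h1.lin h2 a b) (r := a ^ 2 + b ^ 2) (by rw [Complex.normSq_apply]; simp; ring) (by rw [Complex.normSq_apply]; simp; ring) hs hst hZ hC
    rw [← this]
    congr 1; funext ω; congr 4; ring

lemma KK_psgn (p q : ℂ) (a : ℝ) : (psgn a : ℂ) * KK p q a = KK p (-q) a := by
  unfold psgn KK; split_ifs <;> simp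

lemma Core.psgn_lim (H : Core μ F B₁ B₂ Y ρ σ lam y) {u v : ℝ} (hu : 0 ≤ u) {ν : ℕ → ℕ} (hν : Tendsto ν atTop atTop) :
    ∀ᵐ x ∂((volume : Measure ℝ).prod μ), x.1 ∈ Ioc u v →
      Tendsto (fun k => psgn (Y (gr u v (ν k) (idx u v (ν k) x.1)) x.2)) atTop (nhds (psgn (Y x.1 x.2))) := by
  filter_upwards [H.ne_zero_ae] with x hx hm
  have h0 := hx (hu.trans_lt hm.1)
  exact (psgn_cont h0).tendsto.comp (((H.cont x.2).tendsto x.1).comp (gr_idx_tendsto hm hν))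

lemma Core.psgn_lim' (H : Core μ F B₁ B₂ Y ρ σ lam y) (p q : ℂ) {u v : ℝ} (hu : 0 ≤ u) {ν : ℕ → ℕ} (hν : Tendsto ν atTop atTop) :
    ∀ᵐ x ∂((volume : Measure ℝ).prod μ), x.1 ∈ Ioc u v →
      Tendsto (fun k => (psgn (Y (gr u v (ν k) (idx u v (ν k) x.1)) x.2) : ℂ) * KK p q (Y x.1 x.2)) atTop (nhds (KK p (-q) (Y x.1 x.2))) := by
  filter_upwards [H.psgn_lim (v := v) hu hν] with x hx hm
  rw [← KK_psgn]
  exact ((Complex.continuous_ofReal.tendsto _).comp (hx hm)).mul_const _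

lemma Core.psgnm (H : Core μ F B₁ B₂ Y ρ σ lam y) {t : ℝ} (ht : 0 ≤ t) : Measurable[F t] fun ω => psgn (Y t ω) :=
  psgn_meas.comp (H.meas t ht)

lemma Core.lim_psgn (H : Core μ F B₁ B₂ Y ρ σ lam y) {p q : ℂ} {I J : ℝ → Ω → ℝ} (hI : SI μ B₁ B₂ Y p q I) (hJ : SI μ B₁ B₂ Y p (-q) J)
    {u v : ℝ} (hu : 0 ≤ u) (huv : u ≤ v) :
    TendstoInMeasure μ (fun k ω => ∑ i ∈ Finset.range (2 ^ k), psgn (Y (gr u v k i) ω) * (I (gr u v k (i + 1)) ω - I (gr u v k i) ω)) atTop (fun ω => J v ω - J u ω) :=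
  H.lemN hI hu huv (ν := id) (G := fun k i ω => psgn (Y (gr u v k i) ω)) (C := 1) (fun k i _ => H.psgnm (hu.trans (gr_ge huv k i)))
    (fun k i ω => (psgn_abs _).le) ((KK_meas p (-q)).comp H.jm) (fun x => by
      have := KK_bd p (-q) (Y x.1 x.2); rw [norm_neg] at this; simpa using this) (H.psgn_lim' p q hu tendsto_id) (H.ito_SI hJ hu huv)

/-- integrals of psgn against a sign integral are sign integrals -/
lemma Core.SI_psgn (H : Core μ F B₁ B₂ Y ρ σ lam y) {p q : ℂ} {I J : ℝ → Ω → ℝ} (hI : SI μ B₁ B₂ Y p q I)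
    (hJ : ∀ t, 0 ≤ t → TendstoInMeasure μ (fun n => rsum (fun s ω => psgn (Y s ω)) I t n) atTop (J t)) : SI μ B₁ B₂ Y p (-q) J := by
  intro t ht
  have h1 := H.lemN' hI le_rfl ht (ν := id) (G := fun k i ω => psgn (Y (gr 0 t k i) ω)) (C := 1) (fun k i _ => H.psgnm (gr_ge ht k i))
    (fun k i ω => (psgn_abs _).le) ((KK_meas p (-q)).comp H.jm) (fun x => by
      have := KK_bd p (-q) (Y x.1 x.2); rw [norm_neg] at this; simpa using this) (H.psgn_lim' p q le_rfl tendsto_id) (J := J t) (by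
      refine (hJ t ht).congr_left fun n => Eventually.of_forall fun ω => ?_
      simp only [rsum, gr_0, id]; push_cast; rfl)
  exact lim_of_ito H.pb le_rfl ht (ν := id) (c := fun k i ω => KK p (-q) (Y (gr 0 t k i) ω))
      (fun k i _ => H.Km p (-q) (gr_ge ht k i)) (fun k i ω => KK_bd p (-q) _) ((KK_meas p (-q)).comp H.jm) (fun x => KK_bd p (-q) _)
      (H.KK_lim p (-q) le_rfl tendsto_id) h1

lemma SI.neg {p q : ℂ} {I : ℝ → Ω → ℝ} (hI : SI μ B₁ B₂ Y p q I) : SI μ B₁ B₂ Y (-p) (-q) (fun t ω => -I t ω) := by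
  have := hI.lin hI (-1) 0
  simpa using this

end conseq


section euler

def eul (lam y Δ : ℝ) (mm : ℕ → ℝ) : ℕ → ℝ
  | 0 => y
  | k + 1 => eul lam y Δ mm k - lam * psgn (eul lam y Δ mm k) * Δ + mm k

lemma psgn_mono (a b : ℝ) : 0 ≤ (a - b) * (psgn a - psgn b) := by
  unfold psgn; split_ifs <;> nlinarith

lemma psgn_diff (a b : ℝ) : |psgn a - psgn b| ≤ 2 := by
  unfold psgn; split_ifs <;> norm_num

lemma euler_bound {lam Δ δ η y : ℝ} (hl : 0 ≤ lam) (hΔ : 0 ≤ Δ) (f : ℝ → ℝ) (hf : Continuous f) (mm : ℕ → ℝ) (N : ℕ) 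
    (hη : ∀ k ≤ N, |(∑ i ∈ Finset.range k, mm i) - (f (k * Δ) - y + lam * ∫ s in (0:ℝ)..(k * Δ), psgn (f s))| ≤ η)
    (hδ : ∀ k < N, ∀ s ∈ Icc (k * Δ) (((k + 1 : ℕ) : ℝ) * Δ), |f s - f (k * Δ)| ≤ δ) :
    ∀ k ≤ N, |eul lam y Δ mm k - f (k * Δ)| ≤ √(k * (4 * lam * Δ * (δ + η) + 4 * lam ^ 2 * Δ ^ 2)) + η := by
  set e : ℕ → ℝ := fun k => (eul lam y Δ mm k - ∑ i ∈ Finset.range k, mm i) - (y - lam * ∫ s in (0:ℝ)..(k * Δ), psgn (f s)) with he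
  have main : ∀ k ≤ N, e k ^ 2 ≤ k * (4 * lam * Δ * (δ + η) + 4 * lam ^ 2 * Δ ^ 2) := by
    intro k
    induction k with
    | zero => intro _; simp [he, eul]
    | succ k ih =>
      intro hk
      have ih := ih (by omega)
      have hη' := hη k (by omega)
      have hδ' := hδ k (by omega)
      have hle : (k : ℝ) * Δ ≤ ((k + 1 : ℕ) : ℝ) * Δ := by push_cast; nlinarith
      have hintg : ∀ a b, IntervalIntegrable (fun s => psgn (f s)) volume a b := psgn_intervalIntegrable hf
      set z := eul lam y Δ mm k with hz
      set D : ℝ := ∫ s in (k * Δ)..(((k + 1 : ℕ) : ℝ) * Δ), (psgn z - psgn (f s)) with hD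
      have hstep : e (k + 1) = e k - lam * D := by
        have h1 : (∫ s in (0:ℝ)..(((k + 1 : ℕ) : ℝ) * Δ), psgn (f s)) = (∫ s in (0:ℝ)..(k * Δ), psgn (f s)) + ∫ s in (k * Δ)..(((k + 1 : ℕ) : ℝ) * Δ), psgn (f s) :=
          (intervalIntegral.integral_add_adjacent_intervals (hintg _ _) (hintg _ _)).symm
        have h2 : D = psgn z * Δ - ∫ s in (k * Δ)..(((k + 1 : ℕ) : ℝ) * Δ), psgn (f s) := by
          rw [hD, intervalIntegral.integral_sub intervalIntegrable_const (hintg _ _), intervalIntegral.integral_const]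
          push_cast; simp only [smul_eq_mul]; ring
        simp only [he]
        rw [h1, h2, Finset.sum_range_succ]
        simp only [eul]
        rw [← hz]; ring
      have hDle : |D| ≤ 2 * Δ := by
        have := intervalIntegral.norm_integral_le_of_norm_le_const (a := k * Δ) (b := ((k + 1 : ℕ) : ℝ) * Δ) (C := 2) (f := fun s => psgn z - psgn (f s))
          (fun x _ => by rw [Real.norm_eq_abs]; exact psgn_diff _ _)
        rw [Real.norm_eq_abs, abs_of_nonneg (sub_nonneg.2 hle)] at this
        refine this.trans (le_of_eq ?_); push_cast; ring
      have heD : -(2 * (δ + η) * Δ) ≤ e k * D := by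
        have h1 : e k * D = ∫ s in (k * Δ)..(((k + 1 : ℕ) : ℝ) * Δ), e k * (psgn z - psgn (f s)) := by
          rw [hD, intervalIntegral.integral_const_mul]
        have h2 : -(2 * (δ + η) * Δ) = ∫ s in (k * Δ)..(((k + 1 : ℕ) : ℝ) * Δ), (-(2 * (δ + η))) := by
          rw [intervalIntegral.integral_const]; push_cast; simp only [smul_eq_mul]; ring
        rw [h1, h2]
        refine intervalIntegral.integral_mono_on hle intervalIntegrable_const ((intervalIntegrable_const.sub (hintg _ _)).const_mul _) ?_
        intro s hs
        have a1 := hδ' s hs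
        have a2 : e k = (z - f s) + ((f s - f (k * Δ)) - ((∑ i ∈ Finset.range k, mm i) - (f (k * Δ) - y + lam * ∫ s in (0:ℝ)..(k * Δ), psgn (f s)))) := by
          simp only [he]; ring
        have a3 := psgn_mono z (f s)
        have a4 := psgn_diff z (f s)
        rw [a2, add_mul]
        set w := ((f s - f (k * Δ)) - ((∑ i ∈ Finset.range k, mm i) - (f (k * Δ) - y + lam * ∫ s in (0:ℝ)..(k * Δ), psgn (f s)))) with hw
        have a5 : |w| ≤ δ + η := (abs_sub _ _).trans (add_le_add a1 hη')
        have a6 : |w * (psgn z - psgn (f s))| ≤ (δ + η) * 2 := by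
          rw [abs_mul]; exact mul_le_mul a5 a4 (abs_nonneg _) ((abs_nonneg _).trans a5)
        have := neg_abs_le (w * (psgn z - psgn (f s)))
        linarith
      rw [hstep]
      have hD2 : D ^ 2 ≤ 4 * Δ ^ 2 := by
        rw [← sq_abs]; calc |D| ^ 2 ≤ (2 * Δ) ^ 2 := by gcongr
          _ = _ := by ring
      push_cast
      nlinarith [mul_le_mul_of_nonneg_left heD hl, mul_le_mul_of_nonneg_left hD2 (sq_nonneg lam)]
  intro k hk
  have h1 := main k hk
  have h2 := hη k hk
  have h3 : |e k| ≤ √(k * (4 * lam * Δ * (δ + η) + 4 * lam ^ 2 * Δ ^ 2)) := by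
    rw [← Real.sqrt_sq_eq_abs]; exact Real.sqrt_le_sqrt h1
  have h4 : eul lam y Δ mm k - f (k * Δ) = e k + ((∑ i ∈ Finset.range k, mm i) - (f (k * Δ) - y + lam * ∫ s in (0:ℝ)..(k * Δ), psgn (f s))) := by
    simp only [he]; ring
  rw [h4]
  exact (abs_add_le _ _).trans (add_le_add h3 h2)

lemma euler_conv {lam y T : ℝ} (hl : 0 ≤ lam) (hT : 0 ≤ T) (f : ℝ → ℝ) (hf : Continuous f) (mm : ℕ → ℕ → ℝ) (η : ℕ → ℝ) (hη0 : Tendsto η atTop (nhds 0))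
    (hη : ∀ n, ∀ k ≤ 2 ^ n, |(∑ i ∈ Finset.range k, mm n i) - (f (gr 0 T n k) - y + lam * ∫ s in (0:ℝ)..(gr 0 T n k), psgn (f s))| ≤ η n) :
    ∀ ε > 0, ∀ᶠ n in atTop, ∀ k ≤ 2 ^ n, |eul lam y (T / 2 ^ n) (mm n) k - f (gr 0 T n k)| ≤ ε := by
  intro ε hε
  have hgr : ∀ n k, gr 0 T n k = k * (T / 2 ^ n) := fun n k => by rw [gr_0]; ring
  have hd0 : Tendsto (fun n : ℕ => T / 2 ^ n) atTop (nhds 0) := by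
    have := (tendsto_pow_atTop_nhds_zero_of_lt_one (r := (1/2 : ℝ)) (by norm_num) (by norm_num)).const_mul T
    simpa [div_eq_mul_inv] using this
  -- function of (δ, η, Δ)
  have hcont : Tendsto (fun x : ℝ × ℝ × ℝ => √(T * (4 * lam * (x.1 + x.2.1) + 4 * lam ^ 2 * x.2.2)) + x.2.1) (nhds (0, 0, 0)) (nhds 0) := by
    have : Continuous (fun x : ℝ × ℝ × ℝ => √(T * (4 * lam * (x.1 + x.2.1) + 4 * lam ^ 2 * x.2.2)) + x.2.1) := by fun_prop
    have := this.tendsto (0, 0, 0); simpa using this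
  obtain ⟨δ, hδ, hδε⟩ : ∃ δ > 0, ∀ a b c : ℝ, |a| ≤ δ → |b| ≤ δ → |c| ≤ δ → √(T * (4 * lam * (a + b) + 4 * lam ^ 2 * c)) + b ≤ ε := by
    rw [Metric.tendsto_nhds_nhds] at hcont
    obtain ⟨δ, hδ, h⟩ := hcont ε hε
    refine ⟨δ / 2, by positivity, fun a b c ha hb hc => ?_⟩
    have := @h (a, b, c) (by
      rw [Prod.dist_eq, Prod.dist_eq]; simp only [Real.dist_eq, sub_zero]
      exact max_lt (by linarith) (max_lt (by linarith) (by linarith)))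
    rw [Real.dist_eq, sub_zero] at this
    exact (le_abs_self _).trans this.le
  have huc : UniformContinuousOn f (Icc 0 T) := isCompact_Icc.uniformContinuousOn_of_continuous hf.continuousOn
  rw [Metric.uniformContinuousOn_iff] at huc
  obtain ⟨θ, hθ, hθf⟩ := huc δ hδ
  have e1 : ∀ᶠ n : ℕ in atTop, |T / 2 ^ n| < min θ δ := by
    have := (Metric.tendsto_nhds.1 hd0) (min θ δ) (lt_min hθ hδ)
    filter_upwards [this] with n hn; rw [Real.dist_eq, sub_zero] at hn; exact hn
  have e2 : ∀ᶠ n in atTop, |η n| ≤ δ := by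
    have := (Metric.tendsto_nhds.1 hη0) δ hδ
    filter_upwards [this] with n hn; rw [Real.dist_eq, sub_zero] at hn; exact hn.le
  filter_upwards [e1, e2] with n h1 h2
  have hΔ : 0 ≤ T / 2 ^ n := by positivity
  have := euler_bound (y := y) (δ := δ) (η := η n) hl hΔ f hf (mm n) (2 ^ n) (fun k hk => by have := hη n k hk; rwa [hgr] at this) (by
    intro k hk s hs
    rw [← hgr] at hs ⊢; rw [← hgr] at hs
    have b1 := gr_ge hT n k
    have b2 := gr_le hT n (k + 1) hk
    have b3 := gr_le hT n k hk.le
    have b4 := gr_step 0 T n k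
    rw [sub_zero] at b4
    have := hθf s ⟨b1.trans hs.1, hs.2.trans b2⟩ (gr 0 T n k) ⟨b1, b3⟩ (by
      rw [Real.dist_eq, abs_of_nonneg (by linarith [hs.1])]
      rw [abs_of_nonneg hΔ] at h1
      linarith [hs.2, min_le_left θ δ])
    rw [Real.dist_eq] at this; exact this.le)
  intro k hk
  have h3 := this k hk
  rw [← hgr] at h3
  refine h3.trans (le_trans ?_ (hδε δ (η n) (T / 2 ^ n) (by rw [abs_of_pos hδ]) h2 (h1.le.trans (min_le_right _ _))))
  refine add_le_add (Real.sqrt_le_sqrt ?_) le_rfl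
  have e3 : (k : ℝ) * (4 * lam * (T / 2 ^ n) * (δ + η n) + 4 * lam ^ 2 * (T / 2 ^ n) ^ 2) = (gr 0 T n k) * (4 * lam * (δ + η n) + 4 * lam ^ 2 * (T / 2 ^ n)) := by
    rw [hgr]; ring
  rw [e3]
  have hηn : 0 ≤ η n := (abs_nonneg _).trans (hη n 0 (Nat.zero_le _))
  refine mul_le_mul_of_nonneg_right (gr_le hT n k hk) (by positivity)

lemma eul_meas {Ω : Type*} {𝒢 : MeasurableSpace Ω} (lam y Δ : ℝ) {mm : ℕ → Ω → ℝ} (k : ℕ) (h : ∀ i < k, Measurable[𝒢] (mm i)) :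
    Measurable[𝒢] fun ω => eul lam y Δ (fun i => mm i ω) k := by
  induction k with
  | zero => exact measurable_const
  | succ k ih =>
    have ih := ih fun i hi => h i (by omega)
    simp only [eul]
    exact (ih.sub (((psgn_meas.comp ih).const_mul lam).mul_const Δ)).add (h k (by omega))

end euler


section adapt

/-- all variables of a process on `[0,T]` are `𝒢`-measurable -/
def Ad {Ω : Type*} (𝒢 : MeasurableSpace Ω) (T : ℝ) (P : ℝ → Ω → ℝ) : Prop := ∀ s ∈ Icc (0:ℝ) T, Measurable[𝒢] (P s)

lemma Ad.lin {Ω : Type*} {𝒢 : MeasurableSpace Ω} {T : ℝ} {P Q : ℝ → Ω → ℝ} (hP : Ad 𝒢 T P) (hQ : Ad 𝒢 T Q) (a b : ℝ) :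
    Ad 𝒢 T (fun t ω => a * P t ω + b * Q t ω) := fun s hs => ((hP s hs).const_mul a).add ((hQ s hs).const_mul b)

lemma Ad.congr {Ω : Type*} {𝒢 : MeasurableSpace Ω} [m : MeasurableSpace Ω] {μ : Measure Ω} (h𝒢 : NullC μ 𝒢) {T : ℝ} {P Q : ℝ → Ω → ℝ}
    (hP : Ad 𝒢 T P) (h : ∀ t, 0 ≤ t → P t =ᵐ[μ] Q t) : Ad 𝒢 T Q := fun s hs => h𝒢.congr (hP s hs) (h s hs.1)

variable {Ω : Type*} {𝒢 : MeasurableSpace Ω} [m : MeasurableSpace Ω]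
variable {μ : Measure Ω} [IsProbabilityMeasure μ] {F : ℝ → MeasurableSpace Ω} {B₁ B₂ Y : ℝ → Ω → ℝ} {ρ σ lam y : ℝ}

lemma SI.zero {p q : ℂ} {I : ℝ → Ω → ℝ} (hI : SI μ B₁ B₂ Y p q I) : ∀ᵐ ω ∂μ, I 0 ω = 0 := by
  refine tendstoInMeasure_ae_unique (hI 0 le_rfl) ?_
  have : (fun n => ksum B₁ B₂ Y p q 0 0 n) = fun _ : ℕ => fun _ : Ω => (0:ℝ) := by
    funext n ω; simp [ksum, dB, gr]
  rw [this]; exact tim_const _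

lemma Core.Y0 (H : Core μ F B₁ B₂ Y ρ σ lam y) : ∀ᵐ ω ∂μ, Y 0 ω = y := by
  filter_upwards [H.W.zero] with ω hω
  simp only [WW, AA, intervalIntegral.integral_same] at hω; linarith

lemma Core.ad_Y (H : Core μ F B₁ B₂ Y ρ σ lam y) (h𝒢 : NullC μ 𝒢) {T : ℝ} (hW : Ad 𝒢 T (WW Y lam y)) : Ad 𝒢 T Y := by
  intro t ht
  refine h𝒢.lim_ae (f := fun n ω => eul lam y (t / 2 ^ n) (fun i => WW Y lam y (gr 0 t n (i + 1)) ω - WW Y lam y (gr 0 t n i) ω) (2 ^ n)) ?_ ?_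
  · intro n
    refine eul_meas lam y (t / 2 ^ n) (mm := fun i ω => WW Y lam y (gr 0 t n (i + 1)) ω - WW Y lam y (gr 0 t n i) ω) (2 ^ n) fun i hi => ?_
    exact (hW _ ⟨gr_ge ht.1 _ _, (gr_le ht.1 _ _ hi).trans ht.2⟩).sub (hW _ ⟨gr_ge ht.1 _ _, (gr_le ht.1 _ _ hi.le).trans ht.2⟩)
  · filter_upwards [H.W.zero] with ω hω
    have := euler_conv (y := y) H.lam_pos.le ht.1 (fun s => Y s ω) (H.cont ω) (fun n i => WW Y lam y (gr 0 t n (i + 1)) ω - WW Y lam y (gr 0 t n i) ω) (fun _ => 0)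
      tendsto_const_nhds (by
        intro n k hk
        rw [Finset.sum_range_sub (fun i => WW Y lam y (gr 0 t n i) ω), gr_zero, hω]
        simp [WW, AA])
    rw [Metric.tendsto_nhds]
    intro ε hε
    filter_upwards [this (ε / 2) (by positivity)] with n hn
    have := hn (2 ^ n) le_rfl
    rw [gr_last] at this
    rw [Real.dist_eq]; linarith

lemma Core.ad_W (H : Core μ F B₁ B₂ Y ρ σ lam y) {T : ℝ} (hY : Ad 𝒢 T Y) : Ad 𝒢 T (WW Y lam y) := fun s hs =>
  ((hY s hs).sub_const y).add ((AA_meas H.cont hs.1 fun r hr => hY r ⟨hr.1, hr.2.trans hs.2⟩).const_mul lam)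

lemma Core.ad_psgn (H : Core μ F B₁ B₂ Y ρ σ lam y) (h𝒢 : NullC μ 𝒢) {T : ℝ} {p q : ℂ} {I J : ℝ → Ω → ℝ} (hI : SI μ B₁ B₂ Y p q I)
    (hJ : SI μ B₁ B₂ Y p (-q) J) (hY : Ad 𝒢 T Y) (hIa : Ad 𝒢 T I) : Ad 𝒢 T J := by
  intro t ht
  have h1 : Measurable[𝒢] (fun ω => J t ω - J 0 ω) := h𝒢.lim_measure (fun n => by
    refine Finset.measurable_fun_sum _ fun i hi => ?_
    have hi := Finset.mem_range.1 hi
    have a1 : gr 0 t n i ∈ Icc 0 T := ⟨gr_ge ht.1 _ _, (gr_le ht.1 _ _ hi.le).trans ht.2⟩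
    have a2 : gr 0 t n (i + 1) ∈ Icc 0 T := ⟨gr_ge ht.1 _ _, (gr_le ht.1 _ _ hi).trans ht.2⟩
    exact (psgn_meas.comp (hY _ a1)).mul ((hIa _ a2).sub (hIa _ a1))) (H.lim_psgn hI hJ le_rfl ht.1)
  refine h𝒢.congr h1 ?_
  filter_upwards [hJ.zero] with ω hω
  rw [hω, sub_zero]

lemma psgn_same {a b c : ℝ} (ha : c < |a|) (hab : |b - a| ≤ c) (hc : 0 ≤ c) : psgn b = psgn a ∧ b ≠ 0 := by
  unfold psgn
  rcases le_total 0 a with h | h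
  · rw [abs_of_nonneg h] at ha
    have := abs_le.1 hab
    have hb : 0 < b := by linarith
    rw [if_pos hb, if_pos (by linarith)]; exact ⟨rfl, hb.ne'⟩
  · rw [abs_of_nonpos h] at ha
    have := abs_le.1 hab
    have hb : b < 0 := by linarith
    rw [if_neg (by linarith), if_neg (by linarith)]; exact ⟨rfl, hb.ne⟩

lemma psgn_mul_self (a : ℝ) : psgn a * a = |a| := by
  unfold psgn; split_ifs with h
  · rw [abs_of_pos h, one_mul]
  · rw [abs_of_nonpos (not_lt.1 h)]; ring

lemma psgn_sq (a : ℝ) : psgn a * psgn a = 1 := by unfold psgn; split_ifs <;> norm_num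

/-- on an interval where the path has constant sign the increments are explicit -/
lemma sign_step (hY : ∀ ω, Continuous fun t => Y t ω) {s t : ℝ} (hst : s ≤ t) (ω : Ω) (h : ∀ r ∈ Icc s t, psgn (Y r ω) = psgn (Y s ω)) :
    psgn (Y s ω) * (WW Y lam y t ω - WW Y lam y s ω) = |Y t ω| - |Y s ω| + lam * (t - s) := by
  have h1 : AA Y t ω - AA Y s ω = psgn (Y s ω) * (t - s) := by
    rw [AA_sub hY]
    rw [intervalIntegral.integral_congr (g := fun _ => psgn (Y s ω)) (by
      intro r hr; rw [uIcc_of_le hst] at hr; exact h r hr)]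
    simp [mul_comm]
  have h2 := psgn_mul_self (Y t ω)
  rw [h t ⟨hst, le_rfl⟩] at h2
  have h3 := psgn_mul_self (Y s ω)
  have h4 := psgn_sq (Y s ω)
  have : WW Y lam y t ω - WW Y lam y s ω = Y t ω - Y s ω + lam * (AA Y t ω - AA Y s ω) := by simp only [WW]; ring
  rw [this, h1]
  linear_combination h2 - h3 + lam * (t - s) * h4

lemma unif_osc {f : ℝ → ℝ} (hf : Continuous f) {t : ℝ} (ht : 0 ≤ t) {ε : ℝ} (hε : 0 < ε) :
    ∀ᶠ n in atTop, ∀ i < 2 ^ n, ∀ r ∈ Icc (gr 0 t n i) (gr 0 t n (i + 1)), |f r - f (gr 0 t n i)| ≤ ε := by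
  have huc : UniformContinuousOn f (Icc 0 t) := isCompact_Icc.uniformContinuousOn_of_continuous hf.continuousOn
  rw [Metric.uniformContinuousOn_iff] at huc
  obtain ⟨θ, hθ, hθf⟩ := huc ε hε
  have hd0 : Tendsto (fun n : ℕ => t / 2 ^ n) atTop (nhds 0) := by
    have := (tendsto_pow_atTop_nhds_zero_of_lt_one (r := (1/2 : ℝ)) (by norm_num) (by norm_num)).const_mul t
    simpa [div_eq_mul_inv] using this
  filter_upwards [(Metric.tendsto_nhds.1 hd0) θ hθ] with n hn i hi r hr
  rw [Real.dist_eq, sub_zero] at hn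
  have b4 := gr_step 0 t n i
  rw [sub_zero] at b4
  have := hθf r ⟨(gr_ge ht n i).trans hr.1, hr.2.trans (gr_le ht n (i + 1) hi)⟩ (gr 0 t n i) ⟨gr_ge ht n i, gr_le ht n i hi.le⟩ (by
    rw [Real.dist_eq, abs_of_nonneg (by linarith [hr.1])]
    linarith [hr.2, le_abs_self (t / 2 ^ n)])
  rw [Real.dist_eq] at this; exact this.le

end adapt


section adapt2

variable {Ω : Type*} {𝒢 : MeasurableSpace Ω} [m : MeasurableSpace Ω]
variable {μ : Measure Ω} [IsProbabilityMeasure μ] {F : ℝ → MeasurableSpace Ω} {B₁ B₂ Y : ℝ → Ω → ℝ} {ρ σ lam y : ℝ}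

/-- `V♭` is adapted to `|Y|` -/
lemma Core.ad_Vfl (H : Core μ F B₁ B₂ Y ρ σ lam y) (h𝒢 : NullC μ 𝒢) {T : ℝ} {J : ℝ → Ω → ℝ}
    (hJ : SI μ B₁ B₂ Y (ρ - σ * Complex.I) (-(σ - ρ * Complex.I)) J) (hY : Ad 𝒢 T (fun t ω => |Y t ω|)) : Ad 𝒢 T J := by
  intro t ht
  set p : ℂ := ρ - σ * Complex.I with hp
  set q : ℂ := σ - ρ * Complex.I with hq
  let c : ℕ → ℝ := fun k => 1 / ((k : ℝ) + 1)
  have hc : ∀ k, 0 < c k := fun k => by positivity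
  have hc0 : Tendsto c atTop (nhds 0) := tendsto_one_div_add_atTop_nhds_zero_nat
  let Hc : ℕ → ℝ → ℝ := fun k a => if c k < |a| then psgn a else 0
  have hHm : ∀ k, Measurable (Hc k) := fun k => Measurable.ite (measurableSet_lt measurable_const measurable_id.abs) psgn_meas measurable_const
  have hHb : ∀ k a, |Hc k a| ≤ 1 := fun k a => by
    simp only [Hc]; split_ifs
    · exact (psgn_abs a).le
    · simp
  let S : ℕ → ℕ → Ω → ℝ := fun n k ω => ∑ i ∈ Finset.range (2 ^ n), Hc k (Y (gr 0 t n i) ω) * (WW Y lam y (gr 0 t n (i + 1)) ω - WW Y lam y (gr 0 t n i) ω)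
  let S' : ℕ → ℕ → Ω → ℝ := fun n k ω => ∑ i ∈ Finset.range (2 ^ n), if c k < |Y (gr 0 t n i) ω| then
    (|Y (gr 0 t n (i + 1)) ω| - |Y (gr 0 t n i) ω| + lam * (gr 0 t n (i + 1) - gr 0 t n i)) else 0
  have hmem : ∀ n i, i < 2 ^ n → gr 0 t n i ∈ Icc 0 T ∧ gr 0 t n (i + 1) ∈ Icc 0 T := fun n i hi =>
    ⟨⟨gr_ge ht.1 _ _, (gr_le ht.1 _ _ hi.le).trans ht.2⟩, ⟨gr_ge ht.1 _ _, (gr_le ht.1 _ _ hi).trans ht.2⟩⟩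
  have hS'm : ∀ n k, Measurable[𝒢] (S' n k) := by
    intro n k
    refine Finset.measurable_fun_sum _ fun i hi => ?_
    obtain ⟨a1, a2⟩ := hmem n i (Finset.mem_range.1 hi)
    have b1 := hY _ a1
    have b2 := hY _ a2
    exact Measurable.ite (measurableSet_lt measurable_const b1) ((b2.sub b1).add measurable_const) measurable_const
  have hSm : ∀ n k, Measurable (S n k) := by
    intro n k
    refine Finset.measurable_fun_sum _ fun i hi => ?_
    obtain ⟨a1, a2⟩ := hmem n i (Finset.mem_range.1 hi)
    exact ((hHm k).comp (H.measm _)).mul (((H.WWm a2.1).mono (H.pb.le _) le_rfl).sub ((H.WWm a1.1).mono (H.pb.le _) le_rfl))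
  have hS'm' : ∀ n k, Measurable (S' n k) := by
    intro n k
    refine Finset.measurable_fun_sum _ fun i hi => ?_
    have b1 := (H.measm (gr 0 t n i)).abs
    have b2 := (H.measm (gr 0 t n (i + 1))).abs
    exact Measurable.ite (measurableSet_lt measurable_const b1) ((b2.sub b1).add measurable_const) measurable_const
  have heq : ∀ k ω, ∀ᶠ n in atTop, S n k ω = S' n k ω := by
    intro k ω
    filter_upwards [unif_osc (H.cont ω) ht.1 (hc k)] with n hn
    refine Finset.sum_congr rfl fun i hi => ?_
    have hi := Finset.mem_range.1 hi
    simp only [Hc]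
    split_ifs with h
    · exact sign_step H.cont (gr_mono ht.1 n (Nat.le_succ i)) ω fun r hr => (psgn_same h (hn i hi r hr) (hc k).le).1
    · rw [zero_mul]
  have hD : ∀ k, TendstoInMeasure μ (fun n ω => S n k ω - S' n k ω) atTop (fun _ => 0) := by
    intro k
    refine tendstoInMeasure_of_tendsto_ae (fun n => ((hSm n k).sub (hS'm' n k)).aestronglyMeasurable) (Eventually.of_forall fun ω => ?_)
    refine tendsto_const_nhds.congr' ?_
    filter_upwards [heq k ω] with n hn
    rw [hn, sub_self]
  have hch : ∀ k : ℕ, ∃ n ≥ k, μ {ω | c k ≤ |S n k ω - S' n k ω|} ≤ ENNReal.ofReal (c k) := by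
    intro k
    have := (tendstoInMeasure_iff_norm.1 (hD k)) (c k) (hc k)
    have h1 := this.eventually_le_const (u := ENNReal.ofReal (c k)) (by simpa using hc k)
    obtain ⟨n, hn, hn'⟩ := (h1.and (eventually_ge_atTop k)).exists
    refine ⟨n, hn', ?_⟩
    simpa [Real.norm_eq_abs] using hn
  choose ν hνge hν using hch
  have hν0 : Tendsto ν atTop atTop := tendsto_atTop_mono hνge tendsto_id
  have hSlim : TendstoInMeasure μ (fun k => S (ν k) k) atTop (fun ω => J t ω - J 0 ω) := by
    refine H.lemN H.W le_rfl ht.1 (ν := ν) (G := fun k i ω => Hc k (Y (gr 0 t (ν k) i) ω)) (C := 1) (fun k i _ => (hHm k).comp (H.meas _ (gr_ge ht.1 _ i)))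
      (fun k i ω => hHb _ _) ((KK_meas p (-q)).comp H.jm) (fun x => by
        have := KK_bd p (-q) (Y x.1 x.2); rw [norm_neg] at this; simpa using this) ?_ (H.ito_SI hJ le_rfl ht.1)
    filter_upwards [H.ne_zero_ae] with x hx hm
    have h0 := hx hm.1
    have l1 : Tendsto (fun k => Y (gr 0 t (ν k) (idx 0 t (ν k) x.1)) x.2) atTop (nhds (Y x.1 x.2)) :=
      ((H.cont x.2).tendsto x.1).comp (gr_idx_tendsto hm hν0)
    have l2 := (psgn_cont h0).tendsto.comp l1
    have l3 : ∀ᶠ k in atTop, c k < |Y (gr 0 t (ν k) (idx 0 t (ν k) x.1)) x.2| :=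
      hc0.eventually_lt l1.abs (abs_pos.2 h0)
    have l4 : Tendsto (fun k => Hc k (Y (gr 0 t (ν k) (idx 0 t (ν k) x.1)) x.2)) atTop (nhds (psgn (Y x.1 x.2))) := by
      refine l2.congr' ?_
      filter_upwards [l3] with k hk
      simp only [Hc, if_pos hk, Function.comp]
    have := ((Complex.continuous_ofReal.tendsto _).comp l4).mul_const (KK p q (Y x.1 x.2))
    rw [KK_psgn] at this
    exact this
  have hS'lim : TendstoInMeasure μ (fun k => S' (ν k) k) atTop (fun ω => J t ω - J 0 ω) := by
    have hdiff : TendstoInMeasure μ (fun k ω => S (ν k) k ω - S' (ν k) k ω) atTop (fun _ => 0) := by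
      rw [tendstoInMeasure_iff_norm]
      intro ε hε
      have z : Tendsto (fun k => ENNReal.ofReal (c k)) atTop (nhds 0) := by
        have := (ENNReal.continuous_ofReal.tendsto 0).comp hc0; rw [ENNReal.ofReal_zero] at this; exact this
      refine tendsto_of_tendsto_of_tendsto_of_le_of_le' tendsto_const_nhds z (Eventually.of_forall fun _ => zero_le) ?_
      filter_upwards [hc0.eventually_lt_const hε] with k hk
      refine (measure_mono fun ω hω => ?_).trans (hν k)
      simp only [Set.mem_ofPred_eq, sub_zero, Real.norm_eq_abs] at hω ⊢
      exact hk.le.trans hω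
    have := tim_lin 1 (-1) hSlim hdiff
    refine (this.congr_left fun k => Eventually.of_forall fun ω => ?_).congr_right (Eventually.of_forall fun ω => ?_)
    · simp
    · simp
  refine h𝒢.congr (h𝒢.lim_measure (fun k => hS'm (ν k) k) hS'lim) ?_
  filter_upwards [hJ.zero] with ω hω
  rw [hω, sub_zero]

lemma tanaka_step (a b : ℝ) : psgn a * (b - a) ≤ |b| - |a| := by
  have := psgn_mul_self a
  have h2 : psgn a * b ≤ |b| := by
    calc psgn a * b ≤ |psgn a * b| := le_abs_self _
      _ = |b| := by rw [abs_mul, psgn_abs, one_mul]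
  linarith

lemma Core.K_mono (H : Core μ F B₁ B₂ Y ρ σ lam y) {J : ℝ → Ω → ℝ}
    (hJ : SI μ B₁ B₂ Y (ρ - σ * Complex.I) (-(σ - ρ * Complex.I)) J) {s t : ℝ} (hs : 0 ≤ s) (hst : s ≤ t) :
    ∀ᵐ ω ∂μ, J t ω - J s ω ≤ |Y t ω| - |Y s ω| + lam * (t - s) ∧
      ((∀ r ∈ Icc s t, Y r ω ≠ 0) → J t ω - J s ω = |Y t ω| - |Y s ω| + lam * (t - s)) := by
  obtain ⟨ns, -, hns⟩ := (H.lim_psgn H.W hJ hs hst).exists_seq_tendsto_ae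
  filter_upwards [hns] with ω hω
  have step : ∀ n i, i < 2 ^ n → gr s t n i ∈ Icc s t ∧ gr s t n i ≤ gr s t n (i + 1) := fun n i hi =>
    ⟨⟨gr_ge hst _ _, gr_le hst _ _ hi.le⟩, gr_mono hst n (Nat.le_succ i)⟩
  have tel : ∀ n, ∑ i ∈ Finset.range (2 ^ n), (|Y (gr s t n (i + 1)) ω| - |Y (gr s t n i) ω| + lam * (gr s t n (i + 1) - gr s t n i)) = |Y t ω| - |Y s ω| + lam * (t - s) := by
    intro n
    have := Finset.sum_range_sub (fun i => |Y (gr s t n i) ω| + lam * gr s t n i) (2 ^ n)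
    rw [gr_last, gr_zero] at this
    rw [show |Y t ω| - |Y s ω| + lam * (t - s) = |Y t ω| + lam * t - (|Y s ω| + lam * s) by ring, ← this]
    exact Finset.sum_congr rfl fun i _ => by ring
  constructor
  · refine le_of_tendsto hω (Eventually.of_forall fun n => ?_)
    rw [← tel (ns n)]
    refine Finset.sum_le_sum fun i hi => ?_
    have hi := Finset.mem_range.1 hi
    have h1 := tanaka_step (Y (gr s t (ns n) i) ω) (Y (gr s t (ns n) (i + 1)) ω)
    have h2 := AA_lip H.cont (gr s t (ns n) i) (gr s t (ns n) (i + 1)) ω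
    rw [abs_of_nonneg (sub_nonneg.2 (step _ i hi).2)] at h2
    have h3 : psgn (Y (gr s t (ns n) i) ω) * (AA Y (gr s t (ns n) (i + 1)) ω - AA Y (gr s t (ns n) i) ω) ≤ gr s t (ns n) (i + 1) - gr s t (ns n) i := by
      refine (le_abs_self _).trans ?_
      rw [abs_mul, psgn_abs, one_mul]; exact h2
    have h4 := mul_le_mul_of_nonneg_left h3 H.lam_pos.le
    simp only [WW]
    linarith
  · intro hne
    have cs : ∀ r ∈ Icc s t, psgn (Y r ω) = psgn (Y s ω) := by
      intro r hr
      by_contra hcon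
      have hmem : (0:ℝ) ∈ uIcc (Y s ω) (Y r ω) := by
        rw [mem_uIcc]
        unfold psgn at hcon
        split_ifs at hcon with h1 h2 h2
        · exact absurd rfl hcon
        · left; exact ⟨not_lt.1 h2, h1.le⟩
        · right; exact ⟨not_lt.1 h1, h2.le⟩
        · exact absurd rfl hcon
      obtain ⟨z, hz, hz0⟩ := intermediate_value_uIcc (f := fun r => Y r ω) (H.cont ω).continuousOn hmem
      rw [uIcc_of_le hr.1] at hz
      exact hne z ⟨hz.1, hz.2.trans hr.2⟩ hz0
    refine tendsto_nhds_unique hω (tendsto_const_nhds.congr fun n => ?_)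
    rw [← tel (ns n)]
    refine Finset.sum_congr rfl fun i hi => ?_
    have hi := Finset.mem_range.1 hi
    refine (sign_step H.cont (step _ i hi).2 ω fun r hr => ?_).symm
    rw [cs r ⟨(step _ i hi).1.1.trans hr.1, hr.2.trans (gr_le hst _ _ hi)⟩, cs _ (step _ i hi).1]

def rmax (a : ℕ → ℝ) : ℕ → ℝ
  | 0 => 0
  | n + 1 => max (rmax a n) (a n)

/-- `|Y|` is adapted to `V♭` (Skorokhod reflection) -/
lemma Core.ad_absY (H : Core μ F B₁ B₂ Y ρ σ lam y) (h𝒢 : NullC μ 𝒢) {T : ℝ} {J : ℝ → Ω → ℝ}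
    (hJ : SI μ B₁ B₂ Y (ρ - σ * Complex.I) (-(σ - ρ * Complex.I)) J) (hJa : Ad 𝒢 T J) : Ad 𝒢 T (fun t ω => |Y t ω|) := by
  intro t ht
  let U : ℝ → Ω → ℝ := fun s ω => |y| + J s ω - lam * s
  have hUm : Ad 𝒢 T U := fun s hs => ((hJa s hs).const_add _).sub_const _
  rcases ht.1.eq_or_lt with h0 | h0
  · rw [← h0]
    refine h𝒢.congr (f := fun _ => |y|) measurable_const ?_
    filter_upwards [H.Y0] with ω hω; rw [hω]
  let d : ℕ → ℝ := fun j => max 0 (min t (TopologicalSpace.denseSeq ℝ j))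
  have hd : ∀ j, d j ∈ Icc 0 t := fun j => ⟨le_max_left _ _, max_le ht.1 (min_le_left _ _)⟩
  have hKs : ∀ᵐ ω ∂μ, ∀ j, J t ω - J (d j) ω ≤ |Y t ω| - |Y (d j) ω| + lam * (t - d j) ∧
      ((∀ r ∈ Icc (d j) t, Y r ω ≠ 0) → J t ω - J (d j) ω = |Y t ω| - |Y (d j) ω| + lam * (t - d j)) :=
    ae_all_iff.2 fun j => H.K_mono hJ (hd j).1 (hd j).2
  have hK0 := H.K_mono hJ le_rfl ht.1
  have hYt : ∀ᵐ ω ∂μ, Y t ω ≠ 0 := measure_eq_zero_iff_ae_notMem.1 (H.zero_null h0)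
  have key : Measurable[𝒢] (fun ω => |Y t ω| - U t ω) := by
    refine h𝒢.lim_ae (f := fun n ω => rmax (fun j => - U (d j) ω) n) ?_ ?_
    · intro n
      induction n with
      | zero => exact measurable_const
      | succ n ih => exact ih.max (hUm _ ⟨(hd n).1, (hd n).2.trans ht.2⟩).neg
    · filter_upwards [hKs, hK0, hYt, H.Y0, hJ.zero] with ω hKs hK0 hYt hY0 hJ0
      rw [hY0, hJ0, sub_zero] at hK0
      have up : ∀ n, rmax (fun j => - U (d j) ω) n ≤ |Y t ω| - U t ω := by
        intro n
        induction n with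
        | zero => simp only [rmax, U]; linarith [hK0.1]
        | succ n ih =>
          refine max_le ih ?_
          simp only [U]; linarith [(hKs n).1, abs_nonneg (Y (d n) ω)]
      have mono : Monotone (rmax fun j => - U (d j) ω) := monotone_nat_of_le_succ fun n => le_max_left _ _
      refine tendsto_order.2 ⟨fun a ha => ?_, fun a ha => Eventually.of_forall fun n => (up n).trans_lt ha⟩
      suffices ∃ n, a < rmax (fun j => - U (d j) ω) n by
        obtain ⟨n, hn⟩ := this
        filter_upwards [eventually_ge_atTop n] with k hk
        exact hn.trans_le (mono hk)
      by_cases hz : ∃ r ∈ Icc 0 t, Y r ω = 0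
      · -- last zero
        let Z : Set ℝ := Icc 0 t ∩ {r | Y r ω = 0}
        have hZc : IsCompact Z := isCompact_Icc.inter_right (isClosed_eq (H.cont ω) continuous_const)
        have hZn : Z.Nonempty := by obtain ⟨r, hr, hr0⟩ := hz; exact ⟨r, hr, hr0⟩
        obtain ⟨τ, hτ, hmax⟩ := hZc.exists_isGreatest hZn
        have hτ0 : Y τ ω = 0 := hτ.2
        have hτt : τ < t := lt_of_le_of_ne hτ.1.2 (fun h => hYt (h ▸ hτ0))
        set ε := |Y t ω| - U t ω - a with hε
        have hεp : 0 < ε := by linarith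
        obtain ⟨δ, hδ, hδY⟩ := Metric.continuous_iff.1 (H.cont ω) τ ε hεp
        obtain ⟨j, hj⟩ := (TopologicalSpace.denseRange_denseSeq ℝ).exists_mem_open (isOpen_Ioo (a := τ) (b := min t (τ + δ))) (nonempty_Ioo.2 (lt_min hτt (by linarith)))
        have hj1 := hj.2.trans_le (min_le_left _ _)
        have hj2 := hj.2.trans_le (min_le_right _ _)
        have hdj : d j = TopologicalSpace.denseSeq ℝ j := by
          simp only [d]; rw [min_eq_right hj1.le, max_eq_right (hτ.1.1.trans hj.1.le)]
        refine ⟨j + 1, lt_of_lt_of_le ?_ (le_max_right _ _)⟩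
        have h1 := (hKs j).2 (fun r hr hr0 => by
          rw [hdj] at hr
          have := hmax ⟨⟨hτ.1.1.trans (hj.1.le.trans hr.1), hr.2⟩, hr0⟩
          linarith [hj.1, hr.1])
        have h2 := hδY (d j) (by rw [hdj, Real.dist_eq, abs_of_pos (by linarith [hj.1])]; linarith)
        rw [Real.dist_eq, hτ0, sub_zero] at h2
        simp only [U] at hε ⊢
        linarith
      · push Not at hz
        refine ⟨0, ?_⟩
        have := hK0.2 hz
        simp only [rmax]
        simp only [U] at ha; linarith
  have := key.add (hUm t ht)
  have e : (fun ω => |Y t ω|) = fun ω => (|Y t ω| - U t ω) + U t ω := by funext ω; ring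
  show Measurable[𝒢] fun ω => |Y t ω|
  rw [e]; exact this

end adapt2


section hitting

lemma euler_conv' {lam y T : ℝ} (hl : 0 ≤ lam) (hT : 0 ≤ T) (f : ℝ → ℝ) (hf : Continuous f) (mm : ℕ → ℕ → ℝ)
    (hη : ∀ δ > 0, ∀ᶠ n in atTop, ∀ k ≤ 2 ^ n, |(∑ i ∈ Finset.range k, mm n i) - (f (gr 0 T n k) - y + lam * ∫ s in (0:ℝ)..(gr 0 T n k), psgn (f s))| ≤ δ) :
    ∀ ε > 0, ∀ᶠ n in atTop, ∀ k ≤ 2 ^ n, |eul lam y (T / 2 ^ n) (mm n) k - f (gr 0 T n k)| ≤ ε := by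
  let E : ℕ → ℕ → ℝ := fun n k => |(∑ i ∈ Finset.range k, mm n i) - (f (gr 0 T n k) - y + lam * ∫ s in (0:ℝ)..(gr 0 T n k), psgn (f s))|
  let η : ℕ → ℝ := fun n => (Finset.range (2 ^ n + 1)).sup' ⟨0, by simp⟩ (E n)
  have h1 : ∀ n, ∀ k ≤ 2 ^ n, E n k ≤ η n := fun n k hk => Finset.le_sup' (E n) (Finset.mem_range.2 (by omega))
  refine euler_conv hl hT f hf mm η ?_ h1
  rw [Metric.tendsto_nhds]
  intro δ hδ
  filter_upwards [hη (δ / 2) (by positivity)] with n hn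
  have h0 : 0 ≤ η n := (abs_nonneg _).trans (h1 n 0 (Nat.zero_le _))
  have h2 : η n ≤ δ / 2 := Finset.sup'_le _ _ fun k hk => hn k (by have := Finset.mem_range.1 hk; omega)
  rw [Real.dist_eq, sub_zero, abs_of_nonneg h0]; linarith

open Classical in
def hit (f : ℝ → ℝ) (s : ℝ) : ℝ := if ∃ r ∈ Icc 0 s, f r = 0 then -1 else 1

lemma hit_or (f : ℝ → ℝ) (s : ℝ) : hit f s = 1 ∨ hit f s = -1 := by unfold hit; split_ifs <;> simp

lemma hit_neg {f : ℝ → ℝ} {s t : ℝ} (hst : s ≤ t) (h : hit f s = -1) : hit f t = -1 := by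
  unfold hit at *
  split_ifs at h with h1
  · rw [if_pos]; obtain ⟨r, hr, h0⟩ := h1; exact ⟨r, ⟨hr.1, hr.2.trans hst⟩, h0⟩
  · norm_num at h

lemma hit_pos {f : ℝ → ℝ} {s t : ℝ} (hst : s ≤ t) (h : hit f t = 1) : hit f s = 1 := by
  rcases hit_or f s with h' | h'
  · exact h'
  · rw [hit_neg hst h'] at h; norm_num at h

lemma hit_cases {f : ℝ → ℝ} (hf : Continuous f) : (∀ s, hit f s = 1) ∨ ∃ τ, f τ = 0 ∧ ∀ s, hit f s = if τ ≤ s then -1 else 1 := by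
  by_cases h : ∃ r, 0 ≤ r ∧ f r = 0
  · right
    obtain ⟨r, hr, hr0⟩ := h
    have hZc : IsCompact (Icc 0 r ∩ {r | f r = 0}) := isCompact_Icc.inter_right (isClosed_eq hf continuous_const)
    obtain ⟨τ, hτ, hmin⟩ := hZc.exists_isLeast ⟨r, ⟨hr, le_rfl⟩, hr0⟩
    refine ⟨τ, hτ.2, fun s => ?_⟩
    unfold hit
    by_cases hs : τ ≤ s
    · rw [if_pos hs, if_pos ⟨τ, ⟨hτ.1.1, hs⟩, hτ.2⟩]
    · rw [if_neg hs, if_neg]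
      rintro ⟨z, hz, hz0⟩
      push Not at hs
      have := hmin ⟨⟨hz.1, hz.2.trans (hs.le.trans hτ.1.2)⟩, hz0⟩
      linarith [hz.2]
  · left
    intro s
    unfold hit
    rw [if_neg]
    rintro ⟨z, hz, hz0⟩
    exact h ⟨z, hz.1, hz0⟩

lemma hit_cont {f : ℝ → ℝ} (hf : Continuous f) : Continuous fun s => hit f s * f s := by
  rcases hit_cases hf with h | ⟨τ, hτ, h⟩
  · simpa [h] using hf
  · have : (fun s => hit f s * f s) = fun s => if τ ≤ s then - f s else f s := by
      funext s; rw [h s]; split_ifs <;> ring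
    rw [this]
    refine Continuous.if_le hf.neg hf continuous_const continuous_id ?_
    intro x hx
    change τ = x at hx
    rw [← hx, hτ]; simp

lemma psgn_neg {a : ℝ} (ha : a ≠ 0) : psgn (-a) = - psgn a := by
  unfold psgn
  rcases lt_or_gt_of_ne ha with h | h
  · rw [if_pos (by linarith), if_neg (by linarith)]; norm_num
  · rw [if_neg (by linarith), if_pos (by linarith)]

lemma hit_step {f : ℝ → ℝ} (hf : Continuous f) (hne : ∀ᵐ s : ℝ, 0 < s → f s ≠ 0) {lam a b δ : ℝ} (hl : 0 ≤ lam) (ha : 0 ≤ a) (hab : a ≤ b)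
    (hδ : ∀ r ∈ Icc a b, |f r - f a| ≤ δ) :
    ((hit f b = 1 ∨ hit f a = -1) → hit f a * (f b - f a + lam * ∫ s in a..b, psgn (f s)) - (hit f b * f b - hit f a * f a + lam * ∫ s in a..b, psgn (hit f s * f s)) = 0) ∧
    |hit f a * (f b - f a + lam * ∫ s in a..b, psgn (f s)) - (hit f b * f b - hit f a * f a + lam * ∫ s in a..b, psgn (hit f s * f s))| ≤ 4 * δ + 2 * lam * (b - a) := by
  have hδ0 : 0 ≤ δ := (abs_nonneg _).trans (hδ a ⟨le_rfl, hab⟩)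
  have hba : 0 ≤ b - a := sub_nonneg.2 hab
  have key : (hit f b = 1 ∨ hit f a = -1) → hit f a * (f b - f a + lam * ∫ s in a..b, psgn (f s)) - (hit f b * f b - hit f a * f a + lam * ∫ s in a..b, psgn (hit f s * f s)) = 0 := by
    rintro (h | h)
    · have : (∫ s in a..b, psgn (hit f s * f s)) = ∫ s in a..b, psgn (f s) := by
        refine intervalIntegral.integral_congr fun s hs => ?_
        rw [uIcc_of_le hab] at hs
        simp only [hit_pos hs.2 h, one_mul]
      rw [this, h, hit_pos hab h]; ring
    · have : (∫ s in a..b, psgn (hit f s * f s)) = ∫ s in a..b, - psgn (f s) := by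
        refine intervalIntegral.integral_congr_ae ?_
        filter_upwards [hne] with s hs hm
        rw [uIoc_of_le hab] at hm
        rw [hit_neg hm.1.le h, neg_one_mul, psgn_neg (hs (ha.trans_lt hm.1))]
      rw [this, h, hit_neg hab h, intervalIntegral.integral_neg]; ring
  refine ⟨key, ?_⟩
  by_cases hc : hit f b = 1 ∨ hit f a = -1
  · rw [key hc, abs_zero]; positivity
  · push Not at hc
    have hb : hit f b = -1 := (hit_or f b).resolve_left hc.1
    have ha' : hit f a = 1 := (hit_or f a).resolve_right hc.2
    obtain ⟨τ, hτ, hτ0⟩ : ∃ τ ∈ Icc a b, f τ = 0 := by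
      unfold hit at hb
      split_ifs at hb with h1
      · obtain ⟨r, hr, hr0⟩ := h1
        refine ⟨r, ⟨?_, hr.2⟩, hr0⟩
        by_contra hcon
        push Not at hcon
        unfold hit at ha'
        rw [if_pos ⟨r, ⟨hr.1, hcon.le⟩, hr0⟩] at ha'
        norm_num at ha'
      · norm_num at hb
    have hfb : |f b| ≤ 2 * δ := by
      have h1 := hδ b ⟨hab, le_rfl⟩
      have h2 := hδ τ hτ
      rw [hτ0] at h2
      have : f b = (f b - f a) - (0 - f a) := by ring
      rw [this]; exact (abs_sub _ _).trans (by linarith)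
    have hintg : ∀ g : ℝ → ℝ, |∫ s in a..b, psgn (g s)| ≤ b - a := fun g => by
      have := intervalIntegral.norm_integral_le_of_norm_le_const (a := a) (b := b) (C := 1) (f := fun r => psgn (g r))
        (fun x _ => by simp [Real.norm_eq_abs, psgn_abs])
      rwa [Real.norm_eq_abs, one_mul, abs_of_nonneg hba] at this
    have i1 := hintg f
    have i2 := hintg (fun s => hit f s * f s)
    rw [ha', hb]
    have e : (1 * (f b - f a + lam * ∫ s in a..b, psgn (f s)) - (-1 * f b - 1 * f a + lam * ∫ s in a..b, psgn (hit f s * f s))) =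
      2 * f b + lam * ((∫ s in a..b, psgn (f s)) - ∫ s in a..b, psgn (hit f s * f s)) := by ring
    rw [e]
    refine (abs_add_le _ _).trans ?_
    rw [abs_mul, abs_mul, abs_of_nonneg hl, abs_of_pos (by norm_num : (0:ℝ) < 2)]
    have i3 := (abs_sub (∫ s in a..b, psgn (f s)) (∫ s in a..b, psgn (hit f s * f s))).trans (add_le_add i1 i2)
    have := mul_le_mul_of_nonneg_left i3 hl
    linarith

lemma hit_noise {f : ℝ → ℝ} (hf : Continuous f) (hne : ∀ᵐ s : ℝ, 0 < s → f s ≠ 0) {lam y T : ℝ} (hl : 0 ≤ lam) (hT : 0 ≤ T) (h0 : f 0 = y) :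
    ∀ δ > 0, ∀ᶠ n in atTop, ∀ k ≤ 2 ^ n, |(∑ i ∈ Finset.range k, hit f (gr 0 T n i) * ((f (gr 0 T n (i + 1)) - y + lam * ∫ s in (0:ℝ)..(gr 0 T n (i + 1)), psgn (f s)) -
      (f (gr 0 T n i) - y + lam * ∫ s in (0:ℝ)..(gr 0 T n i), psgn (f s))))
      - (hit f (gr 0 T n k) * f (gr 0 T n k) - y + lam * ∫ s in (0:ℝ)..(gr 0 T n k), psgn (hit f s * f s))| ≤ δ := by
  intro δ hδ
  have hd0 : Tendsto (fun n : ℕ => 2 * lam * (T / 2 ^ n)) atTop (nhds 0) := by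
    have := (tendsto_pow_atTop_nhds_zero_of_lt_one (r := (1/2 : ℝ)) (by norm_num) (by norm_num)).const_mul (2 * lam * T)
    simp only [MulZeroClass.mul_zero] at this
    refine this.congr fun n => ?_
    rw [one_div, inv_pow]; ring
  filter_upwards [unif_osc hf hT (ε := δ / 8) (by positivity), hd0.eventually_le_const (u := δ / 2) (by positivity)] with n hn1 hn2
  intro k
  have hif := psgn_intervalIntegrable hf
  have hig := psgn_intervalIntegrable (hit_cont hf)
  set d : ℕ → ℝ := fun k => (∑ i ∈ Finset.range k, hit f (gr 0 T n i) * ((f (gr 0 T n (i + 1)) - y + lam * ∫ s in (0:ℝ)..(gr 0 T n (i + 1)), psgn (f s)) -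
      (f (gr 0 T n i) - y + lam * ∫ s in (0:ℝ)..(gr 0 T n i), psgn (f s))))
      - (hit f (gr 0 T n k) * f (gr 0 T n k) - y + lam * ∫ s in (0:ℝ)..(gr 0 T n k), psgn (hit f s * f s)) with hd
  suffices k ≤ 2 ^ n → (hit f (gr 0 T n k) = 1 → d k = 0) ∧ |d k| ≤ δ from fun hk => (this hk).2
  induction k with
  | zero =>
    intro _
    have : d 0 = 0 := by
      simp only [hd, gr_zero, Finset.range_zero, Finset.sum_empty, intervalIntegral.integral_same, h0]
      rcases hit_or f 0 with h | h
      · rw [h]; ring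
      · have : f 0 = 0 := by
          unfold hit at h
          split_ifs at h with h1
          · obtain ⟨r, hr, hr0⟩ := h1
            have e := le_antisymm hr.2 hr.1; rw [e] at hr0; exact hr0
          · norm_num at h
        rw [h, ← h0, this]; ring
    exact ⟨fun _ => this, by rw [this, abs_zero]; exact hδ.le⟩
  | succ k ih =>
    intro hk
    have ih := ih (by omega)
    have hle : gr 0 T n k ≤ gr 0 T n (k + 1) := gr_mono hT n (Nat.le_succ k)
    have st := hit_step hf hne hl (gr_ge hT n k) hle (hn1 k hk)
    have hstep := gr_step 0 T n k
    rw [sub_zero] at hstep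
    set D := hit f (gr 0 T n k) * (f (gr 0 T n (k + 1)) - f (gr 0 T n k) + lam * ∫ s in gr 0 T n k..gr 0 T n (k + 1), psgn (f s)) - (hit f (gr 0 T n (k + 1)) * f (gr 0 T n (k + 1)) - hit f (gr 0 T n k) * f (gr 0 T n k) + lam * ∫ s in gr 0 T n k..gr 0 T n (k + 1), psgn (hit f s * f s)) with hD
    have hrec : d (k + 1) = d k + D := by
      simp only [hd, Finset.sum_range_succ, hD]
      rw [← intervalIntegral.integral_interval_sub_left (hif 0 (gr 0 T n (k+1))) (hif 0 (gr 0 T n k)), ← intervalIntegral.integral_interval_sub_left (hig 0 (gr 0 T n (k+1))) (hig 0 (gr 0 T n k))]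
      ring
    rw [hrec]
    constructor
    · intro h
      rw [ih.1 (hit_pos hle h), st.1 (Or.inl h), add_zero]
    · rcases hit_or f (gr 0 T n k) with h | h
      · rw [ih.1 h, zero_add]
        refine st.2.trans ?_
        rw [hstep]; linarith
      · rw [st.1 (Or.inr h), add_zero]; exact ih.2

end hitting


section reflection

variable {μ : Measure Ω} [IsProbabilityMeasure μ] {F : ℝ → MeasurableSpace Ω} {B₁ B₂ Y : ℝ → Ω → ℝ} {ρ σ lam y : ℝ}

/-- sign processes `ε` such that `ε Y` is a reflected solution -/
structure Refl (μ : Measure Ω) (F : ℝ → MeasurableSpace Ω) (Y : ℝ → Ω → ℝ) (lam y T : ℝ) (e : ℝ → Ω → ℝ) : Prop where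
  pm : ∀ s ω, e s ω = 1 ∨ e s ω = -1
  meas : ∀ s, 0 ≤ s → Measurable[F s] (e s)
  cont : ∀ ω, Continuous fun s => e s ω * Y s ω
  noise : ∀ᵐ ω ∂μ, ∀ δ > 0, ∀ᶠ n in atTop, ∀ k ≤ 2 ^ n,
    |(∑ i ∈ Finset.range k, e (gr 0 T n i) ω * (WW Y lam y (gr 0 T n (i + 1)) ω - WW Y lam y (gr 0 T n i) ω)) -
      (e (gr 0 T n k) ω * Y (gr 0 T n k) ω - y + lam * ∫ s in (0:ℝ)..(gr 0 T n k), psgn (e s ω * Y s ω))| ≤ δ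

lemma Core.refl_one (H : Core μ F B₁ B₂ Y ρ σ lam y) (T : ℝ) : Refl μ F Y lam y T (fun _ _ => 1) where
  pm := fun _ _ => Or.inl rfl
  meas := fun s _ => @measurable_const _ _ _ (F s) _
  cont := fun ω => by simpa using H.cont ω
  noise := by
    filter_upwards [H.W.zero] with ω hω δ hδ
    refine Eventually.of_forall fun n k hk => ?_
    simp only [one_mul]
    rw [Finset.sum_range_sub (fun i => WW Y lam y (gr 0 T n i) ω), gr_zero, hω]
    simp [WW, AA, hδ.le]

lemma hit_meas {Ω : Type*} {𝒢 : MeasurableSpace Ω} {Y : ℝ → Ω → ℝ} (hc : ∀ ω, Continuous fun t => Y t ω) {s : ℝ} (hs : 0 ≤ s) (hY : ∀ r ∈ Icc 0 s, Measurable (Y r)) :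
    Measurable (fun ω => hit (fun r => Y r ω) s) := by
  classical
  let d : ℕ → ℝ := fun j => max 0 (min s (TopologicalSpace.denseSeq ℝ j))
  have hd : ∀ j, d j ∈ Icc 0 s := fun j => ⟨le_max_left _ _, max_le hs (min_le_left _ _)⟩
  have hset : {ω | ∃ r ∈ Icc 0 s, Y r ω = 0} = ⋂ k : ℕ, ⋃ j : ℕ, {ω | |Y (d j) ω| < 1 / ((k : ℝ) + 1)} := by
    ext ω
    simp only [Set.mem_ofPred_eq, mem_iInter, mem_iUnion]
    constructor
    · rintro ⟨r, hr, hr0⟩ k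
      have hp : (0:ℝ) < 1 / ((k : ℝ) + 1) := by positivity
      have hcont : Continuous fun x => Y (max 0 (min s x)) ω := (hc ω).comp (by fun_prop)
      have ho : IsOpen {x : ℝ | |Y (max 0 (min s x)) ω| < 1 / ((k : ℝ) + 1)} := isOpen_lt hcont.abs continuous_const
      obtain ⟨j, hj⟩ := (TopologicalSpace.denseRange_denseSeq ℝ).exists_mem_open ho ⟨r, by
        simp only [Set.mem_ofPred_eq]; rw [min_eq_right hr.2, max_eq_right hr.1, hr0, abs_zero]; exact hp⟩
      exact ⟨j, hj⟩
    · intro h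
      obtain ⟨r, hr, hmin⟩ := isCompact_Icc.exists_isMinOn (nonempty_Icc.2 hs) (f := fun r => |Y r ω|) (hc ω).abs.continuousOn
      refine ⟨r, hr, ?_⟩
      by_contra hne
      have hp : 0 < |Y r ω| := abs_pos.2 hne
      obtain ⟨k, hk⟩ := exists_nat_one_div_lt hp
      obtain ⟨j, hj⟩ := h k
      have : |Y r ω| ≤ |Y (d j) ω| := hmin (hd j)
      linarith
  have hms : MeasurableSet {ω | ∃ r ∈ Icc 0 s, Y r ω = 0} := by
    rw [hset]
    refine MeasurableSet.iInter fun k => MeasurableSet.iUnion fun j => ?_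
    have hm : Measurable (fun ω => |Y (d j) ω|) := (hY _ (hd j)).abs
    exact measurableSet_lt hm measurable_const
  unfold hit
  exact Measurable.ite hms measurable_const measurable_const

lemma Core.hit_meas (H : Core μ F B₁ B₂ Y ρ σ lam y) {s : ℝ} (hs : 0 ≤ s) : Measurable[F s] (fun ω => hit (fun r => Y r ω) s) :=
  SDEPaper.hit_meas H.cont hs fun r hr => (H.meas r hr.1).mono (H.pb.mono hr.2) le_rfl

lemma Core.refl_hit (H : Core μ F B₁ B₂ Y ρ σ lam y) {T : ℝ} (hT : 0 ≤ T) : Refl μ F Y lam y T (fun s ω => hit (fun r => Y r ω) s) where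
  pm := fun s ω => hit_or _ _
  meas := fun s hs => H.hit_meas hs
  cont := fun ω => hit_cont (H.cont ω)
  noise := by
    filter_upwards [H.Y0, H.ne_zero_path] with ω h0 hne
    exact hit_noise (H.cont ω) hne H.lam_pos.le hT h0

def nz (W₁ W₂ e : ℝ → Ω → ℝ) (ρ σ T : ℝ) (N i : ℕ) (ω : Ω) : ℝ × ℝ :=
  (e (gr 0 T N i) ω * (ρ * (W₁ (gr 0 T N (i + 1)) ω - W₁ (gr 0 T N i) ω) + σ * (W₂ (gr 0 T N (i + 1)) ω - W₂ (gr 0 T N i) ω)),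
   e (gr 0 T N i) ω * (ρ * (W₁ (gr 0 T N (i + 1)) ω - W₁ (gr 0 T N i) ω) - σ * (W₂ (gr 0 T N (i + 1)) ω - W₂ (gr 0 T N i) ω)))

def ye (lam y T : ℝ) (N : ℕ) (z : ℕ → ℝ × ℝ) (k : ℕ) : ℝ := eul lam y (T / 2 ^ N) (fun i => (z i).1) k
def ve (lam y T : ℝ) (N : ℕ) (z : ℕ → ℝ × ℝ) (k : ℕ) : ℝ := ∑ i ∈ Finset.range k, psgn (ye lam y T N z i) * (z i).2

variable {W₁ W₂ V e : ℝ → Ω → ℝ}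

lemma Core.ye_conv (H : Core μ F B₁ B₂ Y ρ σ lam y) (h1 : SI μ B₁ B₂ Y 1 (-Complex.I) W₁) (h2 : SI μ B₁ B₂ Y (-Complex.I) 1 W₂)
    {T : ℝ} (hT : 0 ≤ T) (R : Refl μ F Y lam y T e) :
    ∀ᵐ ω ∂μ, ∀ δ > 0, ∀ᶠ N in atTop, ∀ k ≤ 2 ^ N, |ye lam y T N (fun i => nz W₁ W₂ e ρ σ T N i ω) k - e (gr 0 T N k) ω * Y (gr 0 T N k) ω| ≤ δ := by
  have hW : SI μ B₁ B₂ Y (ρ - σ * Complex.I) (σ - ρ * Complex.I) (fun t ω => ρ * W₁ t ω + σ * W₂ t ω) := by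
    have := h1.lin h2 ρ σ
    convert this using 1 <;> ring
  have hall : ∀ᵐ ω ∂μ, ∀ N i : ℕ, WW Y lam y (gr 0 T N i) ω = ρ * W₁ (gr 0 T N i) ω + σ * W₂ (gr 0 T N i) ω :=
    ae_all_iff.2 fun N => ae_all_iff.2 fun i => H.W.unique hW (gr_ge hT N i)
  filter_upwards [hall, R.noise] with ω hω hn
  refine euler_conv' H.lam_pos.le hT (fun s => e s ω * Y s ω) (R.cont ω) (fun N i => (nz W₁ W₂ e ρ σ T N i ω).1) ?_
  intro δ hδ
  filter_upwards [hn δ hδ] with n hn k hk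
  refine le_trans (le_of_eq ?_) (hn k hk)
  congr 2
  refine Finset.sum_congr rfl fun i _ => ?_
  rw [hω, hω]; simp only [nz]; ring

lemma gr_scale (T : ℝ) (n j k : ℕ) : gr 0 T (n + j) (k * 2 ^ j) = gr 0 T n k := by
  rw [gr_0, gr_0]; push_cast; rw [pow_add]; field_simp

lemma Core.ye_meas (H : Core μ F B₁ B₂ Y ρ σ lam y) (h1 : SI μ B₁ B₂ Y 1 (-Complex.I) W₁) (h2 : SI μ B₁ B₂ Y (-Complex.I) 1 W₂)
    {T : ℝ} (hT : 0 ≤ T) (R : Refl μ F Y lam y T e) (N i : ℕ) :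
    Measurable[F (gr 0 T N i)] fun ω => ye lam y T N (fun i => nz W₁ W₂ e ρ σ T N i ω) i := by
  refine eul_meas lam y (T / 2 ^ N) (mm := fun i ω => (nz W₁ W₂ e ρ σ T N i ω).1) i fun j hj => ?_
  have g0 := gr_ge hT N j
  have g1 := gr_ge hT N (j + 1)
  have hj1 : gr 0 T N (j + 1) ≤ gr 0 T N i := gr_mono hT N hj
  have hj0 : gr 0 T N j ≤ gr 0 T N i := gr_mono hT N hj.le
  have a1 := (H.SI_meas h1 g0).mono (H.pb.mono hj0) le_rfl
  have a2 := (H.SI_meas h1 g1).mono (H.pb.mono hj1) le_rfl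
  have a3 := (H.SI_meas h2 g0).mono (H.pb.mono hj0) le_rfl
  have a4 := (H.SI_meas h2 g1).mono (H.pb.mono hj1) le_rfl
  have a5 := (R.meas _ g0).mono (H.pb.mono hj0) le_rfl
  exact a5.mul (((a2.sub a1).const_mul ρ).add ((a4.sub a3).const_mul σ))

lemma Core.ye_tim (H : Core μ F B₁ B₂ Y ρ σ lam y) (h1 : SI μ B₁ B₂ Y 1 (-Complex.I) W₁) (h2 : SI μ B₁ B₂ Y (-Complex.I) 1 W₂)
    {T : ℝ} (hT : 0 ≤ T) (R : Refl μ F Y lam y T e) (n k : ℕ) (hk : k ≤ 2 ^ n) :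
    TendstoInMeasure μ (fun j ω => ye lam y T (n + j) (fun i => nz W₁ W₂ e ρ σ T (n + j) i ω) (k * 2 ^ j)) atTop
      (fun ω => e (gr 0 T n k) ω * Y (gr 0 T n k) ω) := by
  refine tendstoInMeasure_of_tendsto_ae (fun j => ((H.ye_meas h1 h2 hT R (n + j) (k * 2 ^ j)).mono (H.pb.le _) le_rfl).aestronglyMeasurable) ?_
  filter_upwards [H.ye_conv h1 h2 hT R] with ω hω
  rw [Metric.tendsto_nhds]
  intro δ hδ
  have hs : Tendsto (fun j => n + j) atTop atTop := tendsto_atTop_mono (fun j => Nat.le_add_left j n) tendsto_id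
  filter_upwards [hs.eventually (hω (δ / 2) (by positivity))] with j hj
  have := hj (k * 2 ^ j) (by rw [pow_add]; exact Nat.mul_le_mul_right _ hk)
  rw [gr_scale] at this
  rw [Real.dist_eq]; linarith

lemma Core.ve_tim (H : Core μ F B₁ B₂ Y ρ σ lam y) (h1 : SI μ B₁ B₂ Y 1 (-Complex.I) W₁) (h2 : SI μ B₁ B₂ Y (-Complex.I) 1 W₂)
    (hV : SI μ B₁ B₂ Y (ρ + σ * Complex.I) (σ + ρ * Complex.I) V)
    {T : ℝ} (hT : 0 ≤ T) (R : Refl μ F Y lam y T e) (n k : ℕ) (hk : k ≤ 2 ^ n) :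
    TendstoInMeasure μ (fun j ω => ve lam y T (n + j) (fun i => nz W₁ W₂ e ρ σ T (n + j) i ω) (k * 2 ^ j)) atTop (V (gr 0 T n k)) := by
  set p : ℂ := ρ + σ * Complex.I with hp
  set q : ℂ := σ + ρ * Complex.I with hq
  set s := gr 0 T n k with hs
  have hs0 : 0 ≤ s := gr_ge hT n k
  have hsT : s ≤ T := gr_le hT n k hk
  have hU : SI μ B₁ B₂ Y p (-q) (fun t ω => ρ * W₁ t ω + (-σ) * W₂ t ω) := by
    have := h1.lin h2 ρ (-σ)
    convert this using 1
    · rw [hp]; push_cast; ring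
    · rw [hq]; push_cast; ring
  have hν : Tendsto (fun j => n + j) atTop atTop := tendsto_atTop_mono (fun j => Nat.le_add_left j n) tendsto_id
  have hvJ := H.ito_SI hV le_rfl hs0
  have main := H.lemN hU le_rfl hT (ν := fun j => n + j)
    (G := fun j i ω => if i < k * 2 ^ j then psgn (ye lam y T (n + j) (fun i => nz W₁ W₂ e ρ σ T (n + j) i ω) i) * e (gr 0 T (n + j) i) ω else 0) (C := 1)
    (Γ := fun x => if x.1 ≤ s then KK p q (Y x.1 x.2) else 0) (J := fun ω => V s ω - V 0 ω) ?_ ?_ ?_ ?_ ?_ ?_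
  · refine (main.congr_left fun j => Eventually.of_forall fun ω => ?_).congr_right ?_
    · have hle : k * 2 ^ j ≤ 2 ^ (n + j) := by rw [pow_add]; exact Nat.mul_le_mul_right _ hk
      simp only [ve, ite_mul, zero_mul]
      rw [← Finset.sum_filter]
      refine Finset.sum_congr ?_ fun i hi => ?_
      · ext i; simp only [Finset.mem_filter, Finset.mem_range]; omega
      · simp only [nz]; ring
    · filter_upwards [hV.zero] with ω hω; rw [hω, sub_zero]
  · intro j i hi
    by_cases h : i < k * 2 ^ j
    · simp only [if_pos h]
      exact (psgn_meas.comp (H.ye_meas h1 h2 hT R (n + j) i)).mul (R.meas _ (gr_ge hT _ i))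
    · simp only [if_neg h]; exact measurable_const
  · intro j i ω
    split_ifs
    · rw [abs_mul, psgn_abs, one_mul]
      rcases R.pm (gr 0 T (n + j) i) ω with h | h <;> rw [h] <;> simp
    · simp
  · exact Measurable.ite (measurableSet_le measurable_fst measurable_const) ((KK_meas p q).comp H.jm) measurable_const
  · intro x
    rw [norm_neg, one_mul]
    split_ifs
    · exact KK_bd p q _
    · simp; positivity
  · have hus : ∀ᵐ x ∂((volume : Measure ℝ).prod μ), ∀ δ > 0, ∀ᶠ N in atTop, ∀ k ≤ 2 ^ N, |ye lam y T N (fun i => nz W₁ W₂ e ρ σ T N i x.2) k - e (gr 0 T N k) x.2 * Y (gr 0 T N k) x.2| ≤ δ :=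
      Measure.quasiMeasurePreserving_snd.ae (H.ye_conv h1 h2 hT R)
    filter_upwards [H.ne_zero_ae, hus] with x hx0 hx hm
    have h0 := hx0 hm.1
    have hid := fun j => idx_spec (n + j) hm
    have lg := gr_idx_tendsto hm hν
    by_cases hxs : x.1 ≤ s
    · rw [if_pos hxs]
      have hlt : ∀ j, idx 0 T (n + j) x.1 < k * 2 ^ j := by
        intro j
        by_contra hcon
        have := gr_mono hT (n + j) (not_lt.1 hcon)
        rw [gr_scale, ← hs] at this
        linarith [(hid j).2.1]
      simp only [if_pos (hlt _)]
      have lY : Tendsto (fun j => Y (gr 0 T (n + j) (idx 0 T (n + j) x.1)) x.2) atTop (nhds (Y x.1 x.2)) :=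
        ((H.cont x.2).tendsto x.1).comp lg
      have leY : Tendsto (fun j => e (gr 0 T (n + j) (idx 0 T (n + j) x.1)) x.2 * Y (gr 0 T (n + j) (idx 0 T (n + j) x.1)) x.2) atTop (nhds (e x.1 x.2 * Y x.1 x.2)) :=
        ((R.cont x.2).tendsto x.1).comp lg
      have hd : Tendsto (fun j => ye lam y T (n + j) (fun i => nz W₁ W₂ e ρ σ T (n + j) i x.2) (idx 0 T (n + j) x.1) - e (gr 0 T (n + j) (idx 0 T (n + j) x.1)) x.2 * Y (gr 0 T (n + j) (idx 0 T (n + j) x.1)) x.2) atTop (nhds 0) := by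
        rw [Metric.tendsto_nhds]
        intro δ hδ
        filter_upwards [hν.eventually (hx (δ / 2) (by positivity))] with j hj
        have := hj _ (hid j).1.le
        rw [Real.dist_eq, sub_zero]; linarith
      have lye := hd.add leY
      simp only [sub_add_cancel, zero_add] at lye
      have hne : e x.1 x.2 * Y x.1 x.2 ≠ 0 := mul_ne_zero (by rcases R.pm x.1 x.2 with h | h <;> rw [h] <;> norm_num) h0
      have lp1 := (psgn_cont hne).tendsto.comp lye
      have lp2 := (psgn_cont hne).tendsto.comp leY
      have lp3 := (psgn_cont h0).tendsto.comp lY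
      have lp := (lp1.mul lp2).mul lp3
      rw [psgn_sq, one_mul] at lp
      have lpe : Tendsto (fun j => psgn (ye lam y T (n + j) (fun i => nz W₁ W₂ e ρ σ T (n + j) i x.2) (idx 0 T (n + j) x.1)) * e (gr 0 T (n + j) (idx 0 T (n + j) x.1)) x.2) atTop (nhds (psgn (Y x.1 x.2))) := by
        refine lp.congr' ?_
        filter_upwards [lY.eventually_ne h0] with j hj
        simp only [Function.comp]
        rw [mul_assoc]
        congr 1
        rcases R.pm (gr 0 T (n + j) (idx 0 T (n + j) x.1)) x.2 with h | h
        · rw [h, one_mul, psgn_sq]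
        · rw [h, neg_one_mul, psgn_neg hj, neg_mul, psgn_sq]
      have := ((Complex.continuous_ofReal.tendsto _).comp lpe).mul_const (KK p (-q) (Y x.1 x.2))
      rw [KK_psgn, neg_neg] at this
      exact this
    · rw [if_neg hxs]
      have hge : ∀ j, ¬ idx 0 T (n + j) x.1 < k * 2 ^ j := by
        intro j hcon
        have := gr_mono hT (n + j) (Nat.succ_le_of_lt hcon)
        rw [gr_scale, ← hs] at this
        exact hxs ((hid j).2.2.trans this)
      simp only [if_neg (hge _), Complex.ofReal_zero, zero_mul]
      exact tendsto_const_nhds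
  · convert hvJ using 1
    funext x
    by_cases hx : x.1 ∈ Ioc 0 T
    · rw [indicator_of_mem hx]
      split_ifs with hxs
      · rw [indicator_of_mem (show x.1 ∈ Ioc 0 s from ⟨hx.1, hxs⟩)]
      · rw [indicator_of_notMem (show x.1 ∉ Ioc 0 s from fun h => hxs h.2)]
    · rw [indicator_of_notMem hx, indicator_of_notMem (show x.1 ∉ Ioc 0 s from fun h => hx ⟨h.1, h.2.trans hsT⟩)]

end reflection


section laws

variable {μ : Measure Ω} [IsProbabilityMeasure μ] {F : ℝ → MeasurableSpace Ω} {B₁ B₂ Y : ℝ → Ω → ℝ} {ρ σ lam y : ℝ}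
  {W₁ W₂ V e e' : ℝ → Ω → ℝ}

lemma tim_sum {ι : Type*} (s : Finset ι) {f : ι → ℕ → Ω → ℝ} {g : ι → Ω → ℝ} (h : ∀ i ∈ s, TendstoInMeasure μ (f i) atTop (g i)) :
    TendstoInMeasure μ (fun n ω => ∑ i ∈ s, f i n ω) atTop (fun ω => ∑ i ∈ s, g i ω) := by
  classical
  induction s using Finset.induction_on with
  | empty => simpa using tim_const (μ := μ) (fun _ => (0:ℝ))
  | insert a s ha ih =>
    have := tim_lin 1 1 (h a (by simp)) (ih fun i hi => h i (by simp [hi]))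
    simpa [Finset.sum_insert ha] using this

lemma dual_pi {n : ℕ} (L : StrongDual ℝ (Fin n → ℝ × ℝ)) (z : Fin n → ℝ × ℝ) :
    L z = ∑ i, (L (Pi.single i (1, 0)) * (z i).1 + L (Pi.single i (0, 1)) * (z i).2) := by
  have hz : z = ∑ i, ((z i).1 • (Pi.single i (1, 0) : Fin n → ℝ × ℝ) + (z i).2 • (Pi.single i (0, 1) : Fin n → ℝ × ℝ)) := by
    funext j
    rw [Finset.sum_apply, Finset.sum_eq_single j]
    · simp
    · intro b _ hb
      simp [Pi.single_eq_of_ne hb.symm]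
    · simp
  conv_lhs => rw [hz]
  rw [map_sum]
  refine Finset.sum_congr rfl fun i _ => ?_
  rw [map_add, map_smul, map_smul, smul_eq_mul, smul_eq_mul]; ring

/-- the noise vector -/
def nv (W₁ W₂ e : ℝ → Ω → ℝ) (ρ σ T : ℝ) (N : ℕ) (ω : Ω) : Fin (2 ^ N) → ℝ × ℝ := fun i => nz W₁ W₂ e ρ σ T N i ω

structure PM (F : ℝ → MeasurableSpace Ω) (e : ℝ → Ω → ℝ) : Prop where
  pm : ∀ s ω, e s ω = 1 ∨ e s ω = -1
  meas : ∀ s, 0 ≤ s → Measurable[F s] (e s)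

lemma nv_meas (hP : PB μ F W₁ W₂) {T : ℝ} (hT : 0 ≤ T) (R : PM F e) (N : ℕ) : Measurable (nv W₁ W₂ e ρ σ T N) := by
  refine measurable_pi_lambda _ fun i => ?_
  have g0 := gr_ge hT N i
  have g1 := gr_ge hT N (i + 1)
  have a1 := (hP.meas₁ _ g0).mono (hP.le _) le_rfl
  have a2 := (hP.meas₁ _ g1).mono (hP.le _) le_rfl
  have a3 := (hP.meas₂ _ g0).mono (hP.le _) le_rfl
  have a4 := (hP.meas₂ _ g1).mono (hP.le _) le_rfl
  have a5 := (R.meas _ g0).mono (hP.le _) le_rfl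
  exact (a5.mul (((a2.sub a1).const_mul ρ).add ((a4.sub a3).const_mul σ))).prodMk
    (a5.mul (((a2.sub a1).const_mul ρ).sub ((a4.sub a3).const_mul σ)))

lemma nv_cf (hP : PB μ F W₁ W₂) {T : ℝ} (hT : 0 ≤ T) (R : PM F e) (N : ℕ) (a b : ℕ → ℝ) :
    ∫ ω, Complex.exp (Complex.I * ((∑ i ∈ Finset.range (2 ^ N), (a i * (nz W₁ W₂ e ρ σ T N i ω).1 + b i * (nz W₁ W₂ e ρ σ T N i ω).2) : ℝ) : ℂ)) ∂μ =
      Complex.exp ((-(∑ i ∈ Finset.range (2 ^ N), (((a i + b i) * ρ) ^ 2 + ((a i - b i) * σ) ^ 2) * (gr 0 T N (i + 1) - gr 0 T N i) / 2) : ℝ) : ℂ) := by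
  set γ : ℕ → ℂ := fun i => ⟨(a i + b i) * ρ, (a i - b i) * σ⟩ with hγ
  have := two_valued hP (τ := gr 0 T N) (gr_mono hT N) (gr_ge hT N 0) (c := fun i ω => (e (gr 0 T N i) ω : ℂ) * γ i) 0 (2 ^ N) (Nat.zero_le _)
    (fun i _ _ => (Complex.measurable_ofReal.comp (R.meas _ (gr_ge hT N i))).mul_const _)
    (α := γ) (β := fun i => - γ i) (r := fun i => ((a i + b i) * ρ) ^ 2 + ((a i - b i) * σ) ^ 2) ?_ ?_ ?_ (Z := fun _ => 1)
    (@measurable_const _ _ _ (F (gr 0 T N 0)) _) (C := 1) (by simp)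
  · simp only [one_mul, integral_const, probReal_univ, one_smul, mul_one, ← Finset.range_eq_Ico] at this
    rw [← this]
    congr 1; funext ω
    refine congrArg (fun x : ℝ => Complex.exp (Complex.I * x)) ?_
    refine Finset.sum_congr rfl fun i _ => ?_
    simp only [nz, dB, hγ, Complex.mul_re, Complex.mul_im, Complex.ofReal_re, Complex.ofReal_im]
    ring
  · intro i ω
    rcases R.pm (gr 0 T N i) ω with h | h <;> simp [h]
  · intro i; simp only [hγ, Complex.normSq_mk]; ring
  · intro i; simp only [hγ, Complex.normSq_neg, Complex.normSq_mk]; ring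

lemma nv_law (hP : PB μ F W₁ W₂) {T : ℝ} (hT : 0 ≤ T) (R : PM F e) (R' : PM F e') (N : ℕ) :
    μ.map (nv W₁ W₂ e ρ σ T N) = μ.map (nv W₁ W₂ e' ρ σ T N) := by
  have hm := nv_meas (ρ := ρ) (σ := σ) hP hT R N
  have hm' := nv_meas (ρ := ρ) (σ := σ) hP hT R' N
  have := Measure.isProbabilityMeasure_map (μ := μ) hm.aemeasurable
  have := Measure.isProbabilityMeasure_map (μ := μ) hm'.aemeasurable
  refine Measure.ext_of_charFunDual ?_
  funext L
  have key : ∀ {e : ℝ → Ω → ℝ}, PM F e → charFunDual (μ.map (nv W₁ W₂ e ρ σ T N)) L = Complex.exp ((-(∑ i ∈ Finset.range (2 ^ N),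
    ((((if h : i < 2 ^ N then L (Pi.single ⟨i, h⟩ (1, 0)) else 0) + (if h : i < 2 ^ N then L (Pi.single ⟨i, h⟩ (0, 1)) else 0)) * ρ) ^ 2 +
    (((if h : i < 2 ^ N then L (Pi.single ⟨i, h⟩ (1, 0)) else 0) - (if h : i < 2 ^ N then L (Pi.single ⟨i, h⟩ (0, 1)) else 0)) * σ) ^ 2)
      * (gr 0 T N (i + 1) - gr 0 T N i) / 2) : ℝ) : ℂ) := by
    intro e R
    rw [← nv_cf hP hT R N (fun i => if h : i < 2 ^ N then L (Pi.single ⟨i, h⟩ (1, 0)) else 0) (fun i => if h : i < 2 ^ N then L (Pi.single ⟨i, h⟩ (0, 1)) else 0)]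
    rw [charFunDual_apply, integral_map (nv_meas hP hT R N).aemeasurable (by fun_prop)]
    congr 1; funext ω
    rw [mul_comm, dual_pi, ← Fin.sum_univ_eq_sum_range (fun i => (if h : i < 2 ^ N then L (Pi.single ⟨i, h⟩ (1, 0)) else 0) * (nz W₁ W₂ e ρ σ T N i ω).1 + (if h : i < 2 ^ N then L (Pi.single ⟨i, h⟩ (0, 1)) else 0) * (nz W₁ W₂ e ρ σ T N i ω).2)]
    congr 3
    refine Finset.sum_congr rfl fun i _ => ?_
    simp [nv]
  rw [key R, key R']

lemma eul_congr {lam y Δ : ℝ} {f g : ℕ → ℝ} (k : ℕ) (h : ∀ i < k, f i = g i) : eul lam y Δ f k = eul lam y Δ g k := by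
  induction k with
  | zero => rfl
  | succ k ih =>
    simp only [eul]
    rw [ih fun i hi => h i (by omega), h k (by omega)]

lemma ye_congr {T : ℝ} {N : ℕ} {z z' : ℕ → ℝ × ℝ} (k : ℕ) (h : ∀ i < k, z i = z' i) : ye lam y T N z k = ye lam y T N z' k :=
  eul_congr k fun i hi => by rw [h i hi]

lemma ve_congr {T : ℝ} {N : ℕ} {z z' : ℕ → ℝ × ℝ} (k : ℕ) (h : ∀ i < k, z i = z' i) : ve lam y T N z k = ve lam y T N z' k := by
  unfold ve
  refine Finset.sum_congr rfl fun i hi => ?_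
  rw [Finset.mem_range] at hi
  rw [h i hi, ye_congr i fun j hj => h j (by omega)]

def exz {n : ℕ} (z : Fin n → ℝ × ℝ) (i : ℕ) : ℝ × ℝ := if h : i < n then z ⟨i, h⟩ else 0

lemma exz_meas {n : ℕ} (i : ℕ) : Measurable fun z : Fin n → ℝ × ℝ => exz z i := by
  unfold exz
  split_ifs
  · exact measurable_pi_apply _
  · exact measurable_const

lemma ye_m {T : ℝ} {N n : ℕ} (k : ℕ) : Measurable fun z : Fin n → ℝ × ℝ => ye lam y T N (exz z) k :=
  eul_meas lam y (T / 2 ^ N) (mm := fun i z => (exz z i).1) k fun i _ => (exz_meas i).fst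

lemma ve_m {T : ℝ} {N n : ℕ} (k : ℕ) : Measurable fun z : Fin n → ℝ × ℝ => ve lam y T N (exz z) k :=
  Finset.measurable_sum _ fun i _ => (psgn_meas.comp (ye_m i)).mul (exz_meas i).snd

/-- skeleton vector -/
def sk (P V : ℝ → Ω → ℝ) (T : ℝ) (n : ℕ) (ω : Ω) : Fin (2 ^ n + 1) → ℝ × ℝ := fun k => (P (gr 0 T n k) ω, V (gr 0 T n k) ω)

lemma sk_meas {P V : ℝ → Ω → ℝ} {T : ℝ} (hT : 0 ≤ T) (n : ℕ) (hP : ∀ t, 0 ≤ t → Measurable (P t)) (hV : ∀ t, 0 ≤ t → Measurable (V t)) :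
    Measurable (sk P V T n) :=
  measurable_pi_lambda _ fun k => (hP _ (gr_ge hT n k)).prodMk (hV _ (gr_ge hT n k))

lemma Refl.PM {T : ℝ} (R : Refl μ F Y lam y T e) : PM F e := ⟨R.pm, R.meas⟩

lemma Core.sk_cf (H : Core μ F B₁ B₂ Y ρ σ lam y) (h1 : SI μ B₁ B₂ Y 1 (-Complex.I) W₁) (h2 : SI μ B₁ B₂ Y (-Complex.I) 1 W₂)
    (hV : SI μ B₁ B₂ Y (ρ + σ * Complex.I) (σ + ρ * Complex.I) V)
    {T : ℝ} (hT : 0 ≤ T) (R : Refl μ F Y lam y T e) (n : ℕ) (L : StrongDual ℝ (Fin (2 ^ n + 1) → ℝ × ℝ)) :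
    Tendsto (fun j => ∫ z, Complex.exp (Complex.I * (L (fun k => (ye lam y T (n + j) (exz z) (k * 2 ^ j), ve lam y T (n + j) (exz z) (k * 2 ^ j))) : ℝ))
      ∂(μ.map (nv W₁ W₂ e ρ σ T (n + j)))) atTop
      (nhds (charFunDual (μ.map (sk (fun t ω => e t ω * Y t ω) V T n)) L)) := by
  have hP := H.SI_PB h1 h2
  have hYm : ∀ t, 0 ≤ t → Measurable (fun ω => e t ω * Y t ω) := fun t ht =>
    ((R.meas t ht).mono (hP.le _) le_rfl).mul (H.measm t)
  have hVm : ∀ t, 0 ≤ t → Measurable (V t) := fun t ht => (H.SI_meas hV ht).mono (hP.le _) le_rfl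
  rw [charFunDual_apply, integral_map (sk_meas hT n hYm hVm).aemeasurable (by fun_prop)]
  have hle : ∀ (k : Fin (2 ^ n + 1)) (j : ℕ), (k : ℕ) * 2 ^ j ≤ 2 ^ (n + j) := fun k j => by
    rw [pow_add]; exact Nat.mul_le_mul_right _ (Nat.lt_succ_iff.1 k.2)
  have hres : ∀ (j : ℕ) (ω : Ω), ∀ i < 2 ^ (n + j), exz (nv W₁ W₂ e ρ σ T (n + j) ω) i = nz W₁ W₂ e ρ σ T (n + j) i ω := by
    intro j ω i hi
    simp [exz, nv, hi]
  have hvec : ∀ j, Measurable fun z : Fin (2 ^ (n + j)) → ℝ × ℝ => fun k : Fin (2 ^ n + 1) => (ye lam y T (n + j) (exz z) (k * 2 ^ j), ve lam y T (n + j) (exz z) (k * 2 ^ j)) :=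
    fun j => measurable_pi_lambda _ fun k => (ye_m _).prodMk (ve_m _)
  have hmm : ∀ j, Measurable fun z : Fin (2 ^ (n + j)) → ℝ × ℝ => L fun k : Fin (2 ^ n + 1) => (ye lam y T (n + j) (exz z) (k * 2 ^ j), ve lam y T (n + j) (exz z) (k * 2 ^ j)) :=
    fun j => L.continuous.measurable.comp (hvec j)
  have hlim : TendstoInMeasure μ (fun j ω => L fun k : Fin (2 ^ n + 1) => (ye lam y T (n + j) (exz (nv W₁ W₂ e ρ σ T (n + j) ω)) (k * 2 ^ j), ve lam y T (n + j) (exz (nv W₁ W₂ e ρ σ T (n + j) ω)) (k * 2 ^ j))) atTop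
      (fun ω => L (sk (fun t ω => e t ω * Y t ω) V T n ω)) := by
    have := tim_sum (μ := μ) (Finset.univ : Finset (Fin (2 ^ n + 1)))
      (fun k _ => tim_lin (L (Pi.single k (1, 0))) (L (Pi.single k (0, 1)))
        (H.ye_tim h1 h2 hT R n k (Nat.lt_succ_iff.1 k.2)) (H.ve_tim h1 h2 hV hT R n k (Nat.lt_succ_iff.1 k.2)))
    convert this using 1
    · funext j ω
      rw [dual_pi]
      refine Finset.sum_congr rfl fun k _ => ?_
      rw [ye_congr _ fun i hi => hres j ω i (lt_of_lt_of_le hi (hle k j)), ve_congr _ fun i hi => hres j ω i (lt_of_lt_of_le hi (hle k j))]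
    · funext ω
      rw [dual_pi]; rfl
  have := tim_cexp (μ := μ) (Z := fun _ => 1) measurable_const 1 (by simp) (fun j => (hmm j).comp (nv_meas (ρ := ρ) (σ := σ) hP hT R.PM (n + j))) hlim
  simp only [one_mul] at this
  have e1 : ∀ j, (∫ z, Complex.exp (Complex.I * (L (fun k => (ye lam y T (n + j) (exz z) (k * 2 ^ j), ve lam y T (n + j) (exz z) (k * 2 ^ j))) : ℝ))
      ∂(μ.map (nv W₁ W₂ e ρ σ T (n + j)))) = ∫ ω, Complex.exp (Complex.I * (L (fun k : Fin (2 ^ n + 1) => (ye lam y T (n + j) (exz (nv W₁ W₂ e ρ σ T (n + j) ω)) (k * 2 ^ j), ve lam y T (n + j) (exz (nv W₁ W₂ e ρ σ T (n + j) ω)) (k * 2 ^ j))) : ℝ)) ∂μ := by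
    intro j
    rw [integral_map (nv_meas hP hT R.PM (n + j)).aemeasurable]
    exact (Complex.measurable_exp.comp ((Complex.measurable_ofReal.comp (hmm j)).const_mul _)).aestronglyMeasurable
  simp_rw [e1, mul_comm _ Complex.I]
  exact this

lemma Core.sk_law (H : Core μ F B₁ B₂ Y ρ σ lam y) (h1 : SI μ B₁ B₂ Y 1 (-Complex.I) W₁) (h2 : SI μ B₁ B₂ Y (-Complex.I) 1 W₂)
    (hV : SI μ B₁ B₂ Y (ρ + σ * Complex.I) (σ + ρ * Complex.I) V)
    {T : ℝ} (hT : 0 ≤ T) (R : Refl μ F Y lam y T e) (R' : Refl μ F Y lam y T e') (n : ℕ) :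
    μ.map (sk (fun t ω => e t ω * Y t ω) V T n) = μ.map (sk (fun t ω => e' t ω * Y t ω) V T n) := by
  have hP := H.SI_PB h1 h2
  have hYm : ∀ {e : ℝ → Ω → ℝ}, PM F e → ∀ t, 0 ≤ t → Measurable (fun ω => e t ω * Y t ω) := fun R t ht =>
    ((R.meas t ht).mono (hP.le _) le_rfl).mul (H.measm t)
  have hVm : ∀ t, 0 ≤ t → Measurable (V t) := fun t ht => (H.SI_meas hV ht).mono (hP.le _) le_rfl
  have := Measure.isProbabilityMeasure_map (μ := μ) (sk_meas hT n (hYm R.PM) hVm).aemeasurable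
  have := Measure.isProbabilityMeasure_map (μ := μ) (sk_meas hT n (hYm R'.PM) hVm).aemeasurable
  refine Measure.ext_of_charFunDual ?_
  funext L
  refine tendsto_nhds_unique (H.sk_cf h1 h2 hV hT R n L) ?_
  have := H.sk_cf h1 h2 hV hT R' n L
  refine this.congr fun j => ?_
  rw [nv_law hP hT R'.PM R.PM]

end laws


section strict

variable {μ : Measure Ω} [IsProbabilityMeasure μ] {F : ℝ → MeasurableSpace Ω} {B₁ B₂ Y : ℝ → Ω → ℝ} {ρ σ lam y : ℝ}
  {W₁ W₂ V e : ℝ → Ω → ℝ}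

/-- sigma-algebra generated by the level `n` skeleton of `(|Y|, V)` -/
def skA (P V : ℝ → Ω → ℝ) (T : ℝ) (n : ℕ) : MeasurableSpace Ω := MeasurableSpace.comap (sk P V T n) inferInstance

lemma skA_mono (P V : ℝ → Ω → ℝ) (T : ℝ) : Monotone (skA P V T) := by
  refine monotone_nat_of_le_succ fun n => ?_
  have hk : ∀ k : Fin (2 ^ n + 1), (k : ℕ) * 2 ^ 1 < 2 ^ (n + 1) + 1 := fun k => by
    have := k.2; rw [pow_succ]; omega
  have : sk P V T n = (fun z : Fin (2 ^ (n + 1) + 1) → ℝ × ℝ => fun k : Fin (2 ^ n + 1) => z ⟨k * 2 ^ 1, hk k⟩) ∘ sk P V T (n + 1) := by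
    funext ω k
    simp only [sk, Function.comp]
    rw [gr_scale]
  unfold skA
  rw [this, ← MeasurableSpace.comap_comp]
  exact MeasurableSpace.comap_mono (Measurable.comap_le (measurable_pi_lambda _ fun k => measurable_pi_apply _))

lemma Core.sk_inter (H : Core μ F B₁ B₂ Y ρ σ lam y) (h1 : SI μ B₁ B₂ Y 1 (-Complex.I) W₁) (h2 : SI μ B₁ B₂ Y (-Complex.I) 1 W₂)
    (hV : SI μ B₁ B₂ Y (ρ + σ * Complex.I) (σ + ρ * Complex.I) V)
    {T : ℝ} (hT : 0 ≤ T) (R : Refl μ F Y lam y T e) (n : ℕ) {A : Set ℝ} (hA : MeasurableSet A) {C : Set Ω}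
    (hC : MeasurableSet[skA (fun t ω => |Y t ω|) V T n] C) :
    μ (C ∩ {ω | Y T ω ∈ A}) = μ (C ∩ {ω | e T ω * Y T ω ∈ A}) := by
  obtain ⟨S, hS, rfl⟩ := hC
  have hlaw := H.sk_law h1 h2 hV hT (H.refl_one T) R n
  simp only [one_mul] at hlaw
  have hYm : Measurable (sk (fun t ω => e t ω * Y t ω) V T n) := sk_meas hT n
    (fun t ht => ((R.meas t ht).mono (H.pb.le _) le_rfl).mul (H.measm t)) (fun t ht => (H.SI_meas hV ht).mono (H.pb.le _) le_rfl)
  have hYm1 : Measurable (sk (fun t ω => Y t ω) V T n) := sk_meas hT n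
    (fun t ht => H.measm t) (fun t ht => (H.SI_meas hV ht).mono (H.pb.le _) le_rfl)
  set q : (Fin (2 ^ n + 1) → ℝ × ℝ) → (Fin (2 ^ n + 1) → ℝ × ℝ) := fun z k => (|(z k).1|, (z k).2) with hq
  have hqm : Measurable q := measurable_pi_lambda _ fun k => (measurable_pi_apply k).fst.abs.prodMk (measurable_pi_apply k).snd
  set D : Set (Fin (2 ^ n + 1) → ℝ × ℝ) := q ⁻¹' S ∩ {z | (z (Fin.last _)).1 ∈ A} with hD
  have hDm : MeasurableSet D := (hqm hS).inter ((measurable_pi_apply (Fin.last (2 ^ n))).fst hA)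
  have hg : gr 0 T n ((Fin.last (2 ^ n) : Fin (2 ^ n + 1)) : ℕ) = T := by rw [Fin.val_last, gr_last]
  have e1 : sk (fun t ω => |Y t ω|) V T n ⁻¹' S ∩ {ω | Y T ω ∈ A} = sk (fun t ω => Y t ω) V T n ⁻¹' D := by
    ext ω
    simp only [hD, mem_inter_iff, mem_preimage, Set.mem_ofPred_eq, sk, hq, hg]
    rfl
  have e2 : sk (fun t ω => |Y t ω|) V T n ⁻¹' S ∩ {ω | e T ω * Y T ω ∈ A} = sk (fun t ω => e t ω * Y t ω) V T n ⁻¹' D := by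
    ext ω
    have : ∀ t, |e t ω * Y t ω| = |Y t ω| := fun t => by
      rw [abs_mul]; rcases R.pm t ω with h | h <;> rw [h] <;> simp
    simp only [hD, mem_inter_iff, mem_preimage, Set.mem_ofPred_eq, sk, hq, hg, this]
    rfl
  rw [e1, e2, ← Measure.map_apply hYm1 hDm, ← Measure.map_apply hYm hDm, hlaw]

lemma Core.sk_inter' (H : Core μ F B₁ B₂ Y ρ σ lam y) (h1 : SI μ B₁ B₂ Y 1 (-Complex.I) W₁) (h2 : SI μ B₁ B₂ Y (-Complex.I) 1 W₂)
    (hV : SI μ B₁ B₂ Y (ρ + σ * Complex.I) (σ + ρ * Complex.I) V)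
    {T : ℝ} (hT : 0 ≤ T) (R : Refl μ F Y lam y T e) {A : Set ℝ} (hA : MeasurableSet A) {C : Set Ω}
    (hC : MeasurableSet[⨆ n, skA (fun t ω => |Y t ω|) V T n] C) :
    μ (C ∩ {ω | Y T ω ∈ A}) = μ (C ∩ {ω | e T ω * Y T ω ∈ A}) := by
  have hle : ∀ n, skA (fun t ω => |Y t ω|) V T n ≤ m := fun n => Measurable.comap_le (sk_meas hT n
    (fun t ht => (H.measm t).abs) (fun t ht => (H.SI_meas hV ht).mono (H.pb.le _) le_rfl))
  have hle' : (⨆ n, skA (fun t ω => |Y t ω|) V T n) ≤ m := iSup_le hle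
  have key := ext_on_measurableSpace_of_generate_finite m (μ := μ.restrict {ω | Y T ω ∈ A}) (ν := μ.restrict {ω | e T ω * Y T ω ∈ A})
    (⋃ n, {C | MeasurableSet[skA (fun t ω => |Y t ω|) V T n] C}) ?_ hle' (MeasurableSpace.generateFrom_iUnion_measurableSet _).symm
    (isPiSystem_iUnion_of_monotone _ (fun n => @MeasurableSpace.isPiSystem_measurableSet _ (skA (fun t ω => |Y t ω|) V T n)) (fun a b hab s hs => skA_mono _ _ _ hab s hs)) ?_ hC
  · rwa [Measure.restrict_apply (hle' _ hC), Measure.restrict_apply (hle' _ hC)] at key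
  · intro s hs
    obtain ⟨n, hn⟩ := mem_iUnion.1 hs
    have hn : MeasurableSet[skA (fun t ω => |Y t ω|) V T n] s := hn
    rw [Measure.restrict_apply (hle n _ hn), Measure.restrict_apply (hle n _ hn)]
    exact H.sk_inter h1 h2 hV hT R n hA hn
  · rw [Measure.restrict_apply MeasurableSet.univ, Measure.restrict_apply MeasurableSet.univ]
    exact H.sk_inter h1 h2 hV hT R 0 hA (@MeasurableSet.univ _ (skA (fun t ω => |Y t ω|) V T 0))

lemma sk_gen {P V : ℝ → Ω → ℝ} {T : ℝ} (n k : ℕ) (hk : k ≤ 2 ^ n) :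
    Measurable[⨆ n, skA P V T n] (P (gr 0 T n k)) ∧ Measurable[⨆ n, skA P V T n] (V (gr 0 T n k)) := by
  have h : Measurable[⨆ n, skA P V T n] (sk P V T n) := (Measurable.of_comap_le (le_iSup (skA P V T) n))
  have h' := (measurable_pi_apply (⟨k, Nat.lt_succ_of_le hk⟩ : Fin (2 ^ n + 1))).comp h
  exact ⟨measurable_fst.comp h', measurable_snd.comp h'⟩

lemma natFilt_sk {P V : ℝ → Ω → ℝ} {T : ℝ} (hP : ∀ᵐ ω ∂μ, Continuous fun t => P t ω) (hV : ∀ᵐ ω ∂μ, Continuous fun t => V t ω) :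
    natFilt μ (fun s ω => (P s ω, V s ω)) T ≤ augSA μ (⨆ n, skA P V T n) := by
  have hN := nullC_augSA (⨆ n, skA P V T n) μ
  have hle : (⨆ n, skA P V T n) ≤ augSA μ (⨆ n, skA P V T n) := le_sup_left
  refine natFilt_le_iff hN ?_ ?_
  · intro s hs
    rcases hs.1.eq_or_lt with h | h
    · have := (sk_gen (P := P) (V := V) (T := T) 0 0 (by simp)).1.mono hle le_rfl
      rwa [gr_zero, h] at this
    · have hm : s ∈ Ioc 0 T := ⟨h, hs.2⟩
      refine hN.lim_ae (f := fun n => P (gr 0 T n (idx 0 T n s))) (fun n => (sk_gen n _ (idx_spec n hm).1.le).1.mono hle le_rfl) ?_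
      filter_upwards [hP] with ω hω
      exact (hω.tendsto s).comp (gr_idx_tendsto hm tendsto_id)
  · intro s hs
    rcases hs.1.eq_or_lt with h | h
    · have := (sk_gen (P := P) (V := V) (T := T) 0 0 (by simp)).2.mono hle le_rfl
      rwa [gr_zero, h] at this
    · have hm : s ∈ Ioc 0 T := ⟨h, hs.2⟩
      refine hN.lim_ae (f := fun n => V (gr 0 T n (idx 0 T n s))) (fun n => (sk_gen n _ (idx_spec n hm).1.le).2.mono hle le_rfl) ?_
      filter_upwards [hV] with ω hω
      exact (hω.tendsto s).comp (gr_idx_tendsto hm tendsto_id)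

lemma Core.no_hit (H : Core μ F B₁ B₂ Y ρ σ lam y) (h1 : SI μ B₁ B₂ Y 1 (-Complex.I) W₁) (h2 : SI μ B₁ B₂ Y (-Complex.I) 1 W₂)
    (hV : SI μ B₁ B₂ Y (ρ + σ * Complex.I) (σ + ρ * Complex.I) V)
    {T : ℝ} (hT : 0 ≤ T) {A : Set ℝ} (hA : MeasurableSet A) (hA' : ∀ x ∈ A, -x ∉ A)
    (hm : MeasurableSet[augSA μ (⨆ n, skA (fun t ω => |Y t ω|) V T n)] {ω | Y T ω ∈ A}) :
    ∀ᵐ ω ∂μ, Y T ω ∈ A → hit (fun r => Y r ω) T = 1 := by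
  obtain ⟨C, hC, hCD⟩ := augSA_ae hm
  have key := H.sk_inter' h1 h2 hV hT (H.refl_hit hT) hA hC
  set D := {ω | Y T ω ∈ A} with hDdef
  have hD : MeasurableSet D := H.measm T hA
  have hhm : Measurable fun ω => hit (fun r => Y r ω) T := (H.hit_meas hT).mono (H.pb.le _) le_rfl
  have hE : MeasurableSet {ω | hit (fun r => Y r ω) T = 1} := hhm (measurableSet_singleton 1)
  have k1 : μ (C ∩ D) = μ D := by
    rw [measure_congr (hCD.symm.inter (ae_eq_refl D)), inter_self]
  have k2 : μ (C ∩ {ω | hit (fun r => Y r ω) T * Y T ω ∈ A}) = μ (D ∩ {ω | hit (fun r => Y r ω) T = 1}) := by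
    rw [measure_congr (hCD.symm.inter (ae_eq_refl {ω | hit (fun r => Y r ω) T * Y T ω ∈ A}))]
    congr 1
    ext ω
    simp only [hDdef, mem_inter_iff, Set.mem_ofPred_eq]
    constructor
    · rintro ⟨ha, hb⟩
      refine ⟨ha, ?_⟩
      rcases hit_or (fun r => Y r ω) T with h | h
      · exact h
      · rw [h, neg_one_mul] at hb; exact absurd hb (hA' _ ha)
    · rintro ⟨ha, hb⟩
      exact ⟨ha, by rw [hb, one_mul]; exact ha⟩
  rw [k1, k2] at key
  have h3 : μ (D \ {ω | hit (fun r => Y r ω) T = 1}) = 0 := by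
    have := measure_inter_add_diff (μ := μ) D hE
    rw [key] at this
    exact (ENNReal.add_right_inj (measure_ne_top μ (D ∩ {ω | hit (fun r => Y r ω) T = 1}))).1 (by rw [add_zero]; exact this)
  filter_upwards [measure_eq_zero_iff_ae_notMem.1 h3] with ω hω hω'
  by_contra hne
  exact hω ⟨hω', hne⟩

lemma Core.WW_law (H : Core μ F B₁ B₂ Y ρ σ lam y) (h1 : SI μ B₁ B₂ Y 1 (-Complex.I) W₁) (h2 : SI μ B₁ B₂ Y (-Complex.I) 1 W₂)
    {T : ℝ} (hT : 0 < T) {U : Set ℝ} (hU : MeasurableSet U) (hU' : volume U ≠ 0) : μ {ω | WW Y lam y T ω ∈ U} ≠ 0 := by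
  have hP := H.SI_PB h1 h2
  set Z : Ω → ℝ := fun ω => ρ * (W₁ T ω - W₁ 0 ω) + σ * (W₂ T ω - W₂ 0 ω) with hZ
  have a1 := (hP.meas₁ _ le_rfl).mono (hP.le _) le_rfl
  have a2 := (hP.meas₁ _ hT.le).mono (hP.le _) le_rfl
  have a3 := (hP.meas₂ _ le_rfl).mono (hP.le _) le_rfl
  have a4 := (hP.meas₂ _ hT.le).mono (hP.le _) le_rfl
  have hZm : Measurable Z := ((a2.sub a1).const_mul ρ).add ((a4.sub a3).const_mul σ)
  have := Measure.isProbabilityMeasure_map (μ := μ) hZm.aemeasurable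
  have hlaw : μ.map Z = gaussianReal 0 T.toNNReal := by
    refine Measure.ext_of_charFun ?_
    funext θ
    rw [charFun_gaussianReal, charFun_apply_real, integral_map hZm.aemeasurable (by fun_prop)]
    have := hP.cf 0 T le_rfl hT.le (θ * ρ) (θ * σ) (fun _ => 1) (@measurable_const _ _ _ (F 0) _) 1 (by simp)
    simp only [one_mul, integral_const, probReal_univ, one_smul, mul_one] at this
    have e2 : ((θ * ρ) ^ 2 + (θ * σ) ^ 2) * (T - 0) / 2 = T * θ ^ 2 / 2 := by
      have : (θ * ρ) ^ 2 + (θ * σ) ^ 2 = θ ^ 2 * (ρ ^ 2 + σ ^ 2) := by ring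
      rw [this, H.norm]; ring
    rw [e2] at this
    have hT' : ((T.toNNReal : NNReal) : ℂ) = (T : ℂ) := by
      exact congrArg (fun x : ℝ => (x : ℂ)) (Real.coe_toNNReal T hT.le)
    calc _ = ∫ ω, Complex.exp (Complex.I * ((θ * ρ * (W₁ T ω - W₁ 0 ω) + θ * σ * (W₂ T ω - W₂ 0 ω) : ℝ) : ℂ)) ∂μ := by
          congr 1; funext ω; congr 1; rw [hZ]; push_cast; ring
      _ = _ := by rw [this]; congr 1; push_cast [hT']; simp
  have hW : SI μ B₁ B₂ Y (ρ - σ * Complex.I) (σ - ρ * Complex.I) (fun t ω => ρ * W₁ t ω + σ * W₂ t ω) := by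
    have := h1.lin h2 ρ σ
    convert this using 1 <;> ring
  have hae : ∀ᵐ ω ∂μ, WW Y lam y T ω = Z ω := by
    filter_upwards [H.W.unique hW hT.le, h1.zero, h2.zero] with ω e0 e1 e2
    rw [e0, hZ]; simp only [e1, e2, sub_zero]
  have e3 : μ {ω | WW Y lam y T ω ∈ U} = μ.map Z U := by
    rw [Measure.map_apply hZm hU]
    refine measure_congr ?_
    filter_upwards [hae] with ω hω
    exact propext (by change WW Y lam y T ω ∈ U ↔ Z ω ∈ U; rw [hω])
  rw [e3, hlaw]
  intro h0
  exact hU' (gaussianReal_absolutelyContinuous' 0 (by simpa using hT) h0)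

/-- The sign of `Y` is not encoded in `(|Y|, V)`. -/
lemma Core.strict (H : Core μ F B₁ B₂ Y ρ σ lam y) (h1 : SI μ B₁ B₂ Y 1 (-Complex.I) W₁) (h2 : SI μ B₁ B₂ Y (-Complex.I) 1 W₂)
    (hV : SI μ B₁ B₂ Y (ρ + σ * Complex.I) (σ + ρ * Complex.I) V) (hVc : ∀ᵐ ω ∂μ, Continuous fun t => V t ω)
    {T : ℝ} (hT : 0 < T) : ¬ Measurable[natFilt μ (fun s ω => (|Y s ω|, V s ω)) T] (Y T) := by
  intro hm
  have hm' : Measurable[augSA μ (⨆ n, skA (fun t ω => |Y t ω|) V T n)] (Y T) :=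
    hm.mono (natFilt_sk (Eventually.of_forall fun ω => (H.cont ω).abs) hVc) le_rfl
  have p1 := H.no_hit h1 h2 hV hT.le (A := Ioi 0) measurableSet_Ioi (fun x hx => by simp at hx ⊢; exact hx.le) (hm' measurableSet_Ioi)
  have p2 := H.no_hit h1 h2 hV hT.le (A := Iio 0) measurableSet_Iio (fun x hx => by simp at hx ⊢; exact hx.le) (hm' measurableSet_Iio)
  have hAA : ∀ ω, |lam * AA Y T ω| ≤ lam * T := by
    intro ω
    have := AA_lip H.cont 0 T ω
    simp only [AA, intervalIntegral.integral_same, sub_zero, abs_of_pos hT] at this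
    rw [abs_mul, abs_of_pos H.lam_pos]
    exact mul_le_mul_of_nonneg_left this H.lam_pos.le
  rcases lt_or_ge 0 y with hy | hy
  · refine H.WW_law h1 h2 hT (U := Iio (-y - lam * T)) measurableSet_Iio (by simp) (measure_eq_zero_iff_ae_notMem.2 ?_)
    filter_upwards [p2, H.Y0] with ω hω h0 hlt
    have hlt : WW Y lam y T ω < -y - lam * T := hlt
    have := abs_le.1 (hAA ω)
    have hneg : Y T ω < 0 := by unfold WW at hlt; linarith
    have hh := hω hneg
    obtain ⟨r, hr, hr0⟩ := intermediate_value_Icc' hT.le (H.cont ω).continuousOn (show (0:ℝ) ∈ Icc (Y T ω) (Y 0 ω) from ⟨hneg.le, by rw [h0]; exact hy.le⟩)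
    have : hit (fun r => Y r ω) T = -1 := by unfold hit; rw [if_pos ⟨r, hr, hr0⟩]
    rw [this] at hh; norm_num at hh
  · refine H.WW_law h1 h2 hT (U := Ioi (-y + lam * T)) measurableSet_Ioi (by simp) (measure_eq_zero_iff_ae_notMem.2 ?_)
    filter_upwards [p1, H.Y0] with ω hω h0 hlt
    have hlt : -y + lam * T < WW Y lam y T ω := hlt
    have := abs_le.1 (hAA ω)
    have hpos : 0 < Y T ω := by unfold WW at hlt; linarith
    have hh := hω hpos
    obtain ⟨r, hr, hr0⟩ := intermediate_value_Icc hT.le (H.cont ω).continuousOn (show (0:ℝ) ∈ Icc (Y 0 ω) (Y T ω) from ⟨by rw [h0]; exact hy, hpos.le⟩)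
    have : hit (fun r => Y r ω) T = -1 := by unfold hit; rw [if_pos ⟨r, hr, hr0⟩]
    rw [this] at hh; norm_num at hh

end strict


section groups

variable {Ω : Type*} {𝒢 : MeasurableSpace Ω} [m : MeasurableSpace Ω]

structure Sys (μ : Measure Ω) (F : ℝ → MeasurableSpace Ω) (B₁ B₂ Yc Y S X₁ X₂ W₁ W₂ V₁ V₂ : ℝ → Ω → ℝ) (ρ σ lam y c d : ℝ) : Prop where
  H : Core μ F B₁ B₂ Yc ρ σ lam y
  hY : ∀ t, 0 ≤ t → Yc t =ᵐ[μ] Y t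
  w1 : SI μ B₁ B₂ Yc 1 (-Complex.I) W₁
  w2 : SI μ B₁ B₂ Yc (-Complex.I) 1 W₂
  v1 : SI μ B₁ B₂ Yc 1 Complex.I V₁
  v2 : SI μ B₁ B₂ Yc Complex.I 1 V₂
  s : SI μ B₁ B₂ Yc (ρ + σ * Complex.I) (σ + ρ * Complex.I) S
  sc : ∀ᵐ ω ∂μ, Continuous fun t => S t ω
  diff : ∀ t ω, Y t ω = X₁ t ω - X₂ t ω
  sum : ∀ t ω, X₁ t ω + X₂ t ω = S t ω + c * t + d

variable {μ : Measure Ω} [IsProbabilityMeasure μ] {F : ℝ → MeasurableSpace Ω} {B₁ B₂ Yc Y S X₁ X₂ W₁ W₂ V₁ V₂ : ℝ → Ω → ℝ}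
  {ρ σ lam y c d : ℝ}

lemma Ad.fn {Ω : Type*} {𝒢 : MeasurableSpace Ω} {T : ℝ} {P Q : ℝ → Ω → ℝ} (hP : Ad 𝒢 T P) (h : ∀ t ω, Q t ω = P t ω) : Ad 𝒢 T Q := by
  have : Q = P := by funext t ω; exact h t ω
  rwa [this]

lemma Ad.abs {Ω : Type*} {𝒢 : MeasurableSpace Ω} {T : ℝ} {P : ℝ → Ω → ℝ} (hP : Ad 𝒢 T P) : Ad 𝒢 T (fun t ω => |P t ω|) :=
  fun s hs => (hP s hs).abs

lemma Ad.drift {Ω : Type*} {𝒢 : MeasurableSpace Ω} {T : ℝ} {P : ℝ → Ω → ℝ} (hP : Ad 𝒢 T P) (c d : ℝ) : Ad 𝒢 T (fun t ω => P t ω + c * t + d) :=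
  fun s hs => ((hP s hs).add_const _).add_const _

abbrev Sys' (μ : Measure Ω) (F : ℝ → MeasurableSpace Ω) (B₁ B₂ Yc Y S X₁ X₂ W₁ W₂ V₁ V₂ : ℝ → Ω → ℝ) (ρ σ lam y c d : ℝ) : Prop :=
  Sys μ F B₁ B₂ Yc Y S X₁ X₂ W₁ W₂ V₁ V₂ ρ σ lam y c d

variable {T : ℝ}


lemma Sys.toY (Z : Sys' μ F B₁ B₂ Yc Y S X₁ X₂ W₁ W₂ V₁ V₂ ρ σ lam y c d) (h𝒢 : NullC μ 𝒢) (h : Ad 𝒢 T Yc) : Ad 𝒢 T Y := h.congr h𝒢 Z.hY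
lemma Sys.ofY (Z : Sys' μ F B₁ B₂ Yc Y S X₁ X₂ W₁ W₂ V₁ V₂ ρ σ lam y c d) (h𝒢 : NullC μ 𝒢) (h : Ad 𝒢 T Y) : Ad 𝒢 T Yc := h.congr h𝒢 fun t ht => (Z.hY t ht).symm
lemma Sys.toA (Z : Sys' μ F B₁ B₂ Yc Y S X₁ X₂ W₁ W₂ V₁ V₂ ρ σ lam y c d) (h𝒢 : NullC μ 𝒢) (h : Ad 𝒢 T (fun t ω => |Yc t ω|)) : Ad 𝒢 T (fun t ω => |Y t ω|) :=
  h.congr h𝒢 fun t ht => by filter_upwards [Z.hY t ht] with ω hω; rw [hω]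
lemma Sys.ofA (Z : Sys' μ F B₁ B₂ Yc Y S X₁ X₂ W₁ W₂ V₁ V₂ ρ σ lam y c d) (h𝒢 : NullC μ 𝒢) (h : Ad 𝒢 T (fun t ω => |Y t ω|)) : Ad 𝒢 T (fun t ω => |Yc t ω|) :=
  h.congr h𝒢 fun t ht => by filter_upwards [Z.hY t ht] with ω hω; rw [hω]

lemma Sys.vfl (Z : Sys' μ F B₁ B₂ Yc Y S X₁ X₂ W₁ W₂ V₁ V₂ ρ σ lam y c d) : SI μ B₁ B₂ Yc (ρ - σ * Complex.I) (-(σ - ρ * Complex.I)) (fun t ω => ρ * V₁ t ω + (-σ) * V₂ t ω) := by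
  have := Z.v1.lin Z.v2 ρ (-σ)
  convert this using 1 <;> push_cast <;> ring

lemma Sys.svV (Z : Sys' μ F B₁ B₂ Yc Y S X₁ X₂ W₁ W₂ V₁ V₂ ρ σ lam y c d) : ∀ t, 0 ≤ t → S t =ᵐ[μ] (fun ω => ρ * V₁ t ω + σ * V₂ t ω) := by
  have : SI μ B₁ B₂ Yc (ρ + σ * Complex.I) (σ + ρ * Complex.I) (fun t ω => ρ * V₁ t ω + σ * V₂ t ω) := by
    have := Z.v1.lin Z.v2 ρ σ
    convert this using 1 <;> ring
  exact fun t ht => Z.s.unique this ht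

lemma Sys.wW (Z : Sys' μ F B₁ B₂ Yc Y S X₁ X₂ W₁ W₂ V₁ V₂ ρ σ lam y c d) : ∀ t, 0 ≤ t → WW Yc lam y t =ᵐ[μ] (fun ω => ρ * W₁ t ω + σ * W₂ t ω) := by
  have : SI μ B₁ B₂ Yc (ρ - σ * Complex.I) (σ - ρ * Complex.I) (fun t ω => ρ * W₁ t ω + σ * W₂ t ω) := by
    have := Z.w1.lin Z.w2 ρ σ
    convert this using 1 <;> ring
  exact fun t ht => Z.H.W.unique this ht

/-! group 1 -/

lemma Sys.a1 (Z : Sys' μ F B₁ B₂ Yc Y S X₁ X₂ W₁ W₂ V₁ V₂ ρ σ lam y c d) (h𝒢 : NullC μ 𝒢) (h1 : Ad 𝒢 T V₁) (h2 : Ad 𝒢 T V₂) : Ad 𝒢 T (fun t ω => |Y t ω|) :=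
  Z.toA h𝒢 (Z.H.ad_absY h𝒢 Z.vfl (h1.lin h2 ρ (-σ)))

lemma Sys.c1 (Z : Sys' μ F B₁ B₂ Yc Y S X₁ X₂ W₁ W₂ V₁ V₂ ρ σ lam y c d) (h𝒢 : NullC μ 𝒢) (h1 : Ad 𝒢 T (fun t ω => |Y t ω|)) (h2 : Ad 𝒢 T (fun t ω => ρ * V₁ t ω + σ * V₂ t ω)) :
    Ad 𝒢 T V₁ ∧ Ad 𝒢 T V₂ := by
  have h3 := Z.H.ad_Vfl h𝒢 Z.vfl (Z.ofA h𝒢 h1)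
  have hρ := Z.H.hρ
  have hσ := Z.H.hσ
  refine ⟨(h2.lin h3 (1 / (2 * ρ)) (1 / (2 * ρ))).fn fun t ω => ?_, (h2.lin h3 (1 / (2 * σ)) (-(1 / (2 * σ)))).fn fun t ω => ?_⟩
  · field_simp; ring
  · field_simp; ring

lemma Sys.d1 (Z : Sys' μ F B₁ B₂ Yc Y S X₁ X₂ W₁ W₂ V₁ V₂ ρ σ lam y c d) (h𝒢 : NullC μ 𝒢) (h1 : Ad 𝒢 T (fun t ω => |Y t ω|)) (h2 : Ad 𝒢 T (fun t ω => σ * V₁ t ω + ρ * V₂ t ω)) :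
    Ad 𝒢 T V₁ ∧ Ad 𝒢 T V₂ := by
  have h3 := Z.H.ad_Vfl h𝒢 Z.vfl (Z.ofA h𝒢 h1)
  have hn := Z.H.norm
  refine ⟨(h3.lin h2 ρ σ).fn fun t ω => ?_, (h3.lin h2 (-σ) ρ).fn fun t ω => ?_⟩
  · linear_combination (-V₁ t ω) * hn
  · linear_combination (-V₂ t ω) * hn

lemma Sys.b1 (Z : Sys' μ F B₁ B₂ Yc Y S X₁ X₂ W₁ W₂ V₁ V₂ ρ σ lam y c d) (h𝒢 : NullC μ 𝒢) (h1 : Ad 𝒢 T (fun t ω => max (X₁ t ω) (X₂ t ω))) (h2 : Ad 𝒢 T (fun t ω => min (X₁ t ω) (X₂ t ω))) :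
    Ad 𝒢 T (fun t ω => |Y t ω|) ∧ Ad 𝒢 T (fun t ω => ρ * V₁ t ω + σ * V₂ t ω) := by
  refine ⟨(h1.lin h2 1 (-1)).fn fun t ω => ?_, ?_⟩
  · rw [Z.diff, ← max_sub_min_eq_abs]
    rw [max_comm, min_comm]; ring
  · refine Ad.congr h𝒢 (P := S) (((h1.lin h2 1 1).drift (-c) (-d)).fn fun t ω => ?_) Z.svV
    have := max_add_min (X₁ t ω) (X₂ t ω)
    have := Z.sum t ω
    linarith

lemma Sys.toS (Z : Sys' μ F B₁ B₂ Yc Y S X₁ X₂ W₁ W₂ V₁ V₂ ρ σ lam y c d) (h𝒢 : NullC μ 𝒢) (h1 : Ad 𝒢 T V₁) (h2 : Ad 𝒢 T V₂) : Ad 𝒢 T S :=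
  (h1.lin h2 ρ σ).congr h𝒢 fun t ht => (Z.svV t ht).symm

lemma Sys.e1 (Z : Sys' μ F B₁ B₂ Yc Y S X₁ X₂ W₁ W₂ V₁ V₂ ρ σ lam y c d) (h𝒢 : NullC μ 𝒢) (h1 : Ad 𝒢 T V₁) (h2 : Ad 𝒢 T V₂) :
    Ad 𝒢 T (fun t ω => max (X₁ t ω) (X₂ t ω)) ∧ Ad 𝒢 T (fun t ω => min (X₁ t ω) (X₂ t ω)) := by
  have hS := (Z.toS h𝒢 h1 h2).drift c d
  have hA := Z.a1 h𝒢 h1 h2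
  have e1 : ∀ t ω, max (X₁ t ω) (X₂ t ω) - min (X₁ t ω) (X₂ t ω) = |Y t ω| := fun t ω => by
    rw [Z.diff, ← max_sub_min_eq_abs, max_comm, min_comm]
  refine ⟨(hS.lin hA (1 / 2) (1 / 2)).fn fun t ω => ?_, (hS.lin hA (1 / 2) (-(1 / 2))).fn fun t ω => ?_⟩
  · have := max_add_min (X₁ t ω) (X₂ t ω)
    have := Z.sum t ω
    have := e1 t ω
    linarith
  · have := max_add_min (X₁ t ω) (X₂ t ω)
    have := Z.sum t ω
    have := e1 t ω
    linarith

/-! group 2 -/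

lemma Sys.yW (Z : Sys' μ F B₁ B₂ Yc Y S X₁ X₂ W₁ W₂ V₁ V₂ ρ σ lam y c d) (h𝒢 : NullC μ 𝒢) (h : Ad 𝒢 T Y) : Ad 𝒢 T (fun t ω => ρ * W₁ t ω + σ * W₂ t ω) :=
  (Z.H.ad_W (Z.ofY h𝒢 h)).congr h𝒢 Z.wW

lemma Sys.wY (Z : Sys' μ F B₁ B₂ Yc Y S X₁ X₂ W₁ W₂ V₁ V₂ ρ σ lam y c d) (h𝒢 : NullC μ 𝒢) (h : Ad 𝒢 T (fun t ω => ρ * W₁ t ω + σ * W₂ t ω)) : Ad 𝒢 T Y :=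
  Z.toY h𝒢 (Z.H.ad_Y h𝒢 (h.congr h𝒢 fun t ht => (Z.wW t ht).symm))

lemma Sys.vw (Z : Sys' μ F B₁ B₂ Yc Y S X₁ X₂ W₁ W₂ V₁ V₂ ρ σ lam y c d) (h𝒢 : NullC μ 𝒢) (h : Ad 𝒢 T Y) (h1 : Ad 𝒢 T V₁) (h2 : Ad 𝒢 T V₂) : Ad 𝒢 T W₁ ∧ Ad 𝒢 T W₂ := by
  have hc := Z.ofY h𝒢 h
  refine ⟨Z.H.ad_psgn h𝒢 Z.v1 Z.w1 hc h1, ?_⟩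
  have := Z.w2.neg
  rw [neg_neg] at this
  have h3 := Z.H.ad_psgn h𝒢 Z.v2 this hc h2
  exact (h3.lin h3 (-1) 0).fn fun t ω => by ring

lemma Sys.wv (Z : Sys' μ F B₁ B₂ Yc Y S X₁ X₂ W₁ W₂ V₁ V₂ ρ σ lam y c d) (h𝒢 : NullC μ 𝒢) (h : Ad 𝒢 T Y) (h1 : Ad 𝒢 T W₁) (h2 : Ad 𝒢 T W₂) : Ad 𝒢 T V₁ ∧ Ad 𝒢 T V₂ := by
  have hc := Z.ofY h𝒢 h
  refine ⟨Z.H.ad_psgn h𝒢 Z.w1 (by rw [neg_neg]; exact Z.v1) hc h1, ?_⟩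
  have h3 := Z.H.ad_psgn h𝒢 Z.w2 Z.v2.neg hc h2
  exact (h3.lin h3 (-1) 0).fn fun t ω => by ring

lemma Sys.wall (Z : Sys' μ F B₁ B₂ Yc Y S X₁ X₂ W₁ W₂ V₁ V₂ ρ σ lam y c d) (h𝒢 : NullC μ 𝒢) (h1 : Ad 𝒢 T W₁) (h2 : Ad 𝒢 T W₂) : Ad 𝒢 T Y ∧ Ad 𝒢 T V₁ ∧ Ad 𝒢 T V₂ := by
  have := Z.wY h𝒢 (h1.lin h2 ρ σ)
  exact ⟨this, Z.wv h𝒢 this h1 h2⟩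

lemma Sys.wu (Z : Sys' μ F B₁ B₂ Yc Y S X₁ X₂ W₁ W₂ V₁ V₂ ρ σ lam y c d) (h1 : Ad 𝒢 T (fun t ω => ρ * W₁ t ω + σ * W₂ t ω)) (h2 : Ad 𝒢 T (fun t ω => σ * W₁ t ω - ρ * W₂ t ω)) : Ad 𝒢 T W₁ ∧ Ad 𝒢 T W₂ := by
  have hn := Z.H.norm
  refine ⟨(h1.lin h2 ρ σ).fn fun t ω => ?_, (h1.lin h2 σ (-ρ)).fn fun t ω => ?_⟩
  · linear_combination (-W₁ t ω) * hn
  · linear_combination (-W₂ t ω) * hn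

lemma Sys.xY (Z : Sys' μ F B₁ B₂ Yc Y S X₁ X₂ W₁ W₂ V₁ V₂ ρ σ lam y c d) (h𝒢 : NullC μ 𝒢) (h1 : Ad 𝒢 T X₁) (h2 : Ad 𝒢 T X₂) : Ad 𝒢 T Y ∧ Ad 𝒢 T (fun t ω => ρ * V₁ t ω + σ * V₂ t ω) := by
  refine ⟨(h1.lin h2 1 (-1)).fn fun t ω => ?_, ?_⟩
  · rw [Z.diff]; ring
  · refine Ad.congr h𝒢 (P := S) (((h1.lin h2 1 1).drift (-c) (-d)).fn fun t ω => ?_) Z.svV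
    have := Z.sum t ω
    linarith

lemma Sys.yX (Z : Sys' μ F B₁ B₂ Yc Y S X₁ X₂ W₁ W₂ V₁ V₂ ρ σ lam y c d) (h𝒢 : NullC μ 𝒢) (h : Ad 𝒢 T Y) (h1 : Ad 𝒢 T V₁) (h2 : Ad 𝒢 T V₂) : Ad 𝒢 T X₁ ∧ Ad 𝒢 T X₂ := by
  have hS := (Z.toS h𝒢 h1 h2).drift c d
  refine ⟨(hS.lin h (1 / 2) (1 / 2)).fn fun t ω => ?_, (hS.lin h (1 / 2) (-(1 / 2))).fn fun t ω => ?_⟩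
  · have := Z.sum t ω
    have := Z.diff t ω
    linarith
  · have := Z.sum t ω
    have := Z.diff t ω
    linarith

end groups


section groups2

variable {Ω : Type*} [m : MeasurableSpace Ω]

/-- a boxed sigma-algebra (avoids instance clashes) -/
structure SigA (Ω : Type*) where
  ms : MeasurableSpace Ω

lemma nf_le {μ : Measure Ω} {P Q P' Q' : ℝ → Ω → ℝ} {T : ℝ}
    (h : ∀ 𝒢 : SigA Ω, NullC μ 𝒢.ms → Ad 𝒢.ms T P → Ad 𝒢.ms T Q → Ad 𝒢.ms T P' ∧ Ad 𝒢.ms T Q') :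
    natFilt μ (fun s ω => (P' s ω, Q' s ω)) T ≤ natFilt μ (fun s ω => (P s ω, Q s ω)) T := by
  have hn : NullC μ (natFilt μ (fun s ω => (P s ω, Q s ω)) T) := nullC_augSA _ μ
  have := h ⟨_⟩ hn (fun s hs => (natFilt_meas μ P Q hs).1) (fun s hs => (natFilt_meas μ P Q hs).2)
  exact natFilt_le_iff hn this.1 this.2

variable {μ : Measure Ω} [IsProbabilityMeasure μ] {F : ℝ → MeasurableSpace Ω} {B₁ B₂ Yc Y S X₁ X₂ W₁ W₂ V₁ V₂ W Ufl V Q : ℝ → Ω → ℝ}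
  {ρ σ lam y c d : ℝ}

lemma Ad.sub' {Ω : Type*} {𝒢 : MeasurableSpace Ω} {T : ℝ} {P Q : ℝ → Ω → ℝ} {a b : ℝ} (hP : Ad 𝒢 T P) (hQ : Ad 𝒢 T Q) :
    Ad 𝒢 T (fun t ω => a * P t ω - b * Q t ω) :=
  (hP.lin hQ a (-b)).fn fun t ω => by ring

theorem Sys.final (Z : Sys μ F B₁ B₂ Yc Y S X₁ X₂ W₁ W₂ V₁ V₂ ρ σ lam y c d)
    (hWdef : ∀ t ω, W t ω = ρ * W₁ t ω + σ * W₂ t ω)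
    (hUfl : ∀ t ω, Ufl t ω = σ * W₁ t ω - ρ * W₂ t ω)
    (hVdef : ∀ t ω, V t ω = ρ * V₁ t ω + σ * V₂ t ω)
    (hQ : ∀ t ω, Q t ω = σ * V₁ t ω + ρ * V₂ t ω) :
    ∀ t : ℝ, 0 < t →
      natFilt μ (fun s ω => (V₁ s ω, V₂ s ω)) t =
          natFilt μ (fun s ω => (max (X₁ s ω) (X₂ s ω), min (X₁ s ω) (X₂ s ω))) t ∧
      natFilt μ (fun s ω => (max (X₁ s ω) (X₂ s ω), min (X₁ s ω) (X₂ s ω))) t =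
          natFilt μ (fun s ω => (|Y s ω|, V s ω)) t ∧
      natFilt μ (fun s ω => (|Y s ω|, V s ω)) t =
          natFilt μ (fun s ω => (|Y s ω|, Q s ω)) t ∧
      natFilt μ (fun s ω => (|Y s ω|, Q s ω)) t <
          natFilt μ (fun s ω => (X₁ s ω, X₂ s ω)) t ∧
      natFilt μ (fun s ω => (X₁ s ω, X₂ s ω)) t =
          natFilt μ (fun s ω => (W₁ s ω, W₂ s ω)) t ∧
      natFilt μ (fun s ω => (W₁ s ω, W₂ s ω)) t =
          natFilt μ (fun s ω => (Y s ω, V s ω)) t ∧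
      natFilt μ (fun s ω => (Y s ω, V s ω)) t =
          natFilt μ (fun s ω => (W s ω, Ufl s ω)) t ∧
      natFilt μ (fun s ω => (W s ω, Ufl s ω)) t =
          natFilt μ (fun s ω => (Y s ω, Ufl s ω)) t ∧
      natFilt μ (fun s ω => (Y s ω, Ufl s ω)) t =
          natFilt μ (fun s ω => (W s ω, Q s ω)) t ∧
      natFilt μ (fun s ω => (W s ω, Q s ω)) t =
          natFilt μ (fun s ω => (Y s ω, Q s ω)) t := by
  obtain rfl : W = fun t ω => ρ * W₁ t ω + σ * W₂ t ω := by funext t ω; exact hWdef t ω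
  obtain rfl : Ufl = fun t ω => σ * W₁ t ω - ρ * W₂ t ω := by funext t ω; exact hUfl t ω
  obtain rfl : V = fun t ω => ρ * V₁ t ω + σ * V₂ t ω := by funext t ω; exact hVdef t ω
  obtain rfl : Q = fun t ω => σ * V₁ t ω + ρ * V₂ t ω := by funext t ω; exact hQ t ω
  intro T hT
  -- from `Y, V₁, V₂` everything of the second group
  have all : ∀ 𝒢 : SigA Ω, NullC μ 𝒢.ms → Ad 𝒢.ms T W₁ → Ad 𝒢.ms T W₂ →
      Ad 𝒢.ms T Y ∧ Ad 𝒢.ms T V₁ ∧ Ad 𝒢.ms T V₂ := fun 𝒢 h h1 h2 => Z.wall h h1 h2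
  have vq : ∀ 𝒢 : SigA Ω, NullC μ 𝒢.ms → Ad 𝒢.ms T Y → Ad 𝒢.ms T (fun t ω => ρ * V₁ t ω + σ * V₂ t ω) →
      Ad 𝒢.ms T W₁ ∧ Ad 𝒢.ms T W₂ := fun 𝒢 h h1 h2 => by
    have := Z.c1 h h1.abs h2
    exact Z.vw h h1 this.1 this.2
  have qv : ∀ 𝒢 : SigA Ω, NullC μ 𝒢.ms → Ad 𝒢.ms T Y → Ad 𝒢.ms T (fun t ω => σ * V₁ t ω + ρ * V₂ t ω) →
      Ad 𝒢.ms T W₁ ∧ Ad 𝒢.ms T W₂ := fun 𝒢 h h1 h2 => by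
    have := Z.d1 h h1.abs h2
    exact Z.vw h h1 this.1 this.2
  have eR : natFilt μ (fun s ω => (V₁ s ω, V₂ s ω)) T =
          natFilt μ (fun s ω => (max (X₁ s ω) (X₂ s ω), min (X₁ s ω) (X₂ s ω))) T := by
    refine le_antisymm (nf_le (P := fun s ω => max (X₁ s ω) (X₂ s ω)) (Q := fun s ω => min (X₁ s ω) (X₂ s ω)) ?_)
      (nf_le (P' := fun s ω => max (X₁ s ω) (X₂ s ω)) (Q' := fun s ω => min (X₁ s ω) (X₂ s ω)) ?_)
    · intro 𝒢 h h1 h2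
      have := Z.b1 h h1 h2
      exact Z.c1 h this.1 this.2
    · intro 𝒢 h h1 h2
      exact Z.e1 h h1 h2
  have eV : natFilt μ (fun s ω => (V₁ s ω, V₂ s ω)) T =
          natFilt μ (fun s ω => (|Y s ω|, (fun t ω => ρ * V₁ t ω + σ * V₂ t ω) s ω)) T := by
    refine le_antisymm (nf_le (P := fun s ω => |Y s ω|) ?_) (nf_le (P' := fun s ω => |Y s ω|) ?_)
    · intro 𝒢 h h1 h2
      exact Z.c1 h h1 h2
    · intro 𝒢 h h1 h2
      exact ⟨Z.a1 h h1 h2, h1.lin h2 ρ σ⟩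
  have eQ : natFilt μ (fun s ω => (V₁ s ω, V₂ s ω)) T =
          natFilt μ (fun s ω => (|Y s ω|, (fun t ω => σ * V₁ t ω + ρ * V₂ t ω) s ω)) T := by
    refine le_antisymm (nf_le (P := fun s ω => |Y s ω|) ?_) (nf_le (P' := fun s ω => |Y s ω|) ?_)
    · intro 𝒢 h h1 h2
      exact Z.d1 h h1 h2
    · intro 𝒢 h h1 h2
      exact ⟨Z.a1 h h1 h2, h1.lin h2 σ ρ⟩
  have fX : natFilt μ (fun s ω => (X₁ s ω, X₂ s ω)) T = natFilt μ (fun s ω => (W₁ s ω, W₂ s ω)) T := by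
    refine le_antisymm (nf_le ?_) (nf_le ?_)
    · intro 𝒢 h h1 h2
      have := all 𝒢 h h1 h2
      exact Z.yX h this.1 this.2.1 this.2.2
    · intro 𝒢 h h1 h2
      have := Z.xY h h1 h2
      exact vq 𝒢 h this.1 this.2
  have fV : natFilt μ (fun s ω => (W₁ s ω, W₂ s ω)) T =
      natFilt μ (fun s ω => (Y s ω, (fun t ω => ρ * V₁ t ω + σ * V₂ t ω) s ω)) T := by
    refine le_antisymm (nf_le (vq)) (nf_le ?_)
    intro 𝒢 h h1 h2
    have := all 𝒢 h h1 h2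
    exact ⟨this.1, this.2.1.lin this.2.2 ρ σ⟩
  have fQ : natFilt μ (fun s ω => (W₁ s ω, W₂ s ω)) T =
      natFilt μ (fun s ω => (Y s ω, (fun t ω => σ * V₁ t ω + ρ * V₂ t ω) s ω)) T := by
    refine le_antisymm (nf_le (qv)) (nf_le ?_)
    intro 𝒢 h h1 h2
    have := all 𝒢 h h1 h2
    exact ⟨this.1, this.2.1.lin this.2.2 σ ρ⟩
  have fU : natFilt μ (fun s ω => (W₁ s ω, W₂ s ω)) T =
      natFilt μ (fun s ω => ((fun t ω => ρ * W₁ t ω + σ * W₂ t ω) s ω, (fun t ω => σ * W₁ t ω - ρ * W₂ t ω) s ω)) T := by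
    refine le_antisymm (nf_le (fun 𝒢 h h1 h2 => Z.wu h1 h2)) (nf_le ?_)
    intro 𝒢 h h1 h2
    exact ⟨h1.lin h2 ρ σ, h1.sub' h2⟩
  have fYU : natFilt μ (fun s ω => (W₁ s ω, W₂ s ω)) T =
      natFilt μ (fun s ω => (Y s ω, (fun t ω => σ * W₁ t ω - ρ * W₂ t ω) s ω)) T := by
    refine le_antisymm (nf_le (fun 𝒢 h h1 h2 => Z.wu (Z.yW h h1) h2)) (nf_le ?_)
    intro 𝒢 h h1 h2
    have := all 𝒢 h h1 h2
    exact ⟨this.1, h1.sub' h2⟩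
  have fWQ : natFilt μ (fun s ω => (W₁ s ω, W₂ s ω)) T =
      natFilt μ (fun s ω => ((fun t ω => ρ * W₁ t ω + σ * W₂ t ω) s ω, (fun t ω => σ * V₁ t ω + ρ * V₂ t ω) s ω)) T := by
    refine le_antisymm (nf_le (fun 𝒢 h h1 h2 => qv 𝒢 h (Z.wY h h1) h2)) (nf_le ?_)
    intro 𝒢 h h1 h2
    have := all 𝒢 h h1 h2
    exact ⟨h1.lin h2 ρ σ, this.2.1.lin this.2.2 σ ρ⟩
  have lt : natFilt μ (fun s ω => (V₁ s ω, V₂ s ω)) T < natFilt μ (fun s ω => (X₁ s ω, X₂ s ω)) T := by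
    refine lt_of_le_not_ge (nf_le ?_) ?_
    · intro 𝒢 h h1 h2
      have := Z.xY h h1 h2
      exact Z.c1 h this.1.abs this.2
    · intro hle
      have h1 : natFilt μ (fun s ω => (V₁ s ω, V₂ s ω)) T ≤ natFilt μ (fun s ω => (|Yc s ω|, S s ω)) T := by
        refine nf_le (P := fun s ω => |Yc s ω|) ?_
        intro 𝒢 h h1 h2
        exact Z.c1 h (Z.toA h h1) (h2.congr h Z.svV)
      have h2 := hle.trans h1
      refine Z.H.strict Z.w1 Z.w2 Z.s Z.sc hT ?_
      have hn : NullC μ (natFilt μ (fun s ω => (|Yc s ω|, S s ω)) T) := nullC_augSA _ μ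
      have h3 : Ad (natFilt μ (fun s ω => (|Yc s ω|, S s ω)) T) T X₁ := fun s hs =>
        ((natFilt_meas μ X₁ X₂ hs).1).mono h2 le_rfl
      have h4 : Ad (natFilt μ (fun s ω => (|Yc s ω|, S s ω)) T) T X₂ := fun s hs =>
        ((natFilt_meas μ X₁ X₂ hs).2).mono h2 le_rfl
      exact Z.ofY hn (Z.xY hn h3 h4).1 T ⟨hT.le, le_rfl⟩
  exact ⟨eR, eR.symm.trans eV, eV.symm.trans eQ, eQ ▸ lt, fX, fV, fV.symm.trans fU, fU.symm.trans fYU,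
    fYU.symm.trans fWQ, fWQ.symm.trans fQ⟩

end groups2


section build

variable {Ω : Type*} [m : MeasurableSpace Ω]
variable {μ : Measure Ω} [IsProbabilityMeasure μ] {F : ℝ → MeasurableSpace Ω} {B₁ B₂ Yc Y : ℝ → Ω → ℝ}

lemma grid_nonneg {t : ℝ} (ht : 0 ≤ t) (n i : ℕ) : 0 ≤ t * i / 2 ^ n := by positivity

lemma grid_ae (hYc : ∀ t, 0 ≤ t → Yc t =ᵐ[μ] Y t) {t : ℝ} (ht : 0 ≤ t) (n : ℕ) :
    ∀ᵐ ω ∂μ, ∀ i : ℕ, Yc (t * i / 2 ^ n) ω = Y (t * i / 2 ^ n) ω :=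
  ae_all_iff.2 fun i => hYc _ (grid_nonneg ht n i)

lemma SI_of (hYc : ∀ t, 0 ≤ t → Yc t =ᵐ[μ] Y t) {H₁ H₂ I : ℝ → Ω → ℝ} {p q : ℂ}
    (h1 : ∀ s ω, H₁ s ω = (KK p q (Y s ω)).re) (h2 : ∀ s ω, H₂ s ω = (KK p q (Y s ω)).im)
    (hI : ∀ t, 0 ≤ t → TendstoInMeasure μ (fun n ω => rsum H₁ B₁ t n ω + rsum H₂ B₂ t n ω) atTop (I t)) :
    SI μ B₁ B₂ Yc p q I := by
  intro t ht
  refine (hI t ht).congr_left fun n => ?_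
  filter_upwards [grid_ae hYc ht n] with ω hω
  unfold rsum ksum
  rw [← Finset.sum_add_distrib]
  refine Finset.sum_congr rfl fun i _ => ?_
  rw [gr_0, gr_0, hω i, h1, h2, dB]
  push_cast
  rfl

lemma SI.congr_ae {p q : ℂ} {I J : ℝ → Ω → ℝ} (hI : SI μ B₁ B₂ Yc p q I) (h : ∀ t, 0 ≤ t → I t =ᵐ[μ] J t) :
    SI μ B₁ B₂ Yc p q J := fun t ht => (hI t ht).congr_right (h t ht)

lemma rsum_psgn_congr (hYc : ∀ t, 0 ≤ t → Yc t =ᵐ[μ] Y t) {I J : ℝ → Ω → ℝ}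
    (hI : ∀ t, 0 ≤ t → TendstoInMeasure μ (fun n => rsum (fun s ω => psgn (Y s ω)) I t n) atTop (J t)) :
    ∀ t, 0 ≤ t → TendstoInMeasure μ (fun n => rsum (fun s ω => psgn (Yc s ω)) I t n) atTop (J t) := by
  intro t ht
  refine (hI t ht).congr_left fun n => ?_
  filter_upwards [grid_ae hYc ht n] with ω hω
  unfold rsum
  refine Finset.sum_congr rfl fun i _ => ?_
  simp only [hω i]

lemma drift_int {f : ℝ → ℝ} (hf : Continuous f) {u v : ℝ → ℝ} (a b : ℝ) {t : ℝ} (ht : 0 ≤ t)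
    (h : ∀ s, 0 ≤ s → f s = u s - v s) :
    ∫ s in (0:ℝ)..t, (if u s ≤ v s then a else b) = (a + b) / 2 * t + (b - a) / 2 * ∫ s in (0:ℝ)..t, psgn (f s) := by
  have e : ∫ s in (0:ℝ)..t, (if u s ≤ v s then a else b) = ∫ s in (0:ℝ)..t, ((a + b) / 2 + (b - a) / 2 * psgn (f s)) := by
    refine intervalIntegral.integral_congr fun s hs => ?_
    rw [uIcc_of_le ht] at hs
    simp only [psgn, h s hs.1]
    by_cases hc : u s ≤ v s
    · rw [if_pos hc, if_neg (by linarith)]; ring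
    · rw [if_neg hc, if_pos (by linarith)]; ring
  rw [e, intervalIntegral.integral_add intervalIntegrable_const ((psgn_intervalIntegrable hf _ _).const_mul _),
    intervalIntegral.integral_const, intervalIntegral.integral_const_mul]
  simp; ring

lemma KKre (p q : ℂ) (y : ℝ) : (KK p q y).re = if 0 < y then p.re else q.re := by
  unfold KK; split_ifs <;> rfl
lemma KKim (p q : ℂ) (y : ℝ) : (KK p q y).im = if 0 < y then p.im else q.im := by
  unfold KK; split_ifs <;> rfl

theorem main_null
    (g h ρ σ : ℝ) (hρ : 0 ≤ ρ) (hσ : 0 ≤ σ)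
    (hnorm : ρ ^ 2 + σ ^ 2 = 1) (hgh : 0 < g + h) (hnd : 0 < ρ * σ) (x₁ x₂ : ℝ)
    (hnull : NullC μ (F 0))
    {X₁ X₂ W₁ W₂ V₁ V₂ : ℝ → Ω → ℝ}
    (hBM : IsPlanarBM μ F B₁ B₂)
    (hsol : Solves11 μ F g h ρ σ x₁ x₂ B₁ B₂ X₁ X₂)
    (hYdef : ∀ t ω, Y t ω = X₁ t ω - X₂ t ω)
    (hW₁ : IsSI2 μ (fun s ω => if 0 < Y s ω then (1:ℝ) else 0) B₁
                   (fun s ω => if 0 < Y s ω then (0:ℝ) else -1) B₂ W₁)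
    (hW₂ : IsSI2 μ (fun s ω => if 0 < Y s ω then (0:ℝ) else 1) B₁
                   (fun s ω => if 0 < Y s ω then (-1:ℝ) else 0) B₂ W₂)
    (hV₁ : IsSI μ (fun s ω => psgn (Y s ω)) W₁ V₁)
    (hV₂ : IsSI μ (fun s ω => -psgn (Y s ω)) W₂ V₂) :
    ∃ Yc S : ℝ → Ω → ℝ, Sys μ F B₁ B₂ Yc Y S X₁ X₂ W₁ W₂ V₁ V₂ ρ σ (g + h) (x₁ - x₂) (g - h) (x₁ + x₂) := by
  classical
  have hρ' : 0 < ρ := lt_of_le_of_ne hρ (by rintro rfl; simp at hnd)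
  have hσ' : 0 < σ := lt_of_le_of_ne hσ (by rintro rfl; simp at hnd)
  obtain ⟨had, hcont, I₁, I₂, hI₁, hI₂, heq⟩ := hsol
  obtain rfl : Y = fun t ω => X₁ t ω - X₂ t ω := by funext t ω; exact hYdef t ω
  have hPB := planar_PB hBM
  let G : Ω → Prop := fun ω => (Continuous (fun t => X₁ t ω) ∧ Continuous (fun t => X₂ t ω)) ∧ ∀ t : ℝ, 0 ≤ t →
      X₁ t ω = x₁ + (∫ s in (0:ℝ)..t, (if X₁ s ω ≤ X₂ s ω then g else -h)) + I₁ t ω ∧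
      X₂ t ω = x₂ + (∫ s in (0:ℝ)..t, (if X₁ s ω ≤ X₂ s ω then -h else g)) + I₂ t ω
  have hG : ∀ᵐ ω ∂μ, G ω := hcont.and heq
  let Yc : ℝ → Ω → ℝ := fun t ω => if G ω then X₁ (max t 0) ω - X₂ (max t 0) ω else 0
  have hYc : ∀ t, 0 ≤ t → Yc t =ᵐ[μ] fun ω => X₁ t ω - X₂ t ω := by
    intro t ht
    filter_upwards [hG] with ω hω
    simp only [Yc, if_pos hω, max_eq_left ht]
  have hYcG : ∀ ω, G ω → ∀ s, 0 ≤ s → Yc s ω = X₁ s ω - X₂ s ω := by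
    intro ω hω s hs
    simp only [Yc, if_pos hω, max_eq_left hs]
  have hYcc : ∀ ω, Continuous fun t => Yc t ω := by
    intro ω
    by_cases hω : G ω
    · simp only [Yc, if_pos hω]
      have hm : Continuous fun t : ℝ => max t 0 := by fun_prop
      exact (hω.1.1.comp hm).sub (hω.1.2.comp hm)
    · simp only [Yc, if_neg hω]; exact continuous_const
  have hYcm : ∀ t, 0 ≤ t → Measurable[F t] (Yc t) := by
    intro t ht
    have h1 : Measurable[F t] (fun ω => X₁ t ω - X₂ t ω) := by
      have : Measurable[F t] (fun ω => (X₁ t ω, X₂ t ω)) := measurable_iff_comap_le.2 (had t ht)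
      exact (measurable_fst.sub measurable_snd).comp this
    refine (hnull.mono (hPB.mono ht)).congr h1 ?_
    exact (hYc t ht).symm
  have hYcm' : ∀ t, Measurable (Yc t) := by
    intro t
    have : Yc t = Yc (max t 0) := by
      funext ω; simp only [Yc]
      rw [max_eq_left (le_max_right t 0)]
    rw [this]
    exact (hYcm _ (le_max_right t 0)).mono (hPB.le _) le_rfl
  have sI₁ : SI μ B₁ B₂ Yc ρ σ I₁ := by
    refine SI_of (Y := fun t ω => X₁ t ω - X₂ t ω) hYc (H₁ := fun s ω => if X₁ s ω ≤ X₂ s ω then σ else ρ) (H₂ := fun _ _ => 0) ?_ ?_ ?_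
    · intro s ω
      rw [KKre]
      by_cases hc : X₁ s ω ≤ X₂ s ω
      · rw [if_pos hc, if_neg (by linarith)]; simp
      · rw [if_neg hc, if_pos (by linarith)]; simp
    · intro s ω; rw [KKim]; simp
    · intro t ht
      refine (hI₁.2 t ht).congr_left fun n => Eventually.of_forall fun ω => ?_
      simp [rsum]
  have sI₂ : SI μ B₁ B₂ Yc (σ * Complex.I) (ρ * Complex.I) I₂ := by
    refine SI_of (Y := fun t ω => X₁ t ω - X₂ t ω) hYc (H₂ := fun s ω => if X₁ s ω ≤ X₂ s ω then ρ else σ) (H₁ := fun _ _ => 0) ?_ ?_ ?_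
    · intro s ω; rw [KKre]; simp
    · intro s ω
      rw [KKim]
      by_cases hc : X₁ s ω ≤ X₂ s ω
      · rw [if_pos hc, if_neg (by linarith)]; simp
      · rw [if_neg hc, if_pos (by linarith)]; simp
    · intro t ht
      refine (hI₂.2 t ht).congr_left fun n => Eventually.of_forall fun ω => ?_
      simp [rsum]
  have w1 : SI μ B₁ B₂ Yc 1 (-Complex.I) W₁ := by
    refine SI_of (Y := fun t ω => X₁ t ω - X₂ t ω) hYc ?_ ?_ hW₁.2
    · intro s ω; rw [KKre]; simp
    · intro s ω; rw [KKim]; simp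
  have w2 : SI μ B₁ B₂ Yc (-Complex.I) 1 W₂ := by
    refine SI_of (Y := fun t ω => X₁ t ω - X₂ t ω) hYc ?_ ?_ hW₂.2
    · intro s ω; rw [KKre]; simp
    · intro s ω; rw [KKim]; simp
  have key : ∀ ω, G ω → ∀ t, 0 ≤ t →
      X₁ t ω = x₁ + ((g - h) / 2 * t + (-h - g) / 2 * AA Yc t ω) + I₁ t ω ∧
      X₂ t ω = x₂ + ((g - h) / 2 * t + (g + h) / 2 * AA Yc t ω) + I₂ t ω := by
    intro ω hω t ht
    have e1 := drift_int (hYcc ω) (u := fun s => X₁ s ω) (v := fun s => X₂ s ω) g (-h) ht (hYcG ω hω)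
    have e2 := drift_int (hYcc ω) (u := fun s => X₁ s ω) (v := fun s => X₂ s ω) (-h) g ht (hYcG ω hω)
    have := hω.2 t ht
    rw [e1, e2] at this
    constructor
    · rw [this.1]; unfold AA; ring
    · rw [this.2]; unfold AA; ring
  have hH : Core μ F B₁ B₂ Yc ρ σ (g + h) (x₁ - x₂) := by
    refine ⟨hPB, hnull, hYcm, hYcm', hYcc, hgh, hnorm, hρ', hσ', ?_⟩
    have := sI₁.lin sI₂ 1 (-1)
    have h2 := this.congr_ae (J := WW Yc (g + h) (x₁ - x₂)) ?_
    · convert h2 using 1 <;> push_cast <;> ring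
    · intro t ht
      filter_upwards [hG] with ω hω
      have := key ω hω t ht
      unfold WW
      rw [hYcG ω hω t ht]
      linarith [this.1, this.2]
  refine ⟨Yc, fun t ω => X₁ t ω + X₂ t ω - (x₁ + x₂) - (g - h) * t, hH, hYc, w1, w2, ?_, ?_, ?_, ?_, fun _ _ => rfl, fun t ω => by ring⟩
  · have := hH.SI_psgn w1 (rsum_psgn_congr hYc hV₁.2)
    rwa [neg_neg] at this
  · have h1 : ∀ t, 0 ≤ t → TendstoInMeasure μ (fun n => rsum (fun s ω => psgn (X₁ s ω - X₂ s ω)) W₂ t n) atTop ((fun t ω => -V₂ t ω) t) := by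
      intro t ht
      have := tim_lin (-1) 0 (hV₂.2 t ht) (hV₂.2 t ht)
      refine (this.congr_left fun n => Eventually.of_forall fun ω => ?_).congr_right (Eventually.of_forall fun ω => ?_)
      · simp [rsum]
      · simp
    have h2 := (hH.SI_psgn w2 (rsum_psgn_congr hYc h1)).neg
    simpa using h2
  · have := sI₁.lin sI₂ 1 1
    have h2 := this.congr_ae (J := fun t ω => X₁ t ω + X₂ t ω - (x₁ + x₂) - (g - h) * t) ?_
    · convert h2 using 1 <;> push_cast <;> ring
    · intro t ht
      filter_upwards [hG] with ω hω
      have := key ω hω t ht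
      linarith [this.1, this.2]
  · filter_upwards [hG] with ω hω
    exact ((hω.1.1.add hω.1.2).sub continuous_const).sub (by fun_prop)

end build


section compl

/-- the completed sigma-algebra -/
abbrev cms {Ω : Type*} [m : MeasurableSpace Ω] (μ : Measure Ω) : MeasurableSpace Ω :=
  (inferInstance : MeasurableSpace (NullMeasurableSpace Ω μ))

/-- the completed measure -/
abbrev cmu {Ω : Type*} [m : MeasurableSpace Ω] (μ : Measure Ω) : @Measure Ω (cms μ) := μ.completion

lemma le_cms {Ω : Type*} [m : MeasurableSpace Ω] (μ : Measure Ω) : m ≤ cms μ :=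
  fun s hs => MeasurableSet.nullMeasurableSet hs

lemma null_cms {Ω : Type*} [m : MeasurableSpace Ω] (μ : Measure Ω) : NullC μ (cms μ) :=
  fun s hs => NullMeasurableSet.of_null hs

lemma compl_prob {Ω : Type*} [m : MeasurableSpace Ω] (μ : Measure Ω) [IsProbabilityMeasure μ] :
    @IsProbabilityMeasure Ω (cms μ) (cmu μ) :=
  @IsProbabilityMeasure.mk Ω (cms μ) (cmu μ) (measure_univ (μ := μ))

lemma compl_map {Ω : Type*} [m : MeasurableSpace Ω] (μ : Measure Ω) {f : Ω → ℝ} (hf : Measurable f) :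
    @Measure.map Ω ℝ (cms μ) _ f (cmu μ) = μ.map f := by
  ext s hs
  rw [Measure.map_apply hf hs]
  have hf' : @Measurable Ω ℝ (cms μ) _ f := hf.mono (le_cms μ) le_rfl
  rw [@Measure.map_apply Ω ℝ (cms μ) _ (cmu μ) f hf' s hs]
  rfl

lemma isBM_compl {Ω : Type*} [m : MeasurableSpace Ω] {μ : Measure Ω} [IsProbabilityMeasure μ] {F : ℝ → MeasurableSpace Ω}
    {B : ℝ → Ω → ℝ} (hB : IsBM μ F B) : @IsBM Ω (cms μ) (cmu μ) (fun t => augSA μ (F t)) B := by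
  have hm : ∀ t, 0 ≤ t → Measurable (B t) := fun t ht =>
    (measurable_iff_comap_le.2 (hB.adapted t ht)).mono (hB.le t) le_rfl
  have hzero : ∀ᵐ ω ∂μ, B 0 ω = 0 := by
    obtain ⟨_, _, _, h0, _, _, _⟩ := hB
    exact h0
  refine @IsBM.mk Ω (cms μ) (cmu μ) (fun t => augSA μ (F t)) B ?_ ?_ ?_ hzero hB.cont ?_ ?_
  · intro t
    exact augSA_le (null_cms μ) ((hB.le t).trans (le_cms μ))
  · intro s t hst
    exact sup_le_sup_right (hB.mono hst) _
  · intro t ht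
    exact (hB.adapted t ht).trans le_sup_left
  · intro s t hs hst
    exact (compl_map μ ((hm t (hs.trans hst)).sub (hm s hs))).trans (hB.law s t hs hst)
  · intro s t hs hst
    have := (Indep_iff _ _ μ).1 (hB.indep s t hs hst)
    refine (@Indep_iff Ω _ _ (cms μ) (cmu μ)).2 ?_
    intro A C hA hC
    obtain ⟨C', hC', hCC⟩ := augSA_ae hC
    have e := this A C' hA hC'
    rw [← measure_congr hCC, ← measure_congr ((ae_eq_refl A).inter hCC)] at e
    exact e

lemma planar_compl {Ω : Type*} [m : MeasurableSpace Ω] {μ : Measure Ω} [IsProbabilityMeasure μ] {F : ℝ → MeasurableSpace Ω}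
    {B₁ B₂ : ℝ → Ω → ℝ} (hB : IsPlanarBM μ F B₁ B₂) :
    @IsPlanarBM Ω (cms μ) (cmu μ) (fun t => augSA μ (F t)) B₁ B₂ := by
  refine ⟨isBM_compl hB.1, isBM_compl hB.2.1, ?_⟩
  refine (@indepFun_iff_measure_inter_preimage_eq_mul Ω _ _ (cms μ) (cmu μ) _ _ _ _).2 ?_
  exact indepFun_iff_measure_inter_preimage_eq_mul.1 hB.2.2

lemma tim_compl {Ω : Type*} [m : MeasurableSpace Ω] {μ : Measure Ω} {f : ℕ → Ω → ℝ} {g : Ω → ℝ}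
    (h : TendstoInMeasure μ f atTop g) : @TendstoInMeasure Ω ℕ ℝ _ (cms μ) (cmu μ) f atTop g := h

lemma isSI_compl {Ω : Type*} [m : MeasurableSpace Ω] {μ : Measure Ω} {H X I : ℝ → Ω → ℝ} (h : IsSI μ H X I) :
    @IsSI Ω (cms μ) (cmu μ) H X I := ⟨h.1, fun t ht => tim_compl (h.2 t ht)⟩

lemma isSI2_compl {Ω : Type*} [m : MeasurableSpace Ω] {μ : Measure Ω} {H X H' X' I : ℝ → Ω → ℝ} (h : IsSI2 μ H X H' X' I) :
    @IsSI2 Ω (cms μ) (cmu μ) H X H' X' I := ⟨h.1, fun t ht => tim_compl (h.2 t ht)⟩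

lemma solves_compl {Ω : Type*} [m : MeasurableSpace Ω] {μ : Measure Ω} {F : ℝ → MeasurableSpace Ω}
    {g h ρ σ x₁ x₂ : ℝ} {B₁ B₂ X₁ X₂ : ℝ → Ω → ℝ} (H : Solves11 μ F g h ρ σ x₁ x₂ B₁ B₂ X₁ X₂) :
    @Solves11 Ω (cms μ) (cmu μ) (fun t => augSA μ (F t)) g h ρ σ x₁ x₂ B₁ B₂ X₁ X₂ := by
  obtain ⟨h1, h2, I₁, I₂, h3, h4, h5⟩ := H
  exact ⟨fun t ht => (h1 t ht).trans le_sup_left, h2, I₁, I₂, isSI_compl h3, isSI_compl h4, h5⟩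

end compl

/-- Proposition 2 of the paper. In the non-degenerate case `ρσ > 0`
one has, for every `0 < t < ∞`, the filtration relations
`𝔉^{(V₁,V₂)}(t) = 𝔉^{(R₁,R₂)}(t) = 𝔉^{(|Y|,V)}(t) = 𝔉^{(|Y|,Q)}(t)
 ⊊ 𝔉^{(X₁,X₂)}(t) = 𝔉^{(W₁,W₂)}(t) = 𝔉^{(Y,V)}(t) = 𝔉^{(W,U♭)}(t)
 = 𝔉^{(Y,U♭)}(t) = 𝔉^{(W,Q)}(t) = 𝔉^{(Y,Q)}(t)`, with the single inclusion strict. -/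
theorem nondegenerate_filtration_relations
    (g h ρ σ : ℝ) (hg : 0 ≤ g) (hh : 0 ≤ h) (hρ : 0 ≤ ρ) (hσ : 0 ≤ σ)
    (hnorm : ρ ^ 2 + σ ^ 2 = 1) (hgh : 0 < g + h) (hnd : 0 < ρ * σ) (x₁ x₂ : ℝ)
    {Ω : Type*} [mΩ : MeasurableSpace Ω] (μ : Measure Ω) [IsProbabilityMeasure μ]
    (F : ℝ → MeasurableSpace Ω)
    (B₁ B₂ X₁ X₂ Y W₁ W₂ V₁ V₂ W Ufl V Q : ℝ → Ω → ℝ)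
    (hBM : IsPlanarBM μ F B₁ B₂)
    (hsol : Solves11 μ F g h ρ σ x₁ x₂ B₁ B₂ X₁ X₂)
    (hYdef : ∀ t ω, Y t ω = X₁ t ω - X₂ t ω)
    (hW₁ : IsSI2 μ (fun s ω => if 0 < Y s ω then (1:ℝ) else 0) B₁
                   (fun s ω => if 0 < Y s ω then (0:ℝ) else -1) B₂ W₁)
    (hW₂ : IsSI2 μ (fun s ω => if 0 < Y s ω then (0:ℝ) else 1) B₁
                   (fun s ω => if 0 < Y s ω then (-1:ℝ) else 0) B₂ W₂)
    (hV₁ : IsSI μ (fun s ω => psgn (Y s ω)) W₁ V₁)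
    (hV₂ : IsSI μ (fun s ω => -psgn (Y s ω)) W₂ V₂)
    (hWdef : ∀ t ω, W t ω = ρ * W₁ t ω + σ * W₂ t ω)
    (hUfl : ∀ t ω, Ufl t ω = σ * W₁ t ω - ρ * W₂ t ω)
    (hVdef : ∀ t ω, V t ω = ρ * V₁ t ω + σ * V₂ t ω)
    (hQ : ∀ t ω, Q t ω = σ * V₁ t ω + ρ * V₂ t ω) :
    ∀ t : ℝ, 0 < t →
      natFilt μ (fun s ω => (V₁ s ω, V₂ s ω)) t =
          natFilt μ (fun s ω => (max (X₁ s ω) (X₂ s ω), min (X₁ s ω) (X₂ s ω))) t ∧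
      natFilt μ (fun s ω => (max (X₁ s ω) (X₂ s ω), min (X₁ s ω) (X₂ s ω))) t =
          natFilt μ (fun s ω => (|Y s ω|, V s ω)) t ∧
      natFilt μ (fun s ω => (|Y s ω|, V s ω)) t =
          natFilt μ (fun s ω => (|Y s ω|, Q s ω)) t ∧
      natFilt μ (fun s ω => (|Y s ω|, Q s ω)) t <
          natFilt μ (fun s ω => (X₁ s ω, X₂ s ω)) t ∧
      natFilt μ (fun s ω => (X₁ s ω, X₂ s ω)) t =
          natFilt μ (fun s ω => (W₁ s ω, W₂ s ω)) t ∧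
      natFilt μ (fun s ω => (W₁ s ω, W₂ s ω)) t =
          natFilt μ (fun s ω => (Y s ω, V s ω)) t ∧
      natFilt μ (fun s ω => (Y s ω, V s ω)) t =
          natFilt μ (fun s ω => (W s ω, Ufl s ω)) t ∧
      natFilt μ (fun s ω => (W s ω, Ufl s ω)) t =
          natFilt μ (fun s ω => (Y s ω, Ufl s ω)) t ∧
      natFilt μ (fun s ω => (Y s ω, Ufl s ω)) t =
          natFilt μ (fun s ω => (W s ω, Q s ω)) t ∧
      natFilt μ (fun s ω => (W s ω, Q s ω)) t =
          natFilt μ (fun s ω => (Y s ω, Q s ω)) t := by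
  have hp := compl_prob μ
  obtain ⟨Yc, S, Z⟩ := @main_null Ω (cms μ) (cmu μ) hp (fun t => augSA μ (F t)) B₁ B₂ Y g h ρ σ hρ hσ hnorm hgh hnd x₁ x₂
    (nullC_augSA (F 0) μ) X₁ X₂ W₁ W₂ V₁ V₂ (planar_compl hBM) (solves_compl hsol) hYdef
    (isSI2_compl hW₁) (isSI2_compl hW₂) (isSI_compl hV₁) (isSI_compl hV₂)
  exact @Sys.final Ω (cms μ) (cmu μ) hp _ _ _ _ _ _ _ _ _ _ _ _ _ _ _ _ _ _ _ _ _ _ Z hWdef hUfl hVdef hQ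

end SDEPaper
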